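/- Assume R is unmixed of dimension d ≥ 2. Then the following are equivalent: (1) R is Gorenstein; (2) N(R) = 1; (3) f_0(q, R) = 1 for some C-parameter ideal q of R; (4) e_1(q :_R m, R) − e_1(q, R) = 1 for some C-parameter ideal q of R contained in m^{g(R)}. -/

import Mathlib

/-! Preliminary definitions: lengths, dimensions, (C-)systems of parameters, Hilbert
coefficients, irreducible multiplicities, local cohomology invariants, stable values,
unmixedness, the unmixed component, and the g-invariant. -/

open CategoryTheory CategoryTheory.Limits Opposite IsLocalRing

universe u

noncomputable section

section Definitions

variable (R : Type u) [CommRing R]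

/-- The length of an `R`-module, defined as the Krull dimension of its submodule lattice. -/
def moduleLength (M : Type u) [AddCommGroup M] [Module R M] : WithBot ℕ∞ :=
  Order.krullDim (Submodule R M)

/-- The Krull dimension of an `R`-module `M`, i.e. `dim (R / Ann M)`. -/
def moduleDim (M : Type u) [AddCommGroup M] [Module R M] : WithBot ℕ∞ :=
  ringKrullDim (R ⧸ Module.annihilator R M)

/-- The colon submodule `(N :_M I) = {x : M | I • x ⊆ N}`. -/
def modColon {M : Type u} [AddCommGroup M] [Module R M] (N : Submodule R M) (I : Ideal R) :
    Submodule R M where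
  carrier := {x | ∀ r ∈ I, r • x ∈ N}
  add_mem' := by
    intro a b ha hb r hr
    simpa [smul_add] using N.add_mem (ha r hr) (hb r hr)
  zero_mem' := by
    intro r hr
    simpa using N.zero_mem
  smul_mem' := by
    intro c a ha r hr
    rw [smul_comm]
    exact N.smul_mem c (ha r hr)

/-- `x : Fin s → R` is a system of parameters of the module `M`:
`s = dim M`, the `x i` are nonunits, and `M/(x)M` has finite length. -/
def IsSOP (M : Type u) [AddCommGroup M] [Module R M] {s : ℕ} (x : Fin s → R) : Prop :=
  moduleDim R M = (s : WithBot ℕ∞) ∧ (∀ i, x i ∈ nonunits R) ∧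
    IsFiniteLength R (M ⧸ (Ideal.span (Set.range x) • (⊤ : Submodule R M)))

/-- The ideal `b(M)`: the intersection, over all systems of parameters `x` of `M` and all `i`,
of `Ann_R ((0) :_{M/(x_1,...,x_{i-1})M} x_i)`. -/
def bIdeal (M : Type u) [AddCommGroup M] [Module R M] : Ideal R :=
  ⨅ (s : ℕ) (x : Fin s → R) (_ : IsSOP R M x) (i : Fin s),
    (Submodule.torsionBy R
      (M ⧸ (Ideal.span (x '' {j | j < i}) • (⊤ : Submodule R M))) (x i)).annihilator

/-- `x` is a C-system of parameters of `M`: a system of parameters such that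
`x i ∈ b(M/(x_{i+1},...,x_s)M)^3` for every `i` (for `i = s` the quotient is `M` itself). -/
def IsCSOP (M : Type u) [AddCommGroup M] [Module R M] {s : ℕ} (x : Fin s → R) : Prop :=
  IsSOP R M x ∧ ∀ i : Fin s,
    x i ∈ (bIdeal R (M ⧸ (Ideal.span (x '' {j | i < j}) • (⊤ : Submodule R M)))) ^ 3

/-- A parameter ideal of `R`. -/
def IsParamIdeal (q : Ideal R) : Prop :=
  ∃ (s : ℕ) (x : Fin s → R), IsSOP R R x ∧ q = Ideal.span (Set.range x)

/-- A C-parameter ideal of `R`: an ideal generated by a C-system of parameters of `R`. -/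
def IsCParamIdeal (q : Ideal R) : Prop :=
  ∃ (s : ℕ) (x : Fin s → R), IsCSOP R R x ∧ q = Ideal.span (Set.range x)

/-- A C-parameter ideal of a module `M`. -/
def IsCParamIdealMod (M : Type u) [AddCommGroup M] [Module R M] (q : Ideal R) : Prop :=
  ∃ (s : ℕ) (x : Fin s → R), IsCSOP R M x ∧ q = Ideal.span (Set.range x)

/-- `e` is the family of Hilbert coefficients of `M` (of dimension `s`) with respect to `I`:
`ℓ(M/I^{n+1}M) = ∑_{i=0}^{s} (-1)^i (e i) binom(n+s-i, s-i)` for all large `n`. -/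
def IsHilbCoeffMod (I : Ideal R) (M : Type u) [AddCommGroup M] [Module R M] (s : ℕ)
    (e : ℕ → ℤ) : Prop :=
  ∃ N : ℕ, ∀ n ≥ N, ∃ L : ℕ,
    moduleLength R (M ⧸ (I ^ (n + 1) • (⊤ : Submodule R M))) = (L : WithBot ℕ∞) ∧
    (L : ℤ) = ∑ i ∈ Finset.range (s + 1),
      (-1) ^ i * e i * ((n + s - i).choose (s - i) : ℤ)

/-- `e` is the family of Hilbert coefficients of `R` (of dimension `d`) with respect to `I`;
`e 1` is the Chern number of `I`. -/
def IsHilbCoeff (I : Ideal R) (d : ℕ) (e : ℕ → ℤ) : Prop :=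
  IsHilbCoeffMod R I R d e

variable [IsLocalRing R]

/-- The colon ideal `(q :_R m)`. -/
def colonIdeal (q : Ideal R) : Ideal R :=
  modColon R q (maximalIdeal R)

/-- The index of reducibility `ir_M(q) = ℓ((qM :_M m)/qM)`. -/
def irMod (M : Type u) [AddCommGroup M] [Module R M] (q : Ideal R) : WithBot ℕ∞ :=
  moduleLength R
    ↥(Submodule.map (q • (⊤ : Submodule R M)).mkQ
      (modColon R (q • (⊤ : Submodule R M)) (maximalIdeal R)))

/-- `NN` is the stable value `𝒩(M)` of `M`: the common index of reducibility of all
C-parameter ideals of `M`. -/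
def IsStableValueMod (M : Type u) [AddCommGroup M] [Module R M] (NN : ℕ) : Prop :=
  ∀ q : Ideal R, IsCParamIdealMod R M q → irMod R M q = (NN : WithBot ℕ∞)

/-- `NN` is the stable value `𝒩(R)` of `R`. -/
def IsStableValue (NN : ℕ) : Prop :=
  ∀ q : Ideal R, IsCParamIdeal R q → irMod R R q = (NN : WithBot ℕ∞)

/-- `f` is the family of coefficients of the polynomial giving the index of reducibility,
`ir_M(I^{n+1}) = ℓ((I^{n+1}M :_M m)/I^{n+1}M) = ∑_{i=0}^{s-1} (-1)^i (f i) binom(n+s-1-i, s-1-i)`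
for all large `n`; `f 0` is the irreducible multiplicity of `M` with respect to `I`. -/
def IsIrrCoeffMod (I : Ideal R) (M : Type u) [AddCommGroup M] [Module R M] (s : ℕ)
    (f : ℕ → ℤ) : Prop :=
  ∃ N : ℕ, ∀ n ≥ N, ∃ L : ℕ,
    irMod R M (I ^ (n + 1)) = (L : WithBot ℕ∞) ∧
    (L : ℤ) = ∑ i ∈ Finset.range s,
      (-1) ^ i * f i * ((n + s - 1 - i).choose (s - 1 - i) : ℤ)

/-- Ring version of `IsIrrCoeffMod`. -/
def IsIrrCoeff (I : Ideal R) (d : ℕ) (f : ℕ → ℤ) : Prop :=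
  IsIrrCoeffMod R I R d f

/-- The local cohomology module `H^i_m(M)`. -/
def Hmod (M : Type u) [AddCommGroup M] [Module R M] (i : ℕ) : ModuleCat.{u} R :=
  (localCohomology (maximalIdeal R) i).obj (ModuleCat.of R M)

/-- `r_i(M) = ℓ((0) :_{H^i_m(M)} m)`, the length of the socle of `H^i_m(M)`. -/
def rLengthMod (M : Type u) [AddCommGroup M] [Module R M] (i : ℕ) : WithBot ℕ∞ :=
  moduleLength R ↥(Submodule.torsionBySet R ↥(Hmod R M i) ((maximalIdeal R : Ideal R) : Set R))

/-- `r_i(R)`. -/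
def rLength (i : ℕ) : WithBot ℕ∞ := rLengthMod R R i

/-- `M` is a Cohen-Macaulay `R`-module: `H^i_m(M) = 0` for all `i < dim M`. -/
def IsCMMod (M : Type u) [AddCommGroup M] [Module R M] : Prop :=
  ∀ i : ℕ, (i : WithBot ℕ∞) < moduleDim R M → Subsingleton ↥(Hmod R M i)

/-- `R` is a Cohen-Macaulay local ring: `H^i_m(R) = 0` for all `i < dim R`. -/
def IsCMLocal : Prop :=
  ∀ i : ℕ, (i : WithBot ℕ∞) < ringKrullDim R → Subsingleton ↥(Hmod R R i)

/-- `R` is a generalized Cohen-Macaulay local ring: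
`H^i_m(R)` has finite length for all `i < dim R`. -/
def IsGeneralizedCM : Prop :=
  ∀ i : ℕ, (i : WithBot ℕ∞) < ringKrullDim R → IsFiniteLength R ↥(Hmod R R i)

/-- `R` is a Gorenstein local ring: Cohen-Macaulay of type `r_d(R) = 1`, `d = dim R`. -/
def IsGorensteinLocal : Prop :=
  IsCMLocal R ∧ ∀ d : ℕ, ringKrullDim R = (d : WithBot ℕ∞) → rLength R d = (1 : WithBot ℕ∞)

/-- `R` is unmixed: `dim R̂/p = dim R̂` for every associated prime `p` of the
`m`-adic completion `R̂` of `R`. -/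
def IsUnmixedRing : Prop :=
  ∀ p ∈ associatedPrimes (AdicCompletion (maximalIdeal R) R) (AdicCompletion (maximalIdeal R) R),
    ringKrullDim ((AdicCompletion (maximalIdeal R) R) ⧸ p) =
      ringKrullDim (AdicCompletion (maximalIdeal R) R)

/-- `M` is unmixed: `dim R̂/p = dim M̂` for every associated prime `p` of the
`m`-adic completion `M̂` of `M`, viewed over `R̂`. -/
def IsUnmixedMod (M : Type u) [AddCommGroup M] [Module R M] : Prop :=
  ∀ p ∈ associatedPrimes (AdicCompletion (maximalIdeal R) R) (AdicCompletion (maximalIdeal R) M),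
    ringKrullDim ((AdicCompletion (maximalIdeal R) R) ⧸ p) =
      moduleDim (AdicCompletion (maximalIdeal R) R) (AdicCompletion (maximalIdeal R) M)

/-- `H^0_m(M)`, described as the submodule of elements killed by a power of `m`. -/
def H0Sub (M : Type u) [AddCommGroup M] [Module R M] : Submodule R M :=
  ⨆ n : ℕ, Submodule.torsionBySet R M (((maximalIdeal R) ^ n : Ideal R) : Set R)

/-- The unmixed component `u = U_R(0)` of `R`: the largest ideal of dimension `< dim R`. -/
def unmixedComponent : Ideal R := sSup {J : Ideal R | moduleDim R ↥J < ringKrullDim R}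

end Definitions

section CMImage

/-- `R` is a homomorphic image of a Cohen-Macaulay (Noetherian) local ring. -/
def IsHomImageOfCM (R : Type u) [CommRing R] : Prop :=
  ∃ (A : Type u) (_ : CommRing A) (_ : IsLocalRing A) (_ : IsNoetherianRing A),
    IsCMLocal A ∧ ∃ f : A →+* R, Function.Surjective f

end CMImage

section GInvariant

variable (R : Type u) [CommRing R] [IsLocalRing R] [IsNoetherianRing R]

/-- The canonical homomorphism from `Ext^p(R/q, R)` (the term of the directed system indexed by
the ideal `q` with `J ≤ rad q`) into the local cohomology module `H^p_J(R)`, given by the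
structure of `H^p_J(R)` as an inductive limit. -/
def canonicalToLocalCohomology (J q : Ideal R) (h : J ≤ q.radical) (p : ℕ) :
    ((localCohomology.diagram (localCohomology.selfLERadicalDiagram J) p).obj
        (op (⟨q, h⟩ : localCohomology.SelfLERadical J))).obj (ModuleCat.of R R) ⟶
      (localCohomology J p).obj (ModuleCat.of R R) :=
  haveI := localCohomology.hasColimitDiagram.{u, u} (localCohomology.selfLERadicalDiagram J) p
  (colimit.ι (localCohomology.diagram (localCohomology.selfLERadicalDiagram J) p)
      (op (⟨q, h⟩ : localCohomology.SelfLERadical J))).app (ModuleCat.of R R) ≫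
    (localCohomology.isoSelfLERadical J p).hom.app (ModuleCat.of R R)

/-- A map of `R`-modules is surjective on socles. -/
def SurjectiveOnSocles {A B : ModuleCat.{u} R} (φ : A ⟶ B) : Prop :=
  ∀ y ∈ Submodule.torsionBySet R ↥B ((maximalIdeal R : Ideal R) : Set R),
    ∃ z ∈ Submodule.torsionBySet R ↥A ((maximalIdeal R : Ideal R) : Set R), φ z = y

/-- The defining property of the g-invariant: for every system of parameters `x` of `R`
contained in `m^(n₀)` and every `p`, the canonical homomorphism into the local cohomology
module `H^p_m(R)` is surjective on the socles. -/
def GProperty (n₀ : ℕ) : Prop :=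
  ∀ (s : ℕ) (x : Fin s → R), IsSOP R R x → (∀ i, x i ∈ maximalIdeal R ^ n₀) →
    ∀ (h : maximalIdeal R ≤ (Ideal.span (Set.range x)).radical) (p : ℕ),
      SurjectiveOnSocles R
        (canonicalToLocalCohomology R (maximalIdeal R) (Ideal.span (Set.range x)) h p)

/-- The g-invariant `g(R)`: the least `n₀` satisfying `GProperty`. -/
def gInvariant : ℕ := sInf {n₀ : ℕ | GProperty R n₀}

end GInvariant

end

namespace CParam

section Prefix

variable {R : Type u} [CommRing R]

/-- The ideal generated by the first `s` terms of the sequence `x`. -/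
def headIdeal (x : ℕ → R) (s : ℕ) : Ideal R := Ideal.span (x '' {i | i < s})

/-- The ideal generated by the terms of the sequence `x` with index in `[e, d)`. -/
def tailIdeal (x : ℕ → R) (d e : ℕ) : Ideal R := Ideal.span (x '' {i | e ≤ i ∧ i < d})

theorem headIdeal_succ (x : ℕ → R) (s : ℕ) :
    headIdeal x (s + 1) = headIdeal x s ⊔ Ideal.span {x s} := by
  rw [headIdeal, headIdeal, ← Ideal.span_union, ← Set.image_singleton, ← Set.image_union]
  congr 2
  ext i
  simp only [Set.mem_ofPred_eq, Set.mem_union, Set.mem_singleton_iff]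
  omega

theorem headIdeal_mono (x : ℕ → R) {s t : ℕ} (h : s ≤ t) : headIdeal x s ≤ headIdeal x t :=
  Ideal.span_mono (Set.image_mono fun _ hi => lt_of_lt_of_le hi h)

theorem mem_headIdeal (x : ℕ → R) {i s : ℕ} (h : i < s) : x i ∈ headIdeal x s :=
  Ideal.subset_span ⟨i, h, rfl⟩

theorem headIdeal_zero (x : ℕ → R) : headIdeal x 0 = ⊥ := by simp [headIdeal]

theorem tailIdeal_self (x : ℕ → R) (d : ℕ) : tailIdeal x d d = ⊥ := by
  have : {i : ℕ | d ≤ i ∧ i < d} = ∅ := by ext i; simp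
  simp [tailIdeal, this]

theorem tailIdeal_eq (x : ℕ → R) {d e : ℕ} (h : e < d) :
    tailIdeal x d e = tailIdeal x d (e + 1) ⊔ Ideal.span {x e} := by
  rw [tailIdeal, tailIdeal, ← Ideal.span_union, ← Set.image_singleton, ← Set.image_union]
  congr 2
  ext i
  simp only [Set.mem_ofPred_eq, Set.mem_union, Set.mem_singleton_iff]
  omega

/-- The combinatorial consequences of being a C-system of parameters that are used below;
`b (i + 1)` plays the role of `b(R/(x_{i+1}, …))`. -/
structure IsCSeq (x : ℕ → R) (d : ℕ) (b : ℕ → Ideal R) : Prop where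
  mem : ∀ i < d, x i ∈ b (i + 1) ^ 3
  colon_pow : ∀ s j e n u c, s ≤ j → j < e → e ≤ d →
    x j ^ n * u ∈ headIdeal x s ⊔ tailIdeal x d e → c ∈ b e →
      c * u ∈ headIdeal x s ⊔ tailIdeal x d e
  colon_pow_pow : ∀ s j n a u c, s < j → j < d →
    x j ^ n * u ∈ headIdeal x s ⊔ Ideal.span {x s ^ a} → c ∈ b d →
      c * u ∈ headIdeal x s ⊔ Ideal.span {x s ^ a}

namespace IsCSeq

variable {x : ℕ → R} {d : ℕ} {b : ℕ → Ideal R} (hx : IsCSeq x d b)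
include hx

theorem mem_b {i : ℕ} (h : i < d) : x i ∈ b (i + 1) := Ideal.pow_le_self (by norm_num) (hx.mem i h)

theorem last_mul_mem {s e : ℕ} (hs : s ≤ e) (he : e < d) {u : R}
    (h : x s * (x e * u) ∈ headIdeal x s ⊔ tailIdeal x d (e + 1)) :
    x e * u ∈ headIdeal x s ⊔ tailIdeal x d (e + 1) := by
  have h1 := hx.colon_pow s s (e + 1) 1 (x e * u) (x e) le_rfl (by omega) (by omega)
    (by simpa using h) (hx.mem_b he)
  exact hx.colon_pow s e (e + 1) 2 u (x e) hs (by omega) (by omega)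
    (by rwa [pow_two, mul_assoc]) (hx.mem_b he)

theorem mul_mem_aux {s j : ℕ} (hs : s ≤ j) (n : ℕ) : ∀ u, j + 1 + n ≤ d →
    x s * (x j * u) ∈ headIdeal x s ⊔ tailIdeal x d (j + 1 + n) →
    x j * u ∈ headIdeal x s ⊔ tailIdeal x d (j + 1 + n) := by
  induction n with
  | zero => exact fun u hj h => hx.last_mul_mem hs (by omega) h
  | succ n ih =>
    intro u hj h
    have hlt : j + 1 + n < d := by omega
    have h1 := ih u (by omega) (by
      rw [tailIdeal_eq x hlt, ← sup_assoc]; exact Ideal.mem_sup_left h)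
    rw [tailIdeal_eq x hlt, ← sup_assoc] at h1
    obtain ⟨i, hi, z, hz, hiz⟩ := Submodule.mem_sup.1 h1
    obtain ⟨v, rfl⟩ := Ideal.mem_span_singleton'.1 hz
    rw [← hiz] at h ⊢
    refine Ideal.add_mem _ hi ?_
    have h2 : x s * (x (j + 1 + n) * v) ∈ headIdeal x s ⊔ tailIdeal x d (j + 1 + n + 1) := by
      have h4 := Ideal.sub_mem _ h (Ideal.mul_mem_left _ (x s) hi)
      have h5 : x s * (i + v * x (j + 1 + n)) - x s * i = x s * (x (j + 1 + n) * v) := by ring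
      rwa [h5] at h4
    have h3 := hx.last_mul_mem (by omega) hlt h2
    rwa [mul_comm]

/-- Strong `d`-sequence property. -/
theorem mul_mem {s j e : ℕ} (hs : s ≤ j) (hj : j < e) (he : e ≤ d) {u : R}
    (h : x s * (x j * u) ∈ headIdeal x s ⊔ tailIdeal x d e) :
    x j * u ∈ headIdeal x s ⊔ tailIdeal x d e := by
  obtain ⟨n, rfl⟩ := Nat.exists_eq_add_of_le (show j + 1 ≤ e by omega)
  exact hx.mul_mem_aux hs n u he h

theorem mul_mem_head {s j : ℕ} (hs : s ≤ j) (hj : j < d) {u : R}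
    (h : x s * (x j * u) ∈ headIdeal x s) : x j * u ∈ headIdeal x s := by
  have := hx.mul_mem hs hj le_rfl (u := u)
  simpa only [tailIdeal_self, sup_bot_eq, h, true_imp_iff] using this

theorem pow_mul_mem_head {s j n : ℕ} {c u : R} (hs : s ≤ j) (hj : j < d) (hc : c ∈ b d)
    (h : x j ^ n * u ∈ headIdeal x s) : c * u ∈ headIdeal x s := by
  have := hx.colon_pow s j d n u c hs hj le_rfl
  simpa only [tailIdeal_self, sup_bot_eq, h, hc, true_imp_iff] using this

theorem last_mul_mem_head {s j n : ℕ} (hs : s ≤ j) (hj : j < d) {u : R}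
    (h : x j ^ n * u ∈ headIdeal x s) : x (d - 1) * u ∈ headIdeal x s := by
  refine hx.pow_mul_mem_head hs hj ?_ h
  have := hx.mem_b (i := d - 1) (by omega)
  rwa [Nat.sub_add_cancel (by omega)] at this

theorem mem_head_of_mem {v : R} (hv : v ∈ headIdeal x d) {s : ℕ} (hs : s < d)
    (h : x s * v ∈ headIdeal x s) : v ∈ headIdeal x s := by
  have key : ∀ k, ∀ t, t + k = d → s ≤ t → v ∈ headIdeal x t := by
    intro k
    induction k with
    | zero => rintro t rfl -; exact hv
    | succ k ih =>
      intro t ht hst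
      have h1 := ih (t + 1) (by omega) (by omega)
      rw [headIdeal_succ] at h1
      obtain ⟨w, hw, z, hz, rfl⟩ := Submodule.mem_sup.1 h1
      obtain ⟨r, rfl⟩ := Ideal.mem_span_singleton'.1 hz
      refine Ideal.add_mem _ hw ?_
      have h2 : x t * (w + r * x t) ∈ headIdeal x t :=
        headIdeal_mono x hst (hx.mul_mem_head hst (by omega)
          (by rw [mul_left_comm]; exact Ideal.mul_mem_left _ _ h))
      have h3 : x t * (x t * r) ∈ headIdeal x t := by
        have h4 := Ideal.sub_mem _ h2 (Ideal.mul_mem_left _ (x t) hw)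
        have h5 : x t * (w + r * x t) - x t * w = x t * (x t * r) := by ring
        rwa [h5] at h4
      rw [mul_comm]
      exact hx.mul_mem_head le_rfl (by omega) h3
  exact key (d - s) s (by omega) le_rfl

theorem mem_mul_of_mem_pow (n : ℕ) : ∀ k t, t + k = d → ∀ z ∈ headIdeal x t,
    z ∈ headIdeal x d ^ (n + 1) → z ∈ headIdeal x t * headIdeal x d ^ n := by
  induction n with
  | zero => intro k t _ z hz _; simpa using hz
  | succ n ihn =>
    intro k
    induction k with
    | zero =>
      intro t ht z _ hz; obtain rfl : t = d := by omega
      rwa [← pow_succ']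
    | succ k ih =>
      intro t ht z hz hzn
      have h1 := ih (t + 1) (by omega) z (headIdeal_mono x (Nat.le_succ t) hz) hzn
      rw [headIdeal_succ, Ideal.sup_mul] at h1
      obtain ⟨j, hj, w, hw, rfl⟩ := Submodule.mem_sup.1 h1
      obtain ⟨a, ha, rfl⟩ := Ideal.mem_span_singleton_mul.1 hw
      refine Ideal.add_mem _ hj ?_
      have h2 : x t * a ∈ headIdeal x t := by
        have hj' : j ∈ headIdeal x t := Ideal.mul_le_left (J := headIdeal x d ^ (n + 1)) hj
        have := Ideal.sub_mem _ hz hj'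
        rwa [add_sub_cancel_left] at this
      have ha' : a ∈ headIdeal x d := Ideal.pow_le_self (Nat.succ_ne_zero n) ha
      have h3 := hx.mem_head_of_mem ha' (by omega) h2
      have h4 := ihn (k + 1) t ht a h3 ha
      rw [pow_succ, ← mul_assoc, mul_comm (x t)]
      exact Ideal.mul_mem_mul h4 (mem_headIdeal x (by omega))

theorem exists_sub_mem {s n : ℕ} (hs : s < d) {v : R}
    (h : x s * v ∈ headIdeal x s ⊔ headIdeal x d ^ (n + 1)) :
    ∃ w ∈ headIdeal x d ^ n, x s * (v - w) ∈ headIdeal x s := by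
  obtain ⟨j, hj, z, hz, hjz⟩ := Submodule.mem_sup.1 h
  have h1 : z ∈ headIdeal x (s + 1) := by
    have : z = x s * v - j := by rw [← hjz]; ring
    rw [this]
    exact Ideal.sub_mem _ (Ideal.mul_mem_right _ _ (mem_headIdeal x (Nat.lt_succ_self s)))
      (headIdeal_mono x (Nat.le_succ s) hj)
  have h2 := hx.mem_mul_of_mem_pow n (d - (s + 1)) (s + 1) (by omega) z h1 hz
  rw [headIdeal_succ, Ideal.sup_mul] at h2
  obtain ⟨j', hj', z', hz', hjz'⟩ := Submodule.mem_sup.1 h2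
  obtain ⟨w, hw, rfl⟩ := Ideal.mem_span_singleton_mul.1 hz'
  refine ⟨w, hw, ?_⟩
  have : x s * (v - w) = j + j' := by linear_combination -hjz - hjz'
  rw [this]
  exact Ideal.add_mem _ hj (Ideal.mul_le_left (J := headIdeal x d ^ n) hj')

end IsCSeq
end Prefix

section TwoElements

variable {A : Type u} [CommRing A]

/-- The ideal `I : y`. -/
def divIdeal (I : Ideal A) (y : A) : Ideal A := Submodule.comap (LinearMap.mulLeft A y) I

theorem mem_divIdeal {I : Ideal A} {y u : A} : u ∈ divIdeal I y ↔ y * u ∈ I := Iff.rfl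

theorem le_divIdeal (I : Ideal A) (y : A) : I ≤ divIdeal I y := fun _ h => I.mul_mem_left _ h

theorem divIdeal_mono {I J : Ideal A} (h : I ≤ J) (y : A) : divIdeal I y ≤ divIdeal J y :=
  fun _ hu => h hu

/-- The socle of `A/B` has dimension at most one, in elementary terms. -/
def SocleLeOne (M B : Ideal A) : Prop :=
  ∀ u v, (∀ t ∈ M, t * u ∈ B) → (∀ t ∈ M, t * v ∈ B) →
    ∃ c c', c * u + c' * v ∈ B ∧ ¬ (c ∈ M ∧ c' ∈ M)

theorem exists_socle {M B : Ideal A} {k : ℕ} (hk : M ^ k ≤ B) {v : A} (hv : v ∉ B) :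
    ∃ g, g * v ∉ B ∧ ∀ t ∈ M, t * (g * v) ∈ B := by
  classical
  have hex : ∃ n, ∀ g ∈ M ^ n, g * v ∈ B := ⟨k, fun g hg => B.mul_mem_right _ (hk hg)⟩
  obtain ⟨n, hn, hmin⟩ : ∃ n, (∀ g ∈ M ^ n, g * v ∈ B) ∧
      ∀ m < n, ¬ ∀ g ∈ M ^ m, g * v ∈ B :=
    ⟨Nat.find hex, Nat.find_spec hex, fun m hm => Nat.find_min hex hm⟩
  rcases n with - | n
  · exact absurd (by simpa using hn 1 (by simp)) hv
  · have := hmin n (Nat.lt_succ_self n)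
    push Not at this
    obtain ⟨g, hg, hgv⟩ := this
    refine ⟨g, hgv, fun t ht => ?_⟩
    rw [← mul_assoc]
    exact hn _ (by rw [pow_succ']; exact Ideal.mul_mem_mul ht hg)

theorem mul_mul_induction {b : Ideal A} {Q : A → Prop} {g : A} (hg : g ∈ b ^ 3)
    (hadd : ∀ g g', Q g → Q g' → Q (g + g'))
    (hmul : ∀ a ∈ b, ∀ a' ∈ b, ∀ c ∈ b, Q (a * a' * c)) : Q g := by
  rw [pow_succ, pow_two] at hg
  refine Submodule.mul_induction_on hg (fun m hm c hc => ?_) hadd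
  refine Submodule.mul_induction_on (C := fun m => Q (m * c)) hm
    (fun a ha a' ha' => hmul a ha a' ha' c hc) (fun p q hp hq => ?_)
  rw [add_mul]
  exact hadd _ _ hp hq

variable {M b : Ideal A} {y z : A}

theorem exists_common_quotient (hz : ∀ a, z * a = 0 → a = 0) (hy : ∀ a, y * a = 0 → a = 0)
    (hb : ∀ p r, y * p = z * r → ∀ c ∈ b, (∃ t, c * p = z * t) ∧ ∃ t, c * r = y * t)
    {p r c : A} (hpr : y * p = z * r) (hc : c ∈ b) : ∃ t, c * p = z * t ∧ c * r = y * t := by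
  obtain ⟨⟨t, ht⟩, t', ht'⟩ := hb p r hpr c hc
  refine ⟨t, ht, ?_⟩
  have : t' - t = 0 := hy _ (hz _ (by linear_combination y * ht - z * ht' - c * hpr))
  rw [ht', sub_eq_zero.1 this]

/-- The two-dimensional case: a partial normalization argument showing that if the socle modulo
`(z : y) + (y)` is at most one-dimensional, then `z, y` is a regular sequence. -/
theorem dvd_of_socleLeOne (hM : ∀ a, a ∉ M → IsUnit a) (hbM : b ≤ M)
    (hz : ∀ a, z * a = 0 → a = 0) (hy : ∀ a, y * a = 0 → a = 0) (hzb : z ∈ b ^ 3)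
    (hb : ∀ p r, y * p = z * r → ∀ c ∈ b, (∃ t, c * p = z * t) ∧ ∃ t, c * r = y * t)
    (htop : divIdeal (Ideal.span {z}) y ⊔ divIdeal (Ideal.span {y}) z ≠ ⊤)
    {k : ℕ} (hk : M ^ k ≤ divIdeal (Ideal.span {z}) y ⊔ Ideal.span {y})
    (hsoc : SocleLeOne M (divIdeal (Ideal.span {z}) y ⊔ Ideal.span {y}))
    {p r : A} (hpr : y * p = z * r) : ∃ s, p = z * s := by
  have hcq := fun {p r c : A} => exists_common_quotient (p := p) (r := r) (c := c) hz hy hb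
  set B := divIdeal (Ideal.span {z}) y ⊔ Ideal.span {y} with hB
  set C := divIdeal (Ideal.span {z}) y ⊔ divIdeal (Ideal.span {y}) z with hC
  have memZ : ∀ p, p ∈ divIdeal (Ideal.span {z}) y ↔ ∃ r, y * p = z * r := fun p => by
    rw [mem_divIdeal, Ideal.mem_span_singleton]; rfl
  have memY : ∀ r, r ∈ divIdeal (Ideal.span {y}) z ↔ ∃ p, z * r = y * p := fun p => by
    rw [mem_divIdeal, Ideal.mem_span_singleton]; rfl
  have memB : ∀ u, u ∈ B ↔ ∃ p r s, y * p = z * r ∧ u = p + y * s := by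
    intro u
    rw [hB, Submodule.mem_sup]
    constructor
    · rintro ⟨p, hp, w, hw, rfl⟩
      obtain ⟨r, hr⟩ := (memZ p).1 hp
      obtain ⟨s, rfl⟩ := Ideal.mem_span_singleton.1 hw
      exact ⟨p, r, s, hr, rfl⟩
    · rintro ⟨p, r, s, h, rfl⟩
      exact ⟨p, (memZ p).2 ⟨r, h⟩, _, Ideal.mem_span_singleton.2 ⟨s, rfl⟩, rfl⟩
  have hBC : B ≤ C := by
    refine sup_le_sup_left ?_ _
    rw [Ideal.span_singleton_le_iff_mem, memY]
    exact ⟨z, mul_comm _ _⟩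
  by_contra hcon
  -- the element `r` lies in `C` but not in `B`
  have hrB : r ∉ B := by
    intro hr
    obtain ⟨p', r', s, hp', rfl⟩ := (memB r).1 hr
    have : ∃ T, z * p = z * (z * T + z * s) := by
      refine mul_mul_induction (Q := fun g => ∃ T, g * p = z * (z * T + g * s)) hzb ?_ ?_
      · rintro g g' ⟨T, hT⟩ ⟨T', hT'⟩
        exact ⟨T + T', by linear_combination hT + hT'⟩
      · intro a ha a' ha' c hc
        obtain ⟨t₁, h1, h1'⟩ := hcq hp' ha
        obtain ⟨t₂, h2, h2'⟩ := hcq hpr ha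
        obtain ⟨t₃, h3, -⟩ := hcq (p := t₂ - a * s) (r := t₁)
          (by linear_combination -h2' + h1) ha'
        exact ⟨c * t₃, by linear_combination a' * c * h2 + z * c * h3⟩
    obtain ⟨T, hT⟩ := this
    refine hcon ⟨T + s, ?_⟩
    have := hz (p - z * (T + s)) (by linear_combination hT)
    linear_combination this
  have hrC : r ∈ C := Ideal.mem_sup_right ((memY r).2 ⟨p, hpr.symm⟩)
  obtain ⟨g₁, hg₁, hg₁'⟩ := exists_socle hk hrB
  obtain ⟨g₂, hg₂, hg₂'⟩ := exists_socle (hk.trans hBC) (v := 1)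
    (fun h => htop ((Ideal.eq_top_iff_one _).2 h))
  rw [mul_one] at hg₂
  simp only [mul_one] at hg₂'
  have decomp : ∀ c ∈ M, ∃ p₁ r₁ p₂ r₂, y * p₁ = z * r₁ ∧ y * p₂ = z * r₂ ∧
      c * g₂ = p₁ + r₂ := by
    intro c hc
    obtain ⟨p₁, hp₁, r₂, hr₂, h⟩ := Submodule.mem_sup.1 (hg₂' c hc)
    obtain ⟨r₁, hr₁⟩ := (memZ _).1 hp₁
    obtain ⟨p₂, hp₂⟩ := (memY _).1 hr₂
    exact ⟨p₁, r₁, p₂, r₂, hr₁, hp₂.symm, h.symm⟩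
  have key : ∃ L, (∃ w, z * g₂ - z * L = y * w) ∧ ∀ t p₁ r₁ p₂ r₂, y * p₁ = z * r₁ →
      y * p₂ = z * r₂ → t * g₂ = p₁ + r₂ → ∃ v, z * (t * L) = z * p₁ + z * (y * v) := by
    refine mul_mul_induction (Q := fun g => ∃ L, (∃ w, g * g₂ - z * L = y * w) ∧
      ∀ t p₁ r₁ p₂ r₂, y * p₁ = z * r₁ → y * p₂ = z * r₂ → t * g₂ = p₁ + r₂ →
        ∃ v, z * (t * L) = g * p₁ + z * (y * v)) hzb ?_ ?_
    · rintro g g' ⟨L, ⟨w, hw⟩, hL⟩ ⟨L', ⟨w', hw'⟩, hL'⟩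
      refine ⟨L + L', ⟨w + w', by linear_combination hw + hw'⟩, ?_⟩
      intro t p₁ r₁ p₂ r₂ h1 h2 h3
      obtain ⟨v, hv⟩ := hL t p₁ r₁ p₂ r₂ h1 h2 h3
      obtain ⟨v', hv'⟩ := hL' t p₁ r₁ p₂ r₂ h1 h2 h3
      exact ⟨v + v', by linear_combination hv + hv'⟩
    · intro a ha a' ha' c hc
      obtain ⟨p₁, r₁, p₂, r₂, h1, h2, h3⟩ := decomp c (hbM hc)
      obtain ⟨t₁, e1, e1'⟩ := hcq h1 ha
      obtain ⟨t₂, e2, e2'⟩ := hcq h2 ha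
      refine ⟨a' * t₁, ⟨a' * t₂, ?_⟩, ?_⟩
      · linear_combination a * a' * h3 + a' * e1 + a' * e2'
      · intro t p₁' r₁' p₂' r₂' h1' h2' h3'
        obtain ⟨τ₁, f1, -⟩ := hcq h1' ha
        obtain ⟨τ₂, -, f2⟩ := hcq h2' ha
        obtain ⟨s, -, hs⟩ := hcq (p := t * t₂ - c * τ₂) (r := c * τ₁ - t * t₁)
          (by linear_combination c * f1 - t * e1 + c * f2 - t * e2' + a * c * h3' - a * t * h3) ha'
        exact ⟨-s, by linear_combination -a' * c * f1 - z * hs⟩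
  obtain ⟨L, ⟨w, hw⟩, hL⟩ := key
  have hLC : L ∉ C := by
    intro h
    refine hg₂ ?_
    have : g₂ = L + (g₂ - L) := by ring
    rw [this]
    exact Ideal.add_mem _ h (Ideal.mem_sup_right ((memY _).2 ⟨w, by linear_combination hw⟩))
  have hLB : ∀ t ∈ M, t * L ∈ B := by
    intro t ht
    obtain ⟨p₁, r₁, p₂, r₂, h1, h2, h3⟩ := decomp t ht
    obtain ⟨v, hv⟩ := hL t p₁ r₁ p₂ r₂ h1 h2 h3
    refine (memB _).2 ⟨p₁, r₁, v, h1, ?_⟩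
    have := hz (t * L - p₁ - y * v) (by linear_combination hv)
    linear_combination this
  obtain ⟨c, c', hcc, hnot⟩ := hsoc _ _ hg₁' hLB
  have unit_mul : ∀ {I : Ideal A} {c u : A}, c ∉ M → c * u ∈ I → u ∈ I := by
    intro I c u hc h
    obtain ⟨e, rfl⟩ := hM c hc
    exact (Ideal.unit_mul_mem_iff_mem I e.isUnit).1 h
  have hc' : c' ∈ M := by
    by_contra hc'
    refine hLC (unit_mul hc' ?_)
    have := C.sub_mem (hBC hcc) (C.mul_mem_left c (C.mul_mem_left g₁ hrC))
    rwa [add_sub_cancel_left] at this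
  refine hnot ⟨?_, hc'⟩
  by_contra hc
  refine hg₁ (unit_mul hc ?_)
  have := B.sub_mem hcc (hLB c' hc')
  rwa [add_sub_cancel_right] at this

end TwoElements

section Dichotomy

variable {R : Type u} [CommRing R] {x : ℕ → R} {d : ℕ} {b : ℕ → Ideal R}

theorem headIdeal_sup_tailIdeal_last (x : ℕ → R) {s : ℕ} (hd : 0 < d) :
    headIdeal x s ⊔ tailIdeal x d (d - 1) = headIdeal x s ⊔ Ideal.span {x (d - 1)} := by
  rw [tailIdeal_eq x (by omega : d - 1 < d), Nat.sub_add_cancel hd, tailIdeal_self, bot_sup_eq]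

theorem mem_sup_span {I : Ideal R} {a u : R} :
    u ∈ I ⊔ Ideal.span {a} ↔ ∃ i ∈ I, ∃ r, u = i + a * r := by
  rw [Submodule.mem_sup]
  constructor
  · rintro ⟨i, hi, w, hw, rfl⟩
    obtain ⟨r, rfl⟩ := Ideal.mem_span_singleton.1 hw
    exact ⟨i, hi, r, rfl⟩
  · rintro ⟨i, hi, r, rfl⟩
    exact ⟨i, hi, _, Ideal.mem_span_singleton.2 ⟨r, rfl⟩, rfl⟩

namespace IsCSeq

variable (hx : IsCSeq x d b)
include hx

theorem colon_succ_le {s : ℕ} (hs : s + 2 < d)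
    (ih : divIdeal (headIdeal x (s + 2)) (x (d - 1)) ≤
      divIdeal (headIdeal x (s + 1)) (x (d - 1)) ⊔ Ideal.span {x (s + 1)}) :
    divIdeal (headIdeal x (s + 1)) (x (d - 1)) ≤
      divIdeal (headIdeal x s) (x (d - 1)) ⊔ Ideal.span {x s} := by
  intro u hu
  set y := x (d - 1) with hy
  have hI := headIdeal_sup_tailIdeal_last x (d := d) (s := s) (by omega)
  rw [mem_divIdeal, headIdeal_succ, mem_sup_span] at hu
  obtain ⟨j, hj, v, hv⟩ := hu
  have hxv : x s * v ∈ headIdeal x s ⊔ Ideal.span {y} :=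
    mem_sup_span.2 ⟨-j, neg_mem hj, u, by linear_combination -hv⟩
  have h2 : x (s + 1) * v ∈ headIdeal x s ⊔ Ideal.span {y} := by
    rw [← hI] at hxv ⊢
    refine hx.mul_mem (Nat.le_succ s) (by omega) (by omega) ?_
    rw [mul_left_comm]
    exact Ideal.mul_mem_left _ _ hxv
  obtain ⟨j', hj', v₂, hv₂⟩ := mem_sup_span.1 h2
  have h3 : v₂ ∈ divIdeal (headIdeal x (s + 2)) y := by
    have : y * v₂ = x (s + 1) * v - j' := by linear_combination -hv₂
    rw [mem_divIdeal, this]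
    exact Ideal.sub_mem _ (Ideal.mul_mem_right _ _ (mem_headIdeal x (by omega)))
      (headIdeal_mono x (by omega) hj')
  obtain ⟨h₂, hh₂, w, rfl⟩ := mem_sup_span.1 (ih h3)
  have h4 : y * (v - y * w) ∈ headIdeal x (s + 1) := by
    refine hx.last_mul_mem_head (n := 1) le_rfl (by omega) ?_
    have : x (s + 1) ^ 1 * (v - y * w) = j' + y * h₂ := by linear_combination hv₂
    rw [this]
    exact Ideal.add_mem _ (headIdeal_mono x (Nat.le_succ s) hj') hh₂
  rw [headIdeal_succ, mem_sup_span] at h4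
  obtain ⟨j₄, hj₄, r, hr⟩ := h4
  have h5 : y * (u - x s * w) ∈ headIdeal x s ⊔ Ideal.span {x s ^ 2} := by
    refine hx.colon_pow_pow s (d - 1) 2 2 _ y (by omega) (by omega) ?_ ?_
    · exact mem_sup_span.2 ⟨y * j + x s * j₄,
        Ideal.add_mem _ (Ideal.mul_mem_left _ _ hj) (Ideal.mul_mem_left _ _ hj₄), r,
        by linear_combination y * hv + x s * hr⟩
    · have := hx.mem_b (i := d - 1) (by omega)
      rwa [Nat.sub_add_cancel (by omega)] at this
  obtain ⟨j₅, hj₅, v', hv'⟩ := mem_sup_span.1 h5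
  have h6 : x s * v' ∈ headIdeal x s ⊔ Ideal.span {y} := by
    rw [← hI]
    refine hx.mul_mem le_rfl (by omega) (by omega) ?_
    rw [hI]
    exact mem_sup_span.2 ⟨-j₅, neg_mem hj₅, u - x s * w, by linear_combination -hv'⟩
  obtain ⟨j₆, hj₆, v'', hv''⟩ := mem_sup_span.1 h6
  refine mem_sup_span.2 ⟨u - x s * w - x s * v'', ?_, w + v'', by ring⟩
  have : y * (u - x s * w - x s * v'') = j₅ + x s * j₆ := by
    linear_combination hv' + x s * hv''
  rw [mem_divIdeal, this]
  exact Ideal.add_mem _ hj₅ (Ideal.mul_mem_left _ _ hj₆)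

variable [IsLocalRing R]

theorem exists_socle_lift (hd : 0 < d) {v : R}
    (hv : ∀ t ∈ maximalIdeal R,
      t * v ∈ divIdeal (headIdeal x (d - 1)) (x (d - 1)) ⊔ Ideal.span {x (d - 1)}) :
    ∃ L, (∀ t ∈ maximalIdeal R, t * L ∈ headIdeal x d) ∧
      v - L ∈ divIdeal (headIdeal x (d - 1)) (x (d - 1)) := by
  set y := x (d - 1) with hy
  set J := headIdeal x (d - 1) with hJ
  have hq : headIdeal x d = J ⊔ Ideal.span {y} := by
    rw [hJ, hy, ← headIdeal_succ, Nat.sub_add_cancel hd]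
  have hbU : ∀ c ∈ b d, ∀ h ∈ divIdeal J y, c * h ∈ J := fun c hc h hh =>
    hx.pow_mul_mem_head (n := 1) le_rfl (by omega) hc (by rw [pow_one]; exact hh)
  have hUU : ∀ h, y * h ∈ divIdeal J y → h ∈ divIdeal J y := fun h hh =>
    hx.last_mul_mem_head (n := 2) le_rfl (by omega) (by rw [pow_two, mul_assoc]; exact hh)
  have hy3 : y ∈ b d ^ 3 := by
    have := hx.mem (d - 1) (by omega)
    rwa [Nat.sub_add_cancel hd] at this
  by_cases hbm : b d ≤ maximalIdeal R
  · have : ∃ L, y * v - y * L ∈ J ∧ ∀ t v' h, t * v = h + y * v' → h ∈ divIdeal J y →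
        t * L - y * v' ∈ J := by
      refine mul_mul_induction (Q := fun g => ∃ L, g * v - y * L ∈ J ∧
        ∀ t v' h, t * v = h + y * v' → h ∈ divIdeal J y → t * L - g * v' ∈ J) hy3 ?_ ?_
      · rintro g g' ⟨L, h1, h2⟩ ⟨L', h1', h2'⟩
        refine ⟨L + L', ?_, fun t v' h e hh => ?_⟩
        · convert J.add_mem h1 h1' using 1; ring
        · convert J.add_mem (h2 t v' h e hh) (h2' t v' h e hh) using 1; ring
      · intro a ha a' ha' c hc
        obtain ⟨h, hh, v₁, e₁⟩ := mem_sup_span.1 (hv c (hbm hc))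
        refine ⟨a * a' * v₁, ?_, fun t v' h' e hh' => ?_⟩
        · convert J.mul_mem_left a (hbU a' ha' h hh) using 1
          linear_combination a * a' * e₁
        · have h1 : t * v₁ - c * v' ∈ divIdeal J y := by
            refine hUU _ ?_
            convert Ideal.sub_mem _ (Ideal.mul_mem_left _ c hh') (Ideal.mul_mem_left _ t hh) using 1
            linear_combination c * e - t * e₁
          convert J.mul_mem_left a (hbU a' ha' _ h1) using 1
          ring
    obtain ⟨L, h1, h2⟩ := this
    refine ⟨L, fun t ht => ?_, ?_⟩
    · obtain ⟨h, hh, v₁, e₁⟩ := mem_sup_span.1 (hv t ht)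
      rw [hq, mem_sup_span]
      exact ⟨_, h2 t v₁ h e₁ hh, v₁, by ring⟩
    · rw [mem_divIdeal, mul_sub]
      exact h1
  · have h1 : (1 : R) ∈ b d := by
      rw [← Ideal.eq_top_iff_one]
      by_contra h
      exact hbm (le_maximalIdeal h)
    have hUJ : divIdeal J y ≤ J := fun h hh => by simpa using hbU 1 h1 h hh
    exact ⟨v, fun t ht => by rw [hq]; exact sup_le_sup_right hUJ _ (hv t ht), by simp⟩

theorem colon_last_le (hd : 2 ≤ d)
    (hqm : headIdeal x d ≤ maximalIdeal R)
    (hgen : ∀ w ∈ maximalIdeal R, ∀ n, ¬ headIdeal x d ^ n ≤ headIdeal x (d - 2) ⊔ Ideal.span {w})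
    {k : ℕ} (hk : maximalIdeal R ^ k ≤ headIdeal x d)
    (hsoc : SocleLeOne (maximalIdeal R)
      (divIdeal (headIdeal x (d - 1)) (x (d - 1)) ⊔ Ideal.span {x (d - 1)})) :
    divIdeal (headIdeal x (d - 1)) (x (d - 1)) ≤
      divIdeal (headIdeal x (d - 2)) (x (d - 1)) ⊔ Ideal.span {x (d - 2)} := by
  set y := x (d - 1) with hy
  set z := x (d - 2) with hz
  set J := headIdeal x (d - 2) with hJ
  set U := divIdeal J y with hU
  have hJ' : headIdeal x (d - 1) = J ⊔ Ideal.span {z} := by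
    rw [hJ, hz, ← headIdeal_succ]; congr 1; omega
  have hq : headIdeal x d = J ⊔ Ideal.span {z} ⊔ Ideal.span {y} := by
    rw [← hJ', hy, ← headIdeal_succ, Nat.sub_add_cancel (by omega)]
  rw [hJ'] at hsoc ⊢
  have hzm : z ∈ maximalIdeal R := hqm (mem_headIdeal x (by omega))
  have hym : y ∈ maximalIdeal R := hqm (mem_headIdeal x (by omega))
  have hI : J ⊔ tailIdeal x d (d - 1) = J ⊔ Ideal.span {y} :=
    headIdeal_sup_tailIdeal_last x (by omega)
  have hzU : ∀ a, z * a ∈ U → a ∈ U := fun a ha => by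
    rw [hU, mem_divIdeal, mul_left_comm] at ha
    exact hx.mul_mem_head (by omega) (by omega) ha
  have hyU : ∀ a, y * a ∈ U → a ∈ U := fun a ha =>
    hx.last_mul_mem_head (s := d - 2) (j := d - 1) (n := 2) (by omega) (by omega)
      (by rw [pow_two, mul_assoc]; exact ha)
  have hJU : J ≤ U := le_divIdeal _ _
  have hUZ : U ≤ divIdeal (J ⊔ Ideal.span {z}) y := divIdeal_mono le_sup_left _
  -- comparison of the colon ideals modulo `U` and modulo `J`
  have hcmp : ∀ p r, y * p - z * r ∈ U → ∃ r', r - r' ∈ U ∧ y * p - z * r' ∈ J := by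
    intro p r h
    have h1 : y * p ∈ headIdeal x (d - 1) := by
      refine hx.last_mul_mem_head (j := d - 1) (n := 2) le_rfl (by omega) ?_
      rw [hJ', mem_sup_span]
      exact ⟨y * (y * p - z * r), h, y * r, by rw [← hy]; ring⟩
    rw [hJ', mem_sup_span] at h1
    obtain ⟨j, hj, r', hr'⟩ := h1
    refine ⟨r', hzU _ ?_, by rw [hr']; simpa using hj⟩
    have := U.sub_mem (hJU hj) h
    convert this using 1
    linear_combination hr'
  have hUm : U ≤ maximalIdeal R := by
    refine le_maximalIdeal fun htop => hgen z hzm 1 ?_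
    have : y * 1 ∈ J := by rw [← mem_divIdeal, ← hU, htop]; trivial
    rw [pow_one, hq, sup_le_iff]
    refine ⟨le_rfl, (Ideal.span_singleton_le_iff_mem _).2 (Ideal.mem_sup_left ?_)⟩
    simpa using this
  let π := Ideal.Quotient.mk U
  have hπ : ∀ a, π a = 0 ↔ a ∈ U := fun a => Ideal.Quotient.eq_zero_iff_mem
  have hπs : Function.Surjective π := Ideal.Quotient.mk_surjective
  have hπ2 : ∀ a c, π a = π c ↔ a - c ∈ U := fun a c => Ideal.Quotient.eq
  have hπm : ∀ a, π a ∈ (maximalIdeal R).map π ↔ a ∈ maximalIdeal R := by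
    intro a
    rw [← Ideal.mem_comap, Ideal.comap_map_of_surjective π hπs, ← RingHom.ker_eq_comap_bot,
      Ideal.mk_ker, sup_eq_left.2 hUm]
  have hZ : ∀ p, π p ∈ divIdeal (Ideal.span {π z}) (π y) ↔
      p ∈ divIdeal (J ⊔ Ideal.span {z}) y := by
    intro p
    rw [mem_divIdeal, mem_divIdeal, Ideal.mem_span_singleton]
    constructor
    · rintro ⟨r, hr⟩
      obtain ⟨r, rfl⟩ := hπs r
      rw [← map_mul, ← map_mul, hπ2] at hr
      obtain ⟨r', -, h⟩ := hcmp p r hr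
      exact mem_sup_span.2 ⟨_, h, r', by ring⟩
    · intro h
      obtain ⟨j, hj, r, hr⟩ := mem_sup_span.1 h
      refine ⟨π r, ?_⟩
      rw [← map_mul, ← map_mul, hπ2, hr]
      simpa using hJU hj
  have hB : ∀ p, π p ∈ divIdeal (Ideal.span {π z}) (π y) ⊔ Ideal.span {π y} ↔
      p ∈ divIdeal (J ⊔ Ideal.span {z}) y ⊔ Ideal.span {y} := by
    intro p
    rw [mem_sup_span, mem_sup_span]
    constructor
    · rintro ⟨i, hi, r, h⟩
      obtain ⟨i, rfl⟩ := hπs i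
      obtain ⟨r, rfl⟩ := hπs r
      rw [← map_mul, ← map_add, hπ2] at h
      exact ⟨p - y * r, by
        have := Ideal.add_mem _ (hUZ h) ((hZ i).1 hi)
        convert this using 1; ring, r, by ring⟩
    · rintro ⟨i, hi, r, rfl⟩
      exact ⟨π i, (hZ i).2 hi, π r, by simp⟩
  have hb : ∀ p r, y * p - z * r ∈ U → ∀ c ∈ b (d - 1), ∃ t, c * p - z * t ∈ U ∧
      c * r - y * t ∈ U := by
    intro p r h c hc
    obtain ⟨r', hr', hj⟩ := hcmp p r h
    have h1 : c * r' ∈ J ⊔ Ideal.span {y} := by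
      have := hx.colon_pow (d - 2) (d - 2) (d - 1) 1 r' c le_rfl (by omega) (by omega)
      rw [hI] at this
      refine this ?_ hc
      exact mem_sup_span.2 ⟨_, neg_mem hj, p, by rw [hz]; ring⟩
    obtain ⟨j', hj', t, ht⟩ := mem_sup_span.1 h1
    refine ⟨t, ?_, ?_⟩
    · rw [hU, mem_divIdeal]
      convert J.add_mem (J.mul_mem_left c hj) (J.mul_mem_left z hj') using 1
      linear_combination z * ht
    · convert U.add_mem (U.mul_mem_left c hr') (hJU hj') using 1
      linear_combination ht
  have hb' : ∀ p r, π y * p = π z * r → ∀ c ∈ (b (d - 1)).map π,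
      (∃ t, c * p = π z * t) ∧ ∃ t, c * r = π y * t := by
    intro p r h c hc
    obtain ⟨p, rfl⟩ := hπs p
    obtain ⟨r, rfl⟩ := hπs r
    obtain ⟨c, hc', rfl⟩ := (Ideal.mem_map_iff_of_surjective π hπs).1 hc
    rw [← map_mul, ← map_mul, hπ2] at h
    obtain ⟨t, h1, h2⟩ := hb p r h c hc'
    refine ⟨⟨π t, ?_⟩, π t, ?_⟩ <;> rw [← map_mul, ← map_mul, hπ2] <;> assumption
  have hfin : ∀ u, u ∈ divIdeal (J ⊔ Ideal.span {z}) y → (∃ s, π u = π z * s) →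
      u ∈ U ⊔ Ideal.span {z} := by
    rintro u - ⟨s, hs⟩
    obtain ⟨s, rfl⟩ := hπs s
    rw [← map_mul, hπ2] at hs
    exact mem_sup_span.2 ⟨_, hs, s, by ring⟩
  intro u hu
  refine hfin u hu ?_
  obtain ⟨r, hr⟩ := Ideal.mem_span_singleton.1 ((hZ u).2 hu)
  by_cases hbm : b (d - 1) ≤ maximalIdeal R
  · refine dvd_of_socleLeOne (M := (maximalIdeal R).map π) (b := (b (d - 1)).map π)
      (k := k) ?_ (Ideal.map_mono hbm) ?_ ?_ ?_ hb' ?_ ?_ ?_ hr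
    · intro a ha
      obtain ⟨a, rfl⟩ := hπs a
      rw [hπm] at ha
      exact (by simpa using ha : IsUnit a).map π
    · intro a ha
      obtain ⟨a, rfl⟩ := hπs a
      rw [← map_mul, hπ] at ha
      exact (hπ a).2 (hzU a ha)
    · intro a ha
      obtain ⟨a, rfl⟩ := hπs a
      rw [← map_mul, hπ] at ha
      exact (hπ a).2 (hyU a ha)
    · have := hx.mem (d - 2) (by omega)
      rw [show d - 2 + 1 = d - 1 by omega] at this
      rw [← Ideal.map_pow]
      exact Ideal.mem_map_of_mem π this
    · intro htop
      have h1 := (Ideal.eq_top_iff_one _).1 htop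
      obtain ⟨p, hp, r, hr, hpr⟩ := Submodule.mem_sup.1 h1
      obtain ⟨p, rfl⟩ := hπs p
      obtain ⟨r, rfl⟩ := hπs r
      have h2 : p + r - 1 ∈ U := by rw [← hπ2]; simpa using hpr
      have h3 : ¬ (p ∈ maximalIdeal R ∧ r ∈ maximalIdeal R) := by
        rintro ⟨h, h'⟩
        have := Ideal.sub_mem _ (Ideal.add_mem _ h h') (hUm h2)
        exact (Ideal.ne_top_iff_one _).1 (IsLocalRing.maximalIdeal.isMaximal R).ne_top
          (by simp at this)
      by_cases hpm : p ∈ maximalIdeal R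
      · have hrm : IsUnit r := by
          have : r ∉ maximalIdeal R := fun h => h3 ⟨hpm, h⟩
          simpa using this
        rw [mem_divIdeal, Ideal.mem_span_singleton] at hr
        obtain ⟨s, hs⟩ := hr
        obtain ⟨s, rfl⟩ := hπs s
        rw [← map_mul, ← map_mul, hπ2] at hs
        obtain ⟨r', hr'⟩ := hrm.exists_right_inv
        set h := z - y * (s * r') with hh
        have hhU : y * h ∈ J := by
          rw [← mem_divIdeal, ← hU]
          convert U.mul_mem_left r' hs using 1
          rw [hh]
          linear_combination -z * hr'
        have hyhm : y + h ∈ maximalIdeal R :=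
          Ideal.add_mem _ hym (Ideal.sub_mem _ hzm (Ideal.mul_mem_right _ _ hym))
        refine hgen (y + h) hyhm 2 ?_
        rw [pow_two, Ideal.mul_le]
        have hdec : ∀ a ∈ headIdeal x d, ∃ j ∈ J, ∃ α β, a = j + α * y + β * h := by
          intro a ha
          rw [hq, mem_sup_span] at ha
          obtain ⟨i, hi, e, rfl⟩ := ha
          obtain ⟨j, hj, f, rfl⟩ := mem_sup_span.1 hi
          exact ⟨j, hj, e + f * (s * r'), f, by rw [hh]; ring⟩
        intro a ha c hc
        obtain ⟨j, hj, α, β, rfl⟩ := hdec a ha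
        obtain ⟨j', hj', α', β', rfl⟩ := hdec c hc
        refine mem_sup_span.2 ⟨j * (j' + α' * y + β' * h) + (α * y + β * h) * j' +
          (α * β' + α' * β - α * α' - β * β') * (y * h), ?_, α * α' * y + β * β' * h, by ring⟩
        exact J.add_mem (J.add_mem (J.mul_mem_right _ hj) (J.mul_mem_left _ hj'))
          (J.mul_mem_left _ hhU)
      · have hpm : IsUnit p := by simpa using hpm
        rw [hZ, mem_divIdeal] at hp
        refine hgen z hzm 1 ?_
        rw [pow_one, hq, sup_le_iff]
        refine ⟨le_rfl, (Ideal.span_singleton_le_iff_mem _).2 ?_⟩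
        exact (Ideal.mul_unit_mem_iff_mem _ hpm).1 hp
    · rw [← Ideal.map_pow, Ideal.map_le_iff_le_comap]
      intro a ha
      rw [Ideal.mem_comap, hB]
      have hle : J ⊔ Ideal.span {z} ⊔ Ideal.span {y} ≤
          divIdeal (J ⊔ Ideal.span {z}) y ⊔ Ideal.span {y} :=
        sup_le_sup_right (le_divIdeal _ _) _
      exact hle (hq ▸ hk ha)
    · intro v w hv hw
      obtain ⟨v, rfl⟩ := hπs v
      obtain ⟨w, rfl⟩ := hπs w
      obtain ⟨c, c', h1, h2⟩ := hsoc v w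
        (fun t ht => by rw [← hB, map_mul]; exact hv _ (Ideal.mem_map_of_mem π ht))
        (fun t ht => by rw [← hB, map_mul]; exact hw _ (Ideal.mem_map_of_mem π ht))
      refine ⟨π c, π c', by rw [← map_mul, ← map_mul, ← map_add, hB]; exact h1, ?_⟩
      rwa [hπm, hπm]
  · have h1 : (1 : R) ∈ b (d - 1) := by
      rw [← Ideal.eq_top_iff_one]
      by_contra h
      exact hbm (le_maximalIdeal h)
    have := (hb' _ _ hr (π 1) (Ideal.mem_map_of_mem π h1)).1
    simpa using this

theorem isRegular_of_socleLeOne (hd : 2 ≤ d)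
    (hqm : headIdeal x d ≤ maximalIdeal R)
    (hgen : ∀ w ∈ maximalIdeal R, ∀ n, ¬ headIdeal x d ^ n ≤ headIdeal x (d - 2) ⊔ Ideal.span {w})
    {k : ℕ} (hk : maximalIdeal R ^ k ≤ headIdeal x d)
    (hsoc : SocleLeOne (maximalIdeal R)
      (divIdeal (headIdeal x (d - 1)) (x (d - 1)) ⊔ Ideal.span {x (d - 1)}))
    (hreg : ∀ u, x (d - 1) * u = 0 → u = 0) :
    (∀ s < d, ∀ u, x s * u ∈ headIdeal x s → u ∈ headIdeal x s) ∧
      SocleLeOne (maximalIdeal R) (headIdeal x d) := by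
  have step : ∀ n s, s + 1 + n = d - 1 → divIdeal (headIdeal x (s + 1)) (x (d - 1)) ≤
      divIdeal (headIdeal x s) (x (d - 1)) ⊔ Ideal.span {x s} := by
    intro n
    induction n with
    | zero =>
      intro s hs
      obtain rfl : d = s + 2 := by omega
      exact hx.colon_last_le hd hqm hgen hk hsoc
    | succ n ih => exact fun s hs => hx.colon_succ_le (by omega) (ih (s + 1) (by omega))
  have hU : ∀ s, s < d → divIdeal (headIdeal x s) (x (d - 1)) ≤ headIdeal x s := by
    intro s
    induction s with
    | zero => intro _ u hu; simpa [mem_divIdeal, headIdeal_zero] using hreg u (by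
        simpa [mem_divIdeal, headIdeal_zero] using hu)
    | succ s ih =>
      intro hs
      refine (step (d - 1 - (s + 1)) s (by omega)).trans ?_
      rw [headIdeal_succ]
      exact sup_le_sup_right (ih (by omega)) _
  refine ⟨fun s hs u hu => hU s hs (hx.last_mul_mem_head (n := 1) le_rfl hs (by simpa using hu)), ?_⟩
  have : divIdeal (headIdeal x (d - 1)) (x (d - 1)) = headIdeal x (d - 1) :=
    le_antisymm (hU _ (by omega)) (le_divIdeal _ _)
  rwa [this, ← headIdeal_succ, Nat.sub_add_cancel (by omega)] at hsoc

theorem exists_socle_pair (hd : 0 < d)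
    (hsoc : ¬ SocleLeOne (maximalIdeal R)
      (divIdeal (headIdeal x (d - 1)) (x (d - 1)) ⊔ Ideal.span {x (d - 1)})) :
    ∃ u : Fin 2 → R, (∀ j, ∀ t ∈ maximalIdeal R, t * u j ∈ headIdeal x d) ∧
      ∀ c : Fin 2 → R, ∑ j, c j * u j ∈
        headIdeal x d ⊔ divIdeal (headIdeal x (d - 1)) (x (d - 1)) → ∀ j, c j ∈ maximalIdeal R := by
  simp only [SocleLeOne, not_forall] at hsoc
  obtain ⟨u, v, hu, hv, h⟩ := hsoc
  push Not at h
  obtain ⟨u', hu', huu⟩ := hx.exists_socle_lift hd hu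
  obtain ⟨v', hv', hvv⟩ := hx.exists_socle_lift hd hv
  have hle : headIdeal x d ⊔ divIdeal (headIdeal x (d - 1)) (x (d - 1)) ≤
      divIdeal (headIdeal x (d - 1)) (x (d - 1)) ⊔ Ideal.span {x (d - 1)} := by
    refine sup_le ?_ le_sup_left
    have := headIdeal_succ x (d - 1)
    rw [Nat.sub_add_cancel hd] at this
    rw [this]
    exact sup_le_sup_right (le_divIdeal _ _) _
  refine ⟨![u', v'], ?_, ?_⟩
  · intro j; fin_cases j
    · exact hu'
    · exact hv'
  · intro c hc
    have h1 := hle hc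
    have h2 := h (c 0) (c 1) (by
      have h3 := Ideal.add_mem _ h1 (Ideal.mem_sup_left (T := Ideal.span {x (d - 1)})
        (Ideal.add_mem _ (Ideal.mul_mem_left _ (c 0) huu) (Ideal.mul_mem_left _ (c 1) hvv)))
      convert h3 using 1
      simp [Fin.sum_univ_two]; ring)
    intro j; fin_cases j
    · exact h2.1
    · exact h2.2

end IsCSeq

end Dichotomy

open MvPolynomial

section Homogeneous

variable {R : Type u} [CommRing R] {d : ℕ}

theorem headIdeal_eq_span_range (x : ℕ → R) (d : ℕ) :
    headIdeal x d = Ideal.span (Set.range fun i : Fin d => x i) := by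
  rw [headIdeal]
  congr 1
  ext a
  constructor
  · rintro ⟨i, hi, rfl⟩
    exact ⟨⟨i, hi⟩, rfl⟩
  · rintro ⟨i, rfl⟩
    exact ⟨i, i.2, rfl⟩

theorem prod_pow_mem_pow {x : Fin d → R} {q : Ideal R} (hx : ∀ i, x i ∈ q) (α : Fin d →₀ ℕ) :
    ∏ i, x i ^ α i ∈ q ^ α.degree := by
  rw [Finsupp.degree_eq_sum, ← Finset.prod_pow_eq_pow_sum]
  exact Ideal.prod_mem_prod fun i _ => Ideal.pow_mem_pow (hx i) _

theorem eval_mem_pow {x : Fin d → R} {q : Ideal R} (hx : ∀ i, x i ∈ q)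
    {F : MvPolynomial (Fin d) R} {n : ℕ} (hF : F.IsHomogeneous n) : eval x F ∈ q ^ n := by
  rw [eval_eq']
  refine Ideal.sum_mem _ fun α hα => Ideal.mul_mem_left _ _ ?_
  have := prod_pow_mem_pow hx α
  rwa [Decidable.of_not_not (mt hF.coeff_eq_zero (mem_support_iff.1 hα))] at this

theorem exists_eval_eq {x : Fin d → R} {n : ℕ} {a : R}
    (ha : a ∈ Ideal.span (Set.range x) ^ n) :
    ∃ F : MvPolynomial (Fin d) R, F.IsHomogeneous n ∧ eval x F = a := by
  induction n generalizing a with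
  | zero => exact ⟨C a, isHomogeneous_C _ _, eval_C _⟩
  | succ n ih =>
    rw [pow_succ] at ha
    refine Submodule.mul_induction_on ha ?_ ?_
    · intro p hp r hr
      obtain ⟨F, hF, rfl⟩ := ih hp
      obtain ⟨c, rfl⟩ := (Ideal.mem_span_range_iff_exists_fun).1 hr
      refine ⟨F * ∑ i, C (c i) * X i, hF.mul ?_, by simp⟩
      exact IsHomogeneous.sum _ _ _ fun i _ => by
        simpa using (isHomogeneous_C _ (c i)).mul (isHomogeneous_X R i)
    · rintro p r ⟨F, hF, rfl⟩ ⟨G, hG, rfl⟩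
      exact ⟨F + G, hF.add hG, by simp⟩

theorem isHomogeneous_divMonomial_single {F : MvPolynomial (Fin d) R} {n : ℕ}
    (hF : F.IsHomogeneous (n + 1)) (i : Fin d) :
    (F.divMonomial (Finsupp.single i 1)).IsHomogeneous n := by
  intro α hα
  rw [coeff_divMonomial] at hα
  have := hF hα
  simp [Finsupp.weight_apply, Finsupp.sum_add_index', Finsupp.sum_single_index] at this ⊢
  omega

end Homogeneous

namespace IsCSeq

variable {R : Type u} [CommRing R] {x : ℕ → R} {d : ℕ} {b : ℕ → Ideal R}
variable (hx : IsCSeq x d b)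
include hx

theorem coeff_mem {A : Ideal R} {ι : Type*} [Fintype ι] {u : ι → R}
    (hAu : ∀ j, ∀ t ∈ A, t * u j ∈ headIdeal x d)
    (hu : ∀ c : ι → R, ∑ j, c j * u j ∈
      headIdeal x d ⊔ divIdeal (headIdeal x (d - 1)) (x (d - 1)) → ∀ j, c j ∈ A)
    (n : ℕ) : ∀ k s, s + k = d → ∀ F : ι → MvPolynomial (Fin d) R, (∀ j, (F j).IsHomogeneous n) →
      ∑ j, eval (fun i : Fin d => x i) (F j) * u j ∈ headIdeal x s ⊔ headIdeal x d ^ (n + 1) →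
      ∀ j α, (∀ i : Fin d, (i : ℕ) < s → α i = 0) → coeff α (F j) ∈ A := by
  have hxq : ∀ i : Fin d, x i ∈ headIdeal x d := fun i => mem_headIdeal x i.2
  have hC : ∀ F : ι → MvPolynomial (Fin d) R, (∀ j, (F j).IsHomogeneous 0) →
      ∑ j, eval (fun i : Fin d => x i) (F j) * u j ∈
        headIdeal x d ⊔ divIdeal (headIdeal x (d - 1)) (x (d - 1)) →
      ∀ j α, coeff α (F j) ∈ A := by
    intro F hF h j α
    have hFC : ∀ j, F j = C (coeff 0 (F j)) := fun j =>
      totalDegree_eq_zero_iff_eq_C.1 (Nat.le_zero.1 (hF j).totalDegree_le)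
    by_cases hα : α = 0
    · subst hα
      refine hu (fun j => coeff 0 (F j)) ?_ j
      convert h using 3 with j
      conv_rhs => rw [hFC j, eval_C]
    · rw [hFC, coeff_C, if_neg (Ne.symm hα)]
      exact A.zero_mem
  induction n with
  | zero =>
    intro k s hk F hF h j α _
    refine hC F hF (Ideal.mem_sup_left ?_) j α
    rw [zero_add, pow_one, sup_eq_right.2 (headIdeal_mono x (by omega))] at h
    exact h
  | succ n ihn =>
    intro k
    induction k with
    | zero =>
      intro s hk F hF h j α hα
      have : α = 0 := by ext i; exact hα i (by omega)
      rw [this, (hF j).coeff_eq_zero (by simp)]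
      exact A.zero_mem
    | succ k ihk =>
      intro s hk F hF h
      have hs : s < d := by omega
      set σ : Fin d := ⟨s, hs⟩ with hσ
      have h1 := ihk (s + 1) (by omega) F hF (sup_le_sup_right (headIdeal_mono x (by omega)) _ h)
      set B : ι → MvPolynomial (Fin d) R := fun j => (F j).divMonomial (Finsupp.single σ 1) with hB
      have hBh : ∀ j, (B j).IsHomogeneous n := fun j => isHomogeneous_divMonomial_single (hF j) σ
      have hrem : ∀ j, eval (fun i : Fin d => x i) ((F j).modMonomial (Finsupp.single σ 1)) * u j ∈
          headIdeal x s ⊔ headIdeal x d ^ (n + 1 + 1) := by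
        intro j
        rw [eval_eq', Finset.sum_mul]
        refine Ideal.sum_mem _ fun β hβ => ?_
        have hβs : ¬ Finsupp.single σ 1 ≤ β := fun hle =>
          mem_support_iff.1 hβ (coeff_modMonomial_of_le _ hle)
        have hβ0 : β σ = 0 := by
          by_contra h0
          exact hβs (by simpa [Finsupp.single_le_iff] using Nat.one_le_iff_ne_zero.2 h0)
        have hco := coeff_modMonomial_of_not_le (F j) hβs
        rw [hco]
        by_cases hβi : ∃ i : Fin d, (i : ℕ) < s ∧ β i ≠ 0
        · obtain ⟨i, hi, hi0⟩ := hβi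
          refine Ideal.mem_sup_left (Ideal.mul_mem_right _ _ (Ideal.mul_mem_left _ _ ?_))
          exact Ideal.mem_of_dvd _ (Finset.dvd_prod_of_mem (fun i : Fin d => x i ^ β i)
            (Finset.mem_univ i)) (Ideal.pow_mem_of_mem _ (mem_headIdeal x hi) _
            (Nat.pos_of_ne_zero hi0))
        · push Not at hβi
          have hcA := h1 j β fun i hi => by
            rcases Nat.lt_succ_iff_lt_or_eq.1 hi with hi | hi
            · exact hβi i hi
            · rw [show i = σ from Fin.ext hi]; exact hβ0
          refine Ideal.mem_sup_right ?_
          have hdeg : β.degree = n + 1 := by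
            by_contra h0
            exact mem_support_iff.1 hβ (hco.trans ((hF j).coeff_eq_zero h0))
          have h2 := Ideal.mul_mem_mul (prod_pow_mem_pow (x := fun i : Fin d => x i) hxq β)
            (hAu j _ hcA)
          rw [hdeg, ← pow_succ] at h2
          convert h2 using 1
          ring
      have hv : x s * ∑ j, eval (fun i : Fin d => x i) (B j) * u j ∈
          headIdeal x s ⊔ headIdeal x d ^ (n + 1 + 1) := by
        have h2 := Ideal.sub_mem _ h (Ideal.sum_mem _ fun j (_ : j ∈ Finset.univ) => hrem j)
        convert h2 using 1
        rw [← Finset.sum_sub_distrib, Finset.mul_sum]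
        refine Finset.sum_congr rfl fun j _ => ?_
        have := congrArg (eval fun i : Fin d => x i) (divMonomial_add_modMonomial_single (F j) σ)
        rw [map_add, map_mul, eval_X] at this
        rw [← this]
        ring
      obtain ⟨w, hw, hvw⟩ := hx.exists_sub_mem hs hv
      intro j α hα
      by_cases hασ : α σ = 0
      · refine h1 j α fun i hi => ?_
        rcases Nat.lt_succ_iff_lt_or_eq.1 hi with hi | hi
        · exact hα i hi
        · rw [show i = σ from Fin.ext hi]; exact hασ
      have hle : Finsupp.single σ 1 ≤ α := by
        simpa [Finsupp.single_le_iff] using Nat.one_le_iff_ne_zero.2 hασ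
      have hcα : coeff α (F j) = coeff (α - Finsupp.single σ 1) (B j) := by
        rw [hB, coeff_divMonomial, add_tsub_cancel_of_le hle]
      rw [hcα]
      have hα' : ∀ i : Fin d, (i : ℕ) < s → (α - Finsupp.single σ 1 : Fin d →₀ ℕ) i = 0 := fun i hi => by
        simp [hα i hi]
      rcases Nat.eq_zero_or_pos n with rfl | hn
      · refine hC B hBh ?_ j _
        rw [zero_add, pow_one] at hw
        have h3 := hx.last_mul_mem_head (n := 1) le_rfl hs (by rw [pow_one]; exact hvw)
        have h4 := Submodule.add_mem_sup hw (show _ ∈ divIdeal (headIdeal x (d - 1)) (x (d - 1)) from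
          headIdeal_mono x (by omega) h3)
        rwa [add_sub_cancel] at h4
      · refine ihn (k + 1) s hk B hBh ?_ j _ hα'
        have hvn : ∑ j, eval (fun i : Fin d => x i) (B j) * u j ∈ headIdeal x d ^ n :=
          Ideal.sum_mem _ fun j _ => Ideal.mul_mem_right _ _ (eval_mem_pow hxq (hBh j))
        have h3 := hx.mem_head_of_mem (Ideal.pow_le_self (by omega)
          (Ideal.sub_mem _ hvn (Ideal.pow_le_pow_right (by omega) hw))) hs hvw
        have h4 := Submodule.add_mem_sup h3 hw
        rwa [sub_add_cancel] at h4

/-- The case `s = 0` of `IsCSeq.coeff_mem`: the coefficients of a relation lie in `A`. -/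
theorem coeff_mem_of_sum_mem {A : Ideal R} {ι : Type*} [Fintype ι] {u : ι → R}
    (hAu : ∀ j, ∀ t ∈ A, t * u j ∈ headIdeal x d)
    (hu : ∀ c : ι → R, ∑ j, c j * u j ∈
      headIdeal x d ⊔ divIdeal (headIdeal x (d - 1)) (x (d - 1)) → ∀ j, c j ∈ A)
    {n : ℕ} {F : ι → MvPolynomial (Fin d) R} (hF : ∀ j, (F j).IsHomogeneous n)
    (h : ∑ j, eval (fun i : Fin d => x i) (F j) * u j ∈ headIdeal x d ^ (n + 1)) (j : ι)
    (α : Fin d →₀ ℕ) : coeff α (F j) ∈ A :=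
  hx.coeff_mem hAu hu n d 0 (zero_add d) F hF (Ideal.mem_sup_right h) j α fun i hi => by omega

end IsCSeq

section Length

variable {R : Type u} [CommRing R]

theorem moduleLength_eq (M : Type u) [AddCommGroup M] [Module R M] :
    moduleLength R M = (Module.length R M : WithBot ℕ∞) := (Module.coe_length R M).symm

theorem length_quotient_eq_add {M : Type*} [AddCommGroup M] [Module R M] {N P : Submodule R M}
    (h : N ≤ P) : Module.length R (M ⧸ N) =
      Module.length R (P.map N.mkQ) + Module.length R (M ⧸ P) := by
  refine Module.length_eq_add_of_exact (P.map N.mkQ).subtype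
    (Submodule.liftQ N P.mkQ (by simpa using h)) (Submodule.subtype_injective _) ?_ ?_
  · intro a
    obtain ⟨a, rfl⟩ := P.mkQ_surjective a
    exact ⟨N.mkQ a, by simp⟩
  · intro a
    obtain ⟨a, rfl⟩ := N.mkQ_surjective a
    simp only [Submodule.mkQ_apply, Submodule.liftQ_apply,
      Submodule.Quotient.mk_eq_zero, Submodule.coe_subtype, Subtype.range_coe_subtype,
      Set.mem_ofPred_eq, Submodule.mem_map]
    constructor
    · exact fun h => ⟨a, h, rfl⟩
    · rintro ⟨c, hc, e⟩
      rw [Submodule.Quotient.eq] at e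
      simpa using P.sub_mem hc (h e)

theorem length_map_mkQ_mono {M : Type*} [AddCommGroup M] [Module R M] {N P P' : Submodule R M}
    (h : P ≤ P') : Module.length R (P.map N.mkQ) ≤ Module.length R (P'.map N.mkQ) :=
  Module.length_le_of_injective _ (Submodule.inclusion_injective (Submodule.map_mono h))

theorem card_finsuppAntidiag_univ {d : ℕ} (hd : 0 < d) (n : ℕ) :
    ((Finset.univ : Finset (Fin d)).finsuppAntidiag n).card = (n + d - 1).choose (d - 1) := by
  rw [Finset.card_finsuppAntidiag_nat_eq_choose, Finset.card_univ, Fintype.card_fin,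
    Nat.choose_symm_of_eq_add (b := d - 1) (by omega), add_comm d n]

variable {d : ℕ} {x : Fin d → R} {q A : Ideal R} {ι : Type*} [Fintype ι] {u : ι → R}

theorem range_linearCombination_monomials (hq : q = Ideal.span (Set.range x)) (n : ℕ) :
    LinearMap.range (Fintype.linearCombination R
      (fun p : ι × ((Finset.univ : Finset (Fin d)).finsuppAntidiag n) =>
        (∏ i, x i ^ p.2.1 i) * u p.1)) = q ^ n * Ideal.span (Set.range u) := by
  have hxq : ∀ i, x i ∈ q := fun i => hq ▸ Ideal.subset_span ⟨i, rfl⟩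
  rw [Fintype.range_linearCombination]
  refine le_antisymm (Submodule.span_le.2 ?_) ?_
  · rintro _ ⟨⟨j, α, hα⟩, rfl⟩
    refine Ideal.mul_mem_mul ?_ (Ideal.subset_span ⟨j, rfl⟩)
    have := prod_pow_mem_pow hxq α
    rw [Finset.mem_finsuppAntidiag] at hα
    rwa [Finsupp.degree_eq_sum, hα.1] at this
  · rw [Ideal.mul_le]
    intro a ha c hc
    obtain ⟨r, rfl⟩ := Ideal.mem_span_range_iff_exists_fun.1 hc
    rw [Finset.mul_sum]
    refine Submodule.sum_mem _ fun j _ => ?_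
    rw [hq] at ha
    obtain ⟨F, hF, rfl⟩ := exists_eval_eq ha
    rw [eval_eq', Finset.sum_mul]
    refine Submodule.sum_mem _ fun α hα => ?_
    have hα' : α ∈ (Finset.univ : Finset (Fin d)).finsuppAntidiag n := by
      have h1 : α.degree = n := by
        by_contra h0
        exact mem_support_iff.1 hα (hF.coeff_eq_zero h0)
      rw [Finset.mem_finsuppAntidiag]
      exact ⟨by rw [← h1, Finsupp.degree_eq_sum], Finset.subset_univ _⟩
    have h2 := Submodule.smul_mem _ (coeff α F * r j) (Submodule.subset_span (R := R)
      (s := Set.range fun p : ι × ((Finset.univ : Finset (Fin d)).finsuppAntidiag n) =>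
        (∏ i, x i ^ p.2.1 i) * u p.1) ⟨(j, ⟨α, hα'⟩), rfl⟩)
    convert h2 using 1
    simp only [smul_eq_mul]
    ring

theorem length_map_pow_mul_span (hd : 0 < d) (hq : q = Ideal.span (Set.range x))
    (hAu : ∀ j, ∀ t ∈ A, t * u j ∈ q) {n : ℕ}
    (hA : ∀ F : ι → MvPolynomial (Fin d) R, (∀ j, (F j).IsHomogeneous n) →
      ∑ j, eval x (F j) * u j ∈ q ^ (n + 1) → ∀ j α, coeff α (F j) ∈ A) :
    Module.length R (Submodule.map (q ^ (n + 1)).mkQ (q ^ n * Ideal.span (Set.range u))) =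
      ((Fintype.card ι * (n + d - 1).choose (d - 1) : ℕ) : ℕ∞) * Module.length R (R ⧸ A) := by
  classical
  have hxq : ∀ i, x i ∈ q := fun i => hq ▸ Ideal.subset_span ⟨i, rfl⟩
  rw [← range_linearCombination_monomials hq n, ← LinearMap.range_comp]
  set κ := ι × ((Finset.univ : Finset (Fin d)).finsuppAntidiag n) with hκ
  set φ := (q ^ (n + 1)).mkQ ∘ₗ Fintype.linearCombination R
      (fun p : κ => (∏ i, x i ^ p.2.1 i) * u p.1) with hφ
  have hker : LinearMap.ker φ = Submodule.pi Set.univ fun _ : κ => A := by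
    ext c
    rw [LinearMap.mem_ker, hφ, LinearMap.comp_apply, Submodule.mkQ_apply,
      Submodule.Quotient.mk_eq_zero, Fintype.linearCombination_apply]
    constructor
    · intro hc p _
      let F : ι → MvPolynomial (Fin d) R := fun j =>
        ∑ α : (Finset.univ : Finset (Fin d)).finsuppAntidiag n, monomial α.1 (c (j, α))
      have hF : ∀ j, (F j).IsHomogeneous n := fun j => IsHomogeneous.sum _ _ _ fun α _ => by
        refine isHomogeneous_monomial _ ?_
        exact (Finsupp.degree_eq_sum _).trans (Finset.mem_finsuppAntidiag.1 α.2).1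
      have h1 := hA F hF (by
        convert hc using 1
        rw [Fintype.sum_prod_type]
        refine Finset.sum_congr rfl fun j _ => ?_
        rw [map_sum, Finset.sum_mul]
        refine Finset.sum_congr rfl fun α _ => ?_
        rw [eval_monomial, Finsupp.prod_fintype _ _ (by simp), smul_eq_mul, mul_assoc]) p.1 p.2.1
      rw [coeff_sum, Finset.sum_eq_single p.2] at h1
      · simpa using h1
      · intro α _ hα
        rw [coeff_monomial, if_neg (fun h => hα (Subtype.ext h))]
      · simp
    · intro hc
      refine Ideal.sum_mem _ fun p _ => ?_
      have h1 : ∏ i, x i ^ p.2.1 i ∈ q ^ n := by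
        have := prod_pow_mem_pow hxq p.2.1
        rwa [Finsupp.degree_eq_sum, (Finset.mem_finsuppAntidiag.1 p.2.2).1] at this
      rw [smul_eq_mul, mul_left_comm, pow_succ]
      exact Ideal.mul_mem_mul h1 (hAu _ _ (hc p trivial))
  rw [← φ.quotKerEquivRange.length_eq, hker, (Submodule.quotientPi _).length_eq,
    Module.length_pi, ENat.card_eq_coe_fintype_card, Fintype.card_prod, Fintype.card_coe,
    card_finsuppAntidiag_univ hd]

theorem length_map_pow_mul_span_le (hd : 0 < d) (hq : q = Ideal.span (Set.range x))
    (hAu : ∀ j, ∀ t ∈ A, t * u j ∈ q) (n : ℕ) :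
    Module.length R (Submodule.map (q ^ (n + 1)).mkQ (q ^ n * Ideal.span (Set.range u))) ≤
      ((Fintype.card ι * (n + d - 1).choose (d - 1) : ℕ) : ℕ∞) * Module.length R (R ⧸ A) := by
  classical
  have hxq : ∀ i, x i ∈ q := fun i => hq ▸ Ideal.subset_span ⟨i, rfl⟩
  rw [← range_linearCombination_monomials hq n, ← LinearMap.range_comp]
  set κ := ι × ((Finset.univ : Finset (Fin d)).finsuppAntidiag n) with hκ
  set φ := (q ^ (n + 1)).mkQ ∘ₗ Fintype.linearCombination R
      (fun p : κ => (∏ i, x i ^ p.2.1 i) * u p.1) with hφ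
  have hker : (Submodule.pi Set.univ fun _ : κ => A) ≤ LinearMap.ker φ := by
    intro c hc
    rw [LinearMap.mem_ker, hφ, LinearMap.comp_apply, Submodule.mkQ_apply,
      Submodule.Quotient.mk_eq_zero, Fintype.linearCombination_apply]
    refine Ideal.sum_mem _ fun p _ => ?_
    have h1 : ∏ i, x i ^ p.2.1 i ∈ q ^ n := by
      have := prod_pow_mem_pow hxq p.2.1
      rwa [Finsupp.degree_eq_sum, (Finset.mem_finsuppAntidiag.1 p.2.2).1] at this
    rw [smul_eq_mul, mul_left_comm, pow_succ]
    exact Ideal.mul_mem_mul h1 (hAu _ _ (hc p trivial))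
  rw [← φ.quotKerEquivRange.length_eq]
  refine (Module.length_le_of_surjective _ (Submodule.factor_surjective hker)).trans_eq ?_
  rw [(Submodule.quotientPi _).length_eq,
    Module.length_pi, ENat.card_eq_coe_fintype_card, Fintype.card_prod, Fintype.card_coe,
    card_finsuppAntidiag_univ hd]

end Length

section Numeric

theorem choose_add_le_of_le {n k l : ℕ} (h : l ≤ k) : (n + l).choose l ≤ (n + k).choose k := by
  rw [← Nat.choose_symm_of_eq_add rfl, ← Nat.choose_symm_of_eq_add (n := n + k) rfl]
  exact Nat.choose_le_choose n (by omega)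

theorem nonneg_of_sum_choose_nonneg {d N : ℕ} {g : ℕ → ℤ}
    (h : ∀ n ≥ N, 0 ≤ ∑ i ∈ Finset.range (d + 1), g i * ((n + d - i).choose (d - i) : ℤ)) :
    0 ≤ g 0 := by
  by_contra hg
  push Not at hg
  rcases d with _ | d
  · have := h N le_rfl
    simp at this
    omega
  · set G := ∑ i ∈ Finset.range (d + 1), |g (i + 1)| with hG
    obtain ⟨n, hn, hnG⟩ : ∃ n ≥ N, ((d + 1 : ℕ) : ℤ) * G < n + d + 1 :=
      ⟨N + ((d + 1 : ℕ) * G).toNat, by omega, by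
        have := Int.self_le_toNat ((d + 1 : ℕ) * G)
        push_cast at *
        omega⟩
    have h1 := h n hn
    rw [Finset.sum_range_succ'] at h1
    have h2 : ∑ i ∈ Finset.range (d + 1),
        g (i + 1) * ((n + (d + 1) - (i + 1)).choose (d + 1 - (i + 1)) : ℤ) ≤
        G * ((n + d).choose d : ℤ) := by
      rw [hG, Finset.sum_mul]
      refine Finset.sum_le_sum fun i hi => ?_
      have hid : i ≤ d := by simpa [Nat.lt_succ_iff] using hi
      have e1 : n + (d + 1) - (i + 1) = n + (d - i) := by omega
      have e2 : d + 1 - (i + 1) = d - i := by omega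
      rw [e1, e2]
      have h3 : ((n + (d - i)).choose (d - i) : ℤ) ≤ ((n + d).choose d : ℤ) :=
        Int.ofNat_le.2 (choose_add_le_of_le (by omega))
      calc g (i + 1) * ((n + (d - i)).choose (d - i) : ℤ)
          ≤ |g (i + 1)| * ((n + (d - i)).choose (d - i) : ℤ) :=
            mul_le_mul_of_nonneg_right (le_abs_self _) (by positivity)
        _ ≤ _ := mul_le_mul_of_nonneg_left h3 (abs_nonneg _)
    have h4 : ((n + d).choose d : ℤ) * (n + d + 1) = ((n + (d + 1)).choose (d + 1) : ℤ) * (d + 1) := by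
      have := Nat.add_one_mul_choose_eq (n + d) d
      rw [show n + d + 1 = n + (d + 1) by ring] at this
      push_cast [← Int.natCast_inj] at this
      linarith
    have h5 : 0 < ((n + d).choose d : ℤ) := by
      exact_mod_cast Nat.choose_pos (by omega)
    simp only [tsub_zero] at h1
    have h6 : ((n + (d + 1)).choose (d + 1) : ℤ) ≤ G * ((n + d).choose d : ℤ) := by
      have : 0 ≤ ((n + (d + 1)).choose (d + 1) : ℤ) := by positivity
      nlinarith
    have h7 : ((n + d).choose d : ℤ) * (n + d + 1) ≤ ((n + d).choose d : ℤ) * ((d + 1) * G) := by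
      rw [h4]
      nlinarith
    have h8 := le_of_mul_le_mul_left h7 h5
    push_cast at hnG
    linarith

end Numeric

section Interface

variable {R : Type u} [CommRing R]

theorem moduleLength_quotient_smul_top (I : Ideal R) :
    moduleLength R (R ⧸ (I • (⊤ : Submodule R R))) = (Module.length R (R ⧸ I) : WithBot ℕ∞) := by
  rw [moduleLength_eq, smul_eq_mul, Ideal.mul_top]

theorem isHilbCoeff_iff {I : Ideal R} {d : ℕ} {e : ℕ → ℤ} : IsHilbCoeff R I d e ↔
    ∃ N : ℕ, ∀ n ≥ N, ∃ L : ℕ, Module.length R (R ⧸ I ^ (n + 1)) = (L : ℕ∞) ∧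
      (L : ℤ) = ∑ i ∈ Finset.range (d + 1),
        (-1) ^ i * e i * ((n + d - i).choose (d - i) : ℤ) := by
  have h (n L : ℕ) : moduleLength R (R ⧸ (I ^ (n + 1) • (⊤ : Submodule R R))) =
      (L : WithBot ℕ∞) ↔ Module.length R (R ⧸ I ^ (n + 1)) = (L : ℕ∞) := by
    rw [moduleLength_quotient_smul_top]
    exact WithBot.coe_inj (b := (L : ℕ∞))
  exact exists_congr fun N => forall₂_congr fun n _ => exists_congr fun L =>
    and_congr_left fun _ => h n L

variable [IsLocalRing R]

theorem mem_colonIdeal {I : Ideal R} {a : R} :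
    a ∈ colonIdeal R I ↔ ∀ r ∈ maximalIdeal R, r * a ∈ I := Iff.rfl

theorem le_colonIdeal (I : Ideal R) : I ≤ colonIdeal R I := fun _ ha r _ => I.mul_mem_left r ha

theorem irMod_eq (I : Ideal R) : irMod R R I =
    (Module.length R (Submodule.map I.mkQ (colonIdeal R I)) : WithBot ℕ∞) := by
  have h : (I • (⊤ : Submodule R R)) = I := by rw [smul_eq_mul, Ideal.mul_top]
  have h2 : irMod R R I = moduleLength R (Submodule.map (I • (⊤ : Submodule R R)).mkQ
    (modColon R (I • (⊤ : Submodule R R)) (maximalIdeal R))) := rfl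
  rw [h2, h, moduleLength_eq]
  rfl

theorem isIrrCoeff_iff {I : Ideal R} {d : ℕ} {f : ℕ → ℤ} : IsIrrCoeff R I d f ↔
    ∃ N : ℕ, ∀ n ≥ N, ∃ L : ℕ,
      Module.length R (Submodule.map (I ^ (n + 1)).mkQ (colonIdeal R (I ^ (n + 1)))) = (L : ℕ∞) ∧
      (L : ℤ) = ∑ i ∈ Finset.range d,
        (-1) ^ i * f i * ((n + d - 1 - i).choose (d - 1 - i) : ℤ) := by
  have h (n L : ℕ) : irMod R R (I ^ (n + 1)) = (L : WithBot ℕ∞) ↔ Module.length R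
      (Submodule.map (I ^ (n + 1)).mkQ (colonIdeal R (I ^ (n + 1)))) = (L : ℕ∞) := by
    rw [irMod_eq]
    exact WithBot.coe_inj (b := (L : ℕ∞))
  exact exists_congr fun N => forall₂_congr fun n _ => exists_congr fun L =>
    and_congr_left fun _ => h n L

theorem length_residue : Module.length R (R ⧸ maximalIdeal R) = 1 := by
  rw [Module.length_eq_one_iff, isSimpleModule_iff_isCoatom]
  exact (maximalIdeal.isMaximal R).out

end Interface

section LinForm

variable {R : Type u} [CommRing R] {d : ℕ}

/-- The linear form with coefficients `c`. -/
noncomputable def linForm (c : Fin d → R) : MvPolynomial (Fin d) R := ∑ i, C (c i) * X i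

theorem linForm_isHomogeneous (c : Fin d → R) : (linForm c).IsHomogeneous 1 :=
  IsHomogeneous.sum _ _ _ fun i _ => by
    simpa using (isHomogeneous_C _ (c i)).mul (isHomogeneous_X R i)

theorem eval_linForm (x c : Fin d → R) : eval x (linForm c) = ∑ i, c i * x i := by
  simp [linForm]

theorem coeff_linForm (c : Fin d → R) (i : Fin d) :
    coeff (Finsupp.single i 1) (linForm c) = c i := by
  simp only [linForm, coeff_sum, coeff_C_mul, coeff_X]
  rw [Finset.sum_eq_single i]
  · simp
  · intro j _ hj
    rw [if_neg, mul_zero]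
    simpa [Finsupp.single_left_inj] using hj
  · simp

theorem mem_maximalIdeal_of_map_linForm [IsLocalRing R] {c : Fin d → R}
    (h : MvPolynomial.map (IsLocalRing.residue R) (linForm c) = 0) (i : Fin d) :
    c i ∈ maximalIdeal R := by
  rw [← coeff_linForm c i, ← IsLocalRing.residue_eq_zero_iff, ← coeff_map, h, coeff_zero]

end LinForm

namespace IsCSeq

variable {R : Type u} [CommRing R] [IsLocalRing R] {x : ℕ → R} {d : ℕ} {b : ℕ → Ideal R}
  {u : Fin 2 → R}
variable (hx : IsCSeq x d b) (hd : 0 < d)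
  (hmu : ∀ j, ∀ t ∈ maximalIdeal R, t * u j ∈ headIdeal x d)
  (hu : ∀ c : Fin 2 → R, ∑ j, c j * u j ∈
    headIdeal x d ⊔ divIdeal (headIdeal x (d - 1)) (x (d - 1)) → ∀ j, c j ∈ maximalIdeal R)
include hx hmu hu

theorem socle_pair_mem {n : ℕ} {F : Fin 2 → MvPolynomial (Fin d) R}
    (hF : ∀ j, (F j).IsHomogeneous n)
    (h : ∑ j, eval (fun i : Fin d => x i) (F j) * u j ∈ headIdeal x d ^ (n + 1)) (j : Fin 2) :
    MvPolynomial.map (IsLocalRing.residue R) (F j) = 0 := by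
  ext α
  rw [coeff_map, coeff_zero, IsLocalRing.residue_eq_zero_iff]
  exact hx.coeff_mem_of_sum_mem hmu hu hF h j α

theorem socle_pair_map_eq_zero {n : ℕ} {F G : MvPolynomial (Fin d) R}
    (hF : F.IsHomogeneous n) (hG : G.IsHomogeneous n)
    (h : eval (fun i : Fin d => x i) F * u 0 + eval (fun i : Fin d => x i) G * u 1 ∈
      headIdeal x d ^ (n + 1)) :
    MvPolynomial.map (IsLocalRing.residue R) F = 0 ∧
      MvPolynomial.map (IsLocalRing.residue R) G = 0 := by
  have h1 := hx.socle_pair_mem hmu hu (n := n) (F := ![F, G]) (by simp [Fin.forall_fin_two, hF, hG])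
    (by simpa [Fin.sum_univ_two] using h)
  exact ⟨h1 0, h1 1⟩

include hd in
theorem length_socle_pair (n : ℕ) :
    Module.length R (Submodule.map (headIdeal x d ^ (n + 1)).mkQ
      (headIdeal x d ^ n * Ideal.span (Set.range u))) =
      ((2 * (n + d - 1).choose (d - 1) : ℕ) : ℕ∞) := by
  rw [length_map_pow_mul_span hd (headIdeal_eq_span_range x d) hmu
    (fun F hF h => hx.coeff_mem_of_sum_mem hmu hu hF h), length_residue, mul_one, Fintype.card_fin]

omit hx hu in
theorem span_le_colonIdeal : Ideal.span (Set.range u) ≤ colonIdeal R (headIdeal x d) := by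
  rw [Ideal.span_le]
  rintro _ ⟨j, rfl⟩
  exact hmu j

include hd in
theorem two_mul_choose_le_length_colonIdeal (n : ℕ) :
    ((2 * (n + d - 1).choose (d - 1) : ℕ) : ℕ∞) ≤
      Module.length R (Submodule.map (headIdeal x d ^ (n + 1)).mkQ
        (colonIdeal R (headIdeal x d ^ (n + 1)))) := by
  rw [← hx.length_socle_pair hd hmu hu n]
  refine length_map_mkQ_mono ?_
  rw [Ideal.mul_le]
  intro a ha c hc r hr
  rw [smul_eq_mul, mul_left_comm, pow_succ]
  exact Ideal.mul_mem_mul ha (span_le_colonIdeal hmu hc r hr)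

include hd in
theorem irMod_ne_one : irMod R R (headIdeal x d) ≠ 1 := by
  rw [irMod_eq]
  intro h
  have h1 := hx.two_mul_choose_le_length_colonIdeal hd hmu hu 0
  rw [zero_add, pow_one] at h1
  have h2 : Module.length R (Submodule.map (headIdeal x d).mkQ (colonIdeal R (headIdeal x d))) = 1 :=
    by exact_mod_cast h
  rw [h2] at h1
  norm_num at h1

include hd in
theorem irr_coeff_ne_one {f : ℕ → ℤ} (hf : IsIrrCoeff R (headIdeal x d) d f) : f 0 ≠ 1 := by
  obtain ⟨N, hN⟩ := isIrrCoeff_iff.1 hf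
  obtain ⟨k, rfl⟩ : ∃ k, d = k + 1 := ⟨d - 1, by omega⟩
  have := nonneg_of_sum_choose_nonneg (d := k) (N := N)
    (g := fun i => (-1) ^ i * f i - if i = 0 then 2 else 0) fun n hn => by
      obtain ⟨L, h1, h2⟩ := hN n hn
      have h3 := hx.two_mul_choose_le_length_colonIdeal hd hmu hu n
      rw [h1] at h3
      have h4 : 2 * (n + (k + 1) - 1).choose (k + 1 - 1) ≤ L := by exact_mod_cast h3
      simp only [sub_mul, Finset.sum_sub_distrib]
      rw [Finset.sum_range_succ' (fun i => (if i = 0 then (2 : ℤ) else 0) * _)]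
      have h5 : n + (k + 1) - 1 = n + k := by omega
      simp only [h5, Nat.add_sub_cancel] at h2 h4
      rw [← h2]
      simp
      exact_mod_cast h4
  simp at this
  omega

omit hx hmu in
theorem colonIdeal_ne_top : colonIdeal R (headIdeal x d) ≠ ⊤ := by
  intro htop
  have hm : maximalIdeal R ≤ headIdeal x d := fun t ht => by
    have := mem_colonIdeal.1 (htop ▸ (Submodule.mem_top : (1 : R) ∈ ⊤)) t ht
    simpa using this
  have h1 := hu ![u 1, - u 0] (by
    rw [Fin.sum_univ_two]
    simp only [Matrix.cons_val_zero, Matrix.cons_val_one]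
    rw [show u 1 * u 0 + -u 0 * u 1 = 0 by ring]
    exact Submodule.zero_mem _) 1
  have h2 : u 0 ∈ maximalIdeal R := by simpa using h1
  have h3 := hu ![1, 0] (by
    rw [Fin.sum_univ_two]
    simpa using Ideal.mem_sup_left (hm h2)) 0
  simp at h3

theorem maximalIdeal_mul_colonIdeal_le :
    maximalIdeal R * colonIdeal R (headIdeal x d) ≤ maximalIdeal R * headIdeal x d := by
  rw [Ideal.mul_le]
  intro t ht a ha
  have hlin : ∀ r ∈ headIdeal x d, ∃ c : Fin d → R, ∑ i, c i * x i = r := fun r hr => by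
    rw [headIdeal_eq_span_range] at hr
    exact Ideal.mem_span_range_iff_exists_fun.1 hr
  obtain ⟨c, hc⟩ := hlin (t * a) (ha t ht)
  choose c' hc' using fun j => hlin (t * u j) (hmu j t ht)
  have hev : ∀ c : Fin d → R, eval (fun i : Fin d => x i) (linForm c) = ∑ i, c i * x i :=
    eval_linForm _
  by_cases hcm : MvPolynomial.map (IsLocalRing.residue R) (linForm c) = 0
  · rw [← hc]
    exact Ideal.sum_mem _ fun i _ =>
      Ideal.mul_mem_mul (mem_maximalIdeal_of_map_linForm hcm i) (mem_headIdeal x i.2)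
  have h1 := (hx.socle_pair_map_eq_zero hmu hu (n := 2)
    ((linForm_isHomogeneous c).mul (linForm_isHomogeneous (c' 1))).neg
    ((linForm_isHomogeneous c).mul (linForm_isHomogeneous (c' 0)))
    (by
      rw [map_neg, map_mul, map_mul, hev, hev, hev, hc, hc', hc']
      convert Submodule.zero_mem _ using 1
      ring)).2
  rw [map_mul, mul_eq_zero, or_iff_right hcm] at h1
  have h2 := mem_maximalIdeal_of_map_linForm h1
  have h3 := hx.socle_pair_map_eq_zero hmu hu (n := 1) (linForm_isHomogeneous c)
    (isHomogeneous_zero _ _ _)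
    (by
      rw [map_zero, zero_mul, add_zero, hev, hc, mul_right_comm, ← hc', Finset.sum_mul, pow_succ,
        pow_one]
      refine Ideal.sum_mem _ fun i _ => ?_
      rw [mul_right_comm]
      exact Ideal.mul_mem_mul (ha _ (h2 i)) (mem_headIdeal x i.2))
  exact absurd h3.1 hcm

theorem colonIdeal_pow_le (n : ℕ) :
    colonIdeal R (headIdeal x d) ^ (n + 1) ≤ maximalIdeal R * headIdeal x d ^ n := by
  induction n with
  | zero => simpa using le_maximalIdeal (colonIdeal_ne_top hu)
  | succ n ih =>
    calc colonIdeal R (headIdeal x d) ^ (n + 1 + 1)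
        ≤ maximalIdeal R * headIdeal x d ^ n * colonIdeal R (headIdeal x d) := by
          rw [pow_succ]; exact Ideal.mul_mono_left ih
      _ = maximalIdeal R * colonIdeal R (headIdeal x d) * headIdeal x d ^ n := by ring
      _ ≤ maximalIdeal R * headIdeal x d * headIdeal x d ^ n :=
          Ideal.mul_mono_left (hx.maximalIdeal_mul_colonIdeal_le hmu hu)
      _ = _ := by ring

include hd in
theorem chern_sub_ne_one {e e' : ℕ → ℤ}
    (he : IsHilbCoeff R (headIdeal x d) d e)
    (he' : IsHilbCoeff R (colonIdeal R (headIdeal x d)) d e') : e' 1 - e 1 ≠ 1 := by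
  obtain ⟨N, hN⟩ := isHilbCoeff_iff.1 he
  obtain ⟨N', hN'⟩ := isHilbCoeff_iff.1 he'
  obtain ⟨k, rfl⟩ : ∃ k, d = k + 1 := ⟨d - 1, by omega⟩
  set q := headIdeal x (k + 1) with hq
  set I := colonIdeal R q with hI
  have hqI : ∀ n, q ^ n ≤ I ^ n := fun n => Ideal.pow_right_mono (le_colonIdeal q) n
  obtain ⟨l, hl⟩ : ∃ l : ℕ, Module.length R (R ⧸ q) = l := by
    obtain ⟨L, hL, -⟩ := hN N le_rfl
    have h1 : Module.length R (R ⧸ q) ≤ L := hL ▸ Module.length_le_of_surjective _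
      (Submodule.factor_surjective (Ideal.pow_le_self (Nat.succ_ne_zero N)))
    exact ⟨_, (ENat.natCast_toNat (ne_top_of_le_ne_top (ENat.natCast_ne_top L) h1)).symm⟩
  have key : ∀ n ≥ max N N', ∃ D : ℕ,
      (D : ℤ) = ∑ i ∈ Finset.range (k + 1 + 1),
        (-1) ^ i * (e i - e' i) * ((n + (k + 1) - i).choose (k + 1 - i) : ℤ) ∧
      2 * (n + k).choose k ≤ D ∧ D ≤ l * (n + k).choose k := by
    intro n hn
    obtain ⟨L, hL, hLs⟩ := hN n (le_trans (le_max_left _ _) hn)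
    obtain ⟨L', hL', hLs'⟩ := hN' n (le_trans (le_max_right _ _) hn)
    have h1 := length_quotient_eq_add (hqI (n + 1))
    rw [hL, hL'] at h1
    set Q := Module.length R (Submodule.map (q ^ (n + 1)).mkQ (I ^ (n + 1))) with hQ
    have hup : Q ≤ ((l * (n + k).choose k : ℕ) : ℕ∞) := by
      have h2 : I ^ (n + 1) ≤ q ^ n * Ideal.span (Set.range fun _ : Unit => (1 : R)) := by
        rw [Set.range_const, Ideal.span_singleton_one, Ideal.mul_top]
        exact (hx.colonIdeal_pow_le hmu hu n).trans Ideal.mul_le_right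
      have h3 := (length_map_mkQ_mono h2).trans (length_map_pow_mul_span_le (A := q) hd
        (headIdeal_eq_span_range x (k + 1)) (by simp [← hq]) n)
      rw [hl, Fintype.card_unit, one_mul] at h3
      rw [mul_comm]
      exact_mod_cast h3
    have hlow : ((2 * (n + k).choose k : ℕ) : ℕ∞) ≤ Q := by
      refine (hx.length_socle_pair hd hmu hu n).ge.trans (length_map_mkQ_mono ?_)
      rw [pow_succ]
      exact Ideal.mul_mono (hqI n) (span_le_colonIdeal hmu)
    obtain ⟨D, hD⟩ : ∃ D : ℕ, Q = D :=
      ⟨_, (ENat.natCast_toNat (ne_top_of_le_ne_top (ENat.natCast_ne_top _) hup)).symm⟩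
    rw [hD] at h1 hup hlow
    refine ⟨D, ?_, by exact_mod_cast hlow, by exact_mod_cast hup⟩
    have h4 : L = D + L' := by exact_mod_cast h1
    have h5 : (D : ℤ) = L - L' := by omega
    rw [h5, hLs, hLs', ← Finset.sum_sub_distrib]
    exact Finset.sum_congr rfl fun i _ => by ring
  have hsplit : ∀ n, ∑ i ∈ Finset.range (k + 1 + 1),
        (-1) ^ i * (e i - e' i) * ((n + (k + 1) - i).choose (k + 1 - i) : ℤ) =
      (e 0 - e' 0) * ((n + (k + 1)).choose (k + 1) : ℤ) - ∑ i ∈ Finset.range (k + 1),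
        (-1) ^ i * (e (i + 1) - e' (i + 1)) * ((n + k - i).choose (k - i) : ℤ) := by
    intro n
    rw [Finset.sum_range_succ', add_comm, sub_eq_add_neg (_ * _) (Finset.sum _ _),
      ← Finset.sum_neg_distrib]
    congr 1
    · simp
    · refine Finset.sum_congr rfl fun i _ => ?_
      rw [show n + (k + 1) - (i + 1) = n + k - i by omega, Nat.add_sub_add_right]
      ring
  have he1 : 0 ≤ e 0 - e' 0 := by
    have := nonneg_of_sum_choose_nonneg (d := k + 1) (N := max N N')
      (g := fun i => (-1) ^ i * (e i - e' i)) fun n hn => by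
        obtain ⟨D, hD, -⟩ := key n hn
        rw [← hD]; positivity
    simpa using this
  have he2 : 0 ≤ e' 0 - e 0 := by
    have := nonneg_of_sum_choose_nonneg (d := k + 1) (N := max N N')
      (g := fun i => - ((-1) ^ i * (e i - e' i)) + if i = 1 then (l : ℤ) else 0) fun n hn => by
        obtain ⟨D, hD, -, h⟩ := key n hn
        simp only [add_mul, Finset.sum_add_distrib, neg_mul, Finset.sum_neg_distrib, ← hD]
        rw [Finset.sum_eq_single 1 (by intro i _ hi; simp [hi]) (by simp)]
        have : (D : ℤ) ≤ l * ((n + k).choose k : ℤ) := by exact_mod_cast h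
        simp
        exact this
    simpa using this
  have he0 : e 0 - e' 0 = 0 := by omega
  have he3 := nonneg_of_sum_choose_nonneg (d := k) (N := max N N')
      (g := fun i => - ((-1) ^ i * (e (i + 1) - e' (i + 1))) - if i = 0 then 2 else 0) fun n hn => by
        obtain ⟨D, hD, h, -⟩ := key n hn
        rw [hsplit, he0, zero_mul, zero_sub] at hD
        simp only [sub_mul, Finset.sum_sub_distrib, neg_mul, Finset.sum_neg_distrib]
        rw [Finset.sum_eq_single (f := fun i => (if i = 0 then (2 : ℤ) else 0) * _) 0
          (by intro i _ hi; simp [hi]) (by simp)]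
        have h6 : 2 * ((n + k).choose k : ℤ) ≤ D := by exact_mod_cast h
        simp only [mul_sub, sub_mul, Finset.sum_sub_distrib] at hD ⊢
        simp
        omega
  simp at he3
  omega

end IsCSeq

section Parameters

variable {R : Type u} [CommRing R] [IsLocalRing R] [IsNoetherianRing R]

theorem isFiniteLength_quotient_iff {J : Ideal R} :
    IsFiniteLength R (R ⧸ J) ↔ ∃ k, maximalIdeal R ^ k ≤ J := by
  rw [isFiniteLength_iff_isNoetherian_isArtinian]
  constructor
  · rintro ⟨-, h⟩
    have : IsArtinianRing (R ⧸ J) := isArtinian_of_tower R h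
    exact exists_maximalIdeal_pow_le_of_isArtinianRing_quotient J
  · rintro ⟨k, hk⟩
    refine ⟨inferInstance, ?_⟩
    have h : IsArtinianRing (R ⧸ J) := by
      rcases subsingleton_or_nontrivial (R ⧸ J) with _ | _
      · infer_instance
      have := IsLocalRing.of_surjective' (Ideal.Quotient.mk J) Ideal.Quotient.mk_surjective
      rw [isArtinianRing_iff_isNilpotent_maximalIdeal]
      refine ⟨k, ?_⟩
      rw [← IsLocalRing.map_maximalIdeal_of_surjective (Ideal.Quotient.mk J)
        Ideal.Quotient.mk_surjective, ← Ideal.map_pow]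
      exact (Ideal.map_eq_bot_iff_le_ker _).2 (by rwa [Ideal.mk_ker])
    exact isArtinian_of_surjective_algebraMap (S := R) (R := R ⧸ J) Ideal.Quotient.mk_surjective

theorem exists_pow_le_iff_le_radical {J : Ideal R} :
    (∃ k, maximalIdeal R ^ k ≤ J) ↔ maximalIdeal R ≤ J.radical := by
  constructor
  · rintro ⟨k, hk⟩ t ht
    exact ⟨k, hk (Ideal.pow_mem_pow ht k)⟩
  · intro h
    exact Ideal.exists_pow_le_of_le_radical_of_fg h (IsNoetherian.noetherian _)

theorem ringKrullDim_le_ncard {s : Set R} (hs : s.Finite) (hsm : s ⊆ maximalIdeal R)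
    (h : maximalIdeal R ≤ (Ideal.span s).radical) : ringKrullDim R ≤ s.ncard := by
  rw [← IsLocalRing.maximalIdeal_height_eq_ringKrullDim]
  refine WithBot.coe_le_coe.2 (Ideal.height_le_card_of_mem_minimalPrimes_span hs ?_)
  refine ⟨⟨inferInstance, Ideal.span_le.2 hsm⟩, fun p hp _ => ?_⟩
  exact h.trans (hp.1.radical_le_iff.2 hp.2)

theorem ringKrullDim_quotient_le_of_le_radical {e : ℕ} {I : Ideal R} (hI : I ≤ maximalIdeal R)
    {y : Fin e → R} (hy : ∀ i, y i ∈ maximalIdeal R)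
    (h : maximalIdeal R ≤ (Ideal.span (Set.range y) ⊔ I).radical) :
    ringKrullDim (R ⧸ I) ≤ e := by
  have : Nontrivial (R ⧸ I) := Ideal.Quotient.nontrivial_iff.2
    (ne_top_of_le_ne_top (maximalIdeal.isMaximal R).ne_top hI)
  have := IsLocalRing.of_surjective' (Ideal.Quotient.mk I) Ideal.Quotient.mk_surjective
  have hm := IsLocalRing.map_maximalIdeal_of_surjective (Ideal.Quotient.mk I)
        Ideal.Quotient.mk_surjective
  have hfin : (Set.range fun i => Ideal.Quotient.mk I (y i)).Finite := Set.finite_range _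
  refine (ringKrullDim_le_ncard hfin ?_ ?_).trans ?_
  · rintro _ ⟨i, rfl⟩
    rw [← hm]
    exact Ideal.mem_map_of_mem _ (hy i)
  · rw [← hm, Ideal.map_le_iff_le_comap]
    intro t ht
    obtain ⟨n, hn⟩ := h ht
    refine ⟨n, ?_⟩
    have h1 := Ideal.mem_map_of_mem (Ideal.Quotient.mk I) hn
    rw [Ideal.map_sup, Ideal.map_span, Ideal.map_quotient_self, sup_bot_eq, ← Set.range_comp] at h1
    rw [map_pow] at h1
    exact h1
  · have := Set.ncard_image_le (f := fun i => Ideal.Quotient.mk I (y i)) (Set.finite_univ)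
    rw [Set.image_univ, Set.ncard_univ, Nat.card_fin] at this
    exact_mod_cast this

omit [IsLocalRing R] [IsNoetherianRing R] in
theorem le_of_add_natCast_le_add_natCast {a : WithBot ℕ∞} {e r : ℕ}
    (h : (e : WithBot ℕ∞) + r ≤ a + r) : (e : WithBot ℕ∞) ≤ a := by
  induction a with
  | bot => exact absurd h (by simp)
  | coe a =>
    induction a with
    | top => exact le_top
    | coe a =>
      have : e + r ≤ a + r := by exact_mod_cast h
      exact_mod_cast (by omega : e ≤ a)

theorem le_ringKrullDim_quotient {r : ℕ} {s : Set R} (hs : s.Finite) (hr : s.ncard ≤ r)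
    (hsm : s ⊆ maximalIdeal R) : ringKrullDim R ≤ ringKrullDim (R ⧸ Ideal.span s) + r := by
  refine (ringKrullDim_le_ringKrullDim_quotient_add_encard s ?_).trans ?_
  · rwa [IsLocalRing.ringJacobson_eq_maximalIdeal]
  · gcongr
    rw [← hs.cast_ncard_eq]
    exact_mod_cast hr

omit [IsLocalRing R] [IsNoetherianRing R] in
theorem moduleDim_quotient (I : Ideal R) :
    moduleDim R (R ⧸ (I • (⊤ : Submodule R R))) = ringKrullDim (R ⧸ I) := by
  have : (I • (⊤ : Submodule R R)) = I := by rw [smul_eq_mul, Ideal.mul_top]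
  rw [this, moduleDim, Ideal.annihilator_quotient]

omit [IsLocalRing R] [IsNoetherianRing R] in
theorem moduleDim_self : moduleDim R R = ringKrullDim R := by
  rw [moduleDim, (Module.annihilator_eq_bot (R := R) (M := R)).2 inferInstance]
  exact ringKrullDim_eq_of_ringEquiv (RingEquiv.quotientBot R)

omit [IsLocalRing R] [IsNoetherianRing R] in
theorem mkQ_mem_smul_top {M : Type u} [AddCommGroup M] [Module R M] (N : Submodule R M)
    (J : Ideal R) (a : M) :
    N.mkQ a ∈ (J • ⊤ : Submodule R (M ⧸ N)) ↔ a ∈ N ⊔ J • (⊤ : Submodule R M) := by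
  rw [← Submodule.range_mkQ N, ← Submodule.map_top, ← Submodule.map_smul'', ← Submodule.mem_comap,
    Submodule.comap_map_mkQ]

omit [IsLocalRing R] [IsNoetherianRing R] in
theorem mkQ_mem_smul_top_self (I J : Ideal R) (a : R) :
    (I • (⊤ : Submodule R R)).mkQ a ∈ (J • ⊤ : Submodule R (R ⧸ (I • (⊤ : Submodule R R)))) ↔
      a ∈ J ⊔ I := by
  rw [mkQ_mem_smul_top]
  simp only [smul_eq_mul, Ideal.mul_top, sup_comm I J]

omit [IsLocalRing R] [IsNoetherianRing R] in
theorem mul_mem_of_mem_bIdeal {I : Ideal R} {e : ℕ} {y : Fin e → R}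
    (hy : IsSOP R (R ⧸ (I • (⊤ : Submodule R R))) y) {c u : R}
    (hc : c ∈ bIdeal R (R ⧸ (I • (⊤ : Submodule R R)))) (i : Fin e)
    (h : y i * u ∈ Ideal.span (y '' {j | j < i}) ⊔ I) :
    c * u ∈ Ideal.span (y '' {j | j < i}) ⊔ I := by
  rw [bIdeal] at hc
  simp only [Submodule.mem_iInf] at hc
  have h1 := hc e y hy i
  rw [Submodule.mem_annihilator] at h1
  rw [← mkQ_mem_smul_top_self] at h ⊢
  rw [← Submodule.Quotient.mk_eq_zero] at h ⊢
  exact h1 (Submodule.Quotient.mk (Submodule.Quotient.mk u)) h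

theorem isSOP_quotient {d e r : ℕ} (hdim : ringKrullDim R = d) (her : e + r = d) {s : Set R}
    (hs : s.Finite) (hr : s.ncard ≤ r) (hsm : s ⊆ maximalIdeal R) {y : Fin e → R}
    (hy : ∀ i, y i ∈ maximalIdeal R)
    (h : maximalIdeal R ≤ (Ideal.span (Set.range y) ⊔ Ideal.span s).radical) :
    IsSOP R (R ⧸ (Ideal.span s • (⊤ : Submodule R R))) y := by
  refine ⟨?_, hy, ?_⟩
  · rw [moduleDim_quotient]
    refine le_antisymm
      (ringKrullDim_quotient_le_of_le_radical (Ideal.span_le.2 hsm) hy h) ?_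
    have h1 := le_ringKrullDim_quotient hs hr hsm
    rw [hdim, ← her, Nat.cast_add] at h1
    exact le_of_add_natCast_le_add_natCast h1
  · obtain ⟨k, hk⟩ := exists_pow_le_iff_le_radical.2 h
    refine ((isFiniteLength_quotient_iff (R := R)).2 ⟨k, hk⟩).of_surjective
      (f := Submodule.liftQ _ ((Submodule.mkQ _).comp (Submodule.mkQ _)) ?_) ?_
    · intro a ha
      rw [LinearMap.mem_ker, LinearMap.comp_apply, Submodule.mkQ_apply _ (Submodule.mkQ _ a),
        Submodule.Quotient.mk_eq_zero, mkQ_mem_smul_top_self]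
      exact ha
    · intro z
      obtain ⟨z, rfl⟩ := Submodule.mkQ_surjective _ z
      obtain ⟨z, rfl⟩ := Submodule.mkQ_surjective _ z
      exact ⟨Submodule.mkQ _ z, rfl⟩

omit [IsLocalRing R] [IsNoetherianRing R] in
theorem isFiniteLength_quotient_smul_top (I : Ideal R) :
    IsFiniteLength R (R ⧸ (I • (⊤ : Submodule R R))) ↔ IsFiniteLength R (R ⧸ I) := by
  rw [show (I • (⊤ : Submodule R R)) = I by rw [smul_eq_mul, Ideal.mul_top]]

theorem isSOP_self_iff {d : ℕ} {y : Fin d → R} :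
    IsSOP R R y ↔ ringKrullDim R = d ∧ (∀ i, y i ∈ maximalIdeal R) ∧
      maximalIdeal R ≤ (Ideal.span (Set.range y)).radical := by
  rw [← exists_pow_le_iff_le_radical, ← isFiniteLength_quotient_iff,
    ← isFiniteLength_quotient_smul_top, ← moduleDim_self]
  exact Iff.rfl

/-- Extend a finite sequence by zero. -/
def extendZero {d : ℕ} (x : Fin d → R) (i : ℕ) : R := if h : i < d then x ⟨i, h⟩ else 0

omit [IsLocalRing R] [IsNoetherianRing R] in
theorem extendZero_of_lt {d : ℕ} (x : Fin d → R) {i : ℕ} (h : i < d) :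
    extendZero x i = x ⟨i, h⟩ := dif_pos h

omit [IsLocalRing R] [IsNoetherianRing R] in
theorem headIdeal_extendZero {d : ℕ} (x : Fin d → R) :
    headIdeal (extendZero x) d = Ideal.span (Set.range x) := by
  rw [headIdeal_eq_span_range]
  congr 2
  ext i
  exact extendZero_of_lt x i.2

omit [IsLocalRing R] [IsNoetherianRing R] in
theorem span_image_eq_tailIdeal {d : ℕ} (x : Fin d → R) (e : ℕ) :
    Ideal.span (x '' {j | e ≤ (j : ℕ)}) = tailIdeal (extendZero x) d e := by
  rw [tailIdeal]
  congr 1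
  ext a
  constructor
  · rintro ⟨j, hj, rfl⟩
    exact ⟨j, ⟨hj, j.2⟩, extendZero_of_lt x j.2⟩
  · rintro ⟨j, ⟨hj, hj'⟩, rfl⟩
    exact ⟨⟨j, hj'⟩, hj, (extendZero_of_lt x hj').symm⟩

/-- Permuting and raising to positive powers the first `e` members of a system of parameters
gives a system of parameters modulo the remaining members. -/
theorem isSOP_quotient_of_perm {d e : ℕ} (he : e ≤ d) {x : Fin d → R} (hx : IsSOP R R x)
    (σ : Equiv.Perm (Fin e)) {a : Fin e → ℕ} (ha : ∀ i, 0 < a i) :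
    IsSOP R (R ⧸ (Ideal.span (x '' {j | e ≤ (j : ℕ)}) • (⊤ : Submodule R R)))
      fun i => extendZero x (σ i) ^ a i := by
  obtain ⟨hdim, hxm, hrad⟩ := isSOP_self_iff.1 hx
  refine isSOP_quotient hdim (Nat.add_sub_of_le he) (Set.toFinite _) ?_ ?_ ?_ ?_
  · have h1 : (x '' {j | e ≤ (j : ℕ)}) ⊆ (extendZero x) '' (Finset.Ico e d : Set ℕ) := by
      rintro _ ⟨j, hj, rfl⟩
      exact ⟨j, by simpa using hj, extendZero_of_lt x j.2⟩
    refine (Set.ncard_le_ncard h1 (Set.toFinite _)).trans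
      ((Set.ncard_image_le (Set.toFinite _)).trans ?_)
    rw [Set.ncard_coe_finset, Nat.card_Ico]
  · rintro _ ⟨j, -, rfl⟩
    exact hxm j
  · intro i
    rw [extendZero_of_lt x ((σ i).2.trans_le he)]
    exact Ideal.pow_mem_of_mem _ (hxm _) _ (ha i)
  · refine hrad.trans ?_
    rw [← Ideal.radical_idem (_ ⊔ _)]
    refine Ideal.radical_mono (Ideal.span_le.2 ?_)
    rintro _ ⟨j, rfl⟩
    by_cases hj : (j : ℕ) < e
    · refine ⟨a (σ.symm ⟨j, hj⟩), Ideal.mem_sup_left (Ideal.subset_span ⟨σ.symm ⟨j, hj⟩, ?_⟩)⟩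
      simp [extendZero_of_lt x j.2]
    · exact Ideal.le_radical (Ideal.mem_sup_right (Ideal.subset_span ⟨j, not_lt.1 hj, rfl⟩))

/-- The ideals `b` of the successive quotients by the tails of `x`. -/
noncomputable def tailB {d : ℕ} (x : Fin d → R) (e : ℕ) : Ideal R :=
  bIdeal R (R ⧸ (Ideal.span (x '' {j | e ≤ (j : ℕ)}) • (⊤ : Submodule R R)))

theorem mul_mem_of_mem_tailB {d e : ℕ} (he : e ≤ d) {x : Fin d → R} (hx : IsSOP R R x)
    (σ : Equiv.Perm (Fin e)) {a : Fin e → ℕ} (ha : ∀ i, 0 < a i) {c u : R} (hc : c ∈ tailB x e)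
    (i : Fin e) {J : Ideal R}
    (hJ : J = Ideal.span ((fun i => extendZero x (σ i) ^ a i) '' {j : Fin e | j < i}))
    (h : extendZero x (σ i) ^ a i * u ∈ J ⊔ tailIdeal (extendZero x) d e) :
    c * u ∈ J ⊔ tailIdeal (extendZero x) d e := by
  subst hJ
  rw [← span_image_eq_tailIdeal] at h ⊢
  exact mul_mem_of_mem_bIdeal (isSOP_quotient_of_perm he hx σ ha) hc i h

theorem isCSeq_of_isCSOP {d : ℕ} {x : Fin d → R} (hx : IsCSOP R R x) :
    IsCSeq (extendZero x) d (tailB x) := by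
  refine ⟨fun i hi => ?_, ?_, ?_⟩
  · rw [extendZero_of_lt x hi]
    exact hx.2 ⟨i, hi⟩
  · intro s j e n u c hsj hje hed h hc
    rcases Nat.eq_zero_or_pos n with rfl | hn
    · rw [pow_zero, one_mul] at h
      exact Ideal.mul_mem_left _ _ h
    have hse := hsj.trans_lt hje
    refine mul_mem_of_mem_tailB hed hx.1 (Equiv.swap ⟨s, hse⟩ ⟨j, hje⟩)
      (a := fun i => if (i : ℕ) = s then n else 1) (by intro i; split_ifs <;> omega) hc ⟨s, hse⟩ ?_
      (by simpa using h)
    rw [headIdeal]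
    congr 1
    have key : ∀ k (hk : k < s), extendZero x (Equiv.swap (⟨s, hse⟩ : Fin e) ⟨j, hje⟩
        ⟨k, hk.trans hse⟩) ^ (if k = s then n else 1) = extendZero x k := by
      intro k hk
      rw [Equiv.swap_apply_of_ne_of_ne (by simp; omega) (by simp; omega), if_neg hk.ne, pow_one]
    ext a
    constructor
    · rintro ⟨k, hk, rfl⟩
      exact ⟨⟨k, lt_trans hk hse⟩, hk, key k hk⟩
    · rintro ⟨k, hk, rfl⟩
      exact ⟨k, hk, (key k hk).symm⟩
  · intro s j n a u c hsj hjd h hc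
    rcases Nat.eq_zero_or_pos n with rfl | hn
    · rw [pow_zero, one_mul] at h
      exact Ideal.mul_mem_left _ _ h
    rcases Nat.eq_zero_or_pos a with rfl | ha
    · rw [pow_zero, Ideal.span_singleton_one, sup_top_eq]
      exact Submodule.mem_top
    have hsd : s + 1 < d := by omega
    have h1 := mul_mem_of_mem_tailB le_rfl hx.1 (Equiv.swap ⟨s + 1, hsd⟩ ⟨j, hjd⟩)
      (a := fun i => if (i : ℕ) = s then a else if (i : ℕ) = s + 1 then n else 1)
      (by intro i; split_ifs <;> omega) (c := c) (u := u) hc ⟨s + 1, hsd⟩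
      (J := headIdeal (extendZero x) s ⊔ Ideal.span {extendZero x s ^ a}) ?_
    · simp only [tailIdeal_self, sup_bot_eq] at h1
      exact h1 (by simpa using h)
    have key : ∀ k (hk : k < s + 1), extendZero x (Equiv.swap (⟨s + 1, hsd⟩ : Fin d) ⟨j, hjd⟩
        ⟨k, hk.trans hsd⟩) ^ (if k = s then a else if k = s + 1 then n else 1) =
          extendZero x k ^ (if k = s then a else 1) := by
      intro k hk
      rw [Equiv.swap_apply_of_ne_of_ne (by simp; omega) (by simp; omega), if_neg hk.ne]
    rw [headIdeal, ← Ideal.span_union]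
    congr 1
    ext r
    constructor
    · rintro (⟨k, hk, rfl⟩ | rfl)
      · refine ⟨⟨k, by have : k < s := hk; omega⟩, Nat.lt_succ_of_lt hk, (key k (Nat.lt_succ_of_lt hk)).trans ?_⟩
        rw [if_neg (ne_of_lt hk), pow_one]
      · exact ⟨⟨s, by omega⟩, Nat.lt_succ_self s, (key s (Nat.lt_succ_self s)).trans (by rw [if_pos rfl])⟩
    · rintro ⟨k, hk, rfl⟩
      have hk' : (k : ℕ) < s + 1 := hk
      change extendZero x (Equiv.swap (⟨s + 1, hsd⟩ : Fin d) ⟨j, hjd⟩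
        ⟨k, hk'.trans hsd⟩) ^ (if (k : ℕ) = s then a else if (k : ℕ) = s + 1 then n else 1) ∈ _
      rw [key k hk']
      rcases (Nat.lt_succ_iff_lt_or_eq.1 hk') with h2 | h2
      · rw [if_neg h2.ne, pow_one]
        exact Or.inl ⟨k, h2, rfl⟩
      · rw [if_pos h2, h2]
        exact Or.inr rfl

theorem not_headIdeal_pow_le {d : ℕ} (hd : 2 ≤ d) {x : Fin d → R} (hx : IsSOP R R x) {w : R}
    (hw : w ∈ maximalIdeal R) (n : ℕ) : ¬ headIdeal (extendZero x) d ^ n ≤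
      headIdeal (extendZero x) (d - 2) ⊔ Ideal.span {w} := by
  intro h
  obtain ⟨hdim, hxm, hrad⟩ := isSOP_self_iff.1 hx
  rw [headIdeal_extendZero, headIdeal, ← Ideal.span_union] at h
  have hfin : (extendZero x '' {i | i < d - 2} ∪ {w}).Finite :=
    ((Set.finite_lt_nat _).image _).union (Set.finite_singleton _)
  have h1 := ringKrullDim_le_ncard hfin ?_ ?_
  · have h2 : (extendZero x '' {i | i < d - 2} ∪ {w}).ncard ≤ (d - 2) + 1 := by
      refine (Set.ncard_union_le _ _).trans (add_le_add ?_ (by simp))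
      refine (Set.ncard_image_le (Set.finite_lt_nat _)).trans ?_
      rw [show {i | i < d - 2} = ((Finset.range (d - 2) : Finset ℕ) : Set ℕ) by ext; simp,
        Set.ncard_coe_finset, Finset.card_range]
    rw [hdim] at h1
    have h3 : d ≤ (extendZero x '' {i | i < d - 2} ∪ {w}).ncard := by exact_mod_cast h1
    omega
  · rintro _ (⟨i, hi, rfl⟩ | rfl)
    · have hi' : i < d - 2 := hi
      rw [extendZero_of_lt x (by omega : i < d)]
      exact hxm _
    · exact hw
  · intro t ht
    obtain ⟨m, hm⟩ := hrad ht
    exact ⟨m * n, h (by rw [pow_mul]; exact Ideal.pow_mem_pow hm n)⟩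

end Parameters

section Completion

variable {A : Type*} [CommRing A] {R : Type*} [CommRing R]

theorem exists_surjective_adicCompletion (φ : A →+* R) (hφ : Function.Surjective φ) (J : Ideal A)
    (I : Ideal R) (hJ : J.map φ = I) :
    ∃ Φ : AdicCompletion J A →+* AdicCompletion I R, Function.Surjective Φ := by
  have hpow : ∀ n, J ^ n ≤ (I ^ n).comap φ := fun n => by
    rw [← Ideal.map_le_iff_le_comap, Ideal.map_pow, hJ]
  let F : (n : ℕ) → AdicCompletion J A →+* R ⧸ I ^ n := fun n =>
    (Ideal.quotientMap (I ^ n) φ (hpow n)).comp (AdicCompletion.evalₐ J n : _ →+* A ⧸ J ^ n)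
  have hFmk : ∀ n (x : AdicCompletion.AdicCauchySequence J A),
      F n (AdicCompletion.mk J A x) = Ideal.Quotient.mk (I ^ n) (φ (x.val n)) := by
    intro n x
    simp [F]
  refine ⟨AdicCompletion.liftRingHom I F ?_, ?_⟩
  · intro m n hle
    ext x
    induction x using AdicCompletion.induction_on with
    | h x =>
      rw [RingHom.comp_apply, hFmk, hFmk]
      change Ideal.Quotient.mk (I ^ m) _ = Ideal.Quotient.mk (I ^ m) _
      rw [Ideal.Quotient.eq, ← map_sub]
      refine hpow m ?_
      rw [← Ideal.Quotient.eq]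
      exact (AdicCompletion.Ideal.mk_eq_mk J hle x)
  · intro y
    induction y using AdicCompletion.induction_on with
    | h r =>
      have hr : ∀ n, r.val (n + 1) - r.val n ∈ (J ^ n).map φ := by
        intro n
        rw [Ideal.map_pow, hJ, ← Ideal.Quotient.eq]
        exact (AdicCompletion.Ideal.mk_eq_mk I (Nat.le_succ n) r)
      have hstep : ∀ (n : ℕ) (a : {a : A // φ a = r.val n}),
          ∃ b : {b : A // φ b = r.val (n + 1)}, b.1 - a.1 ∈ J ^ n := by
        rintro n ⟨a, ha⟩
        obtain ⟨j, hj, hj'⟩ := (Ideal.mem_map_iff_of_surjective φ hφ).1 (hr n)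
        exact ⟨⟨a + j, by rw [map_add, ha, hj']; ring⟩, by simpa using hj⟩
      choose g hg using hstep
      obtain ⟨a0, ha0⟩ := hφ (r.val 0)
      let a : (n : ℕ) → {a : A // φ a = r.val n} := fun n =>
        Nat.rec ⟨a0, ha0⟩ (fun n a => g n a) n
      have ha : ∀ n, (a (n + 1)).1 - (a n).1 ∈ J ^ n := fun n => hg n (a n)
      refine ⟨AdicCompletion.mk J A (AdicCompletion.AdicCauchySequence.mk J A
        (fun n => (a n).1) ?_), ?_⟩
      · intro n
        rw [smul_eq_mul, Ideal.mul_top]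
        refine SModEq.symm ?_
        rw [SModEq.sub_mem]
        exact ha n
      · refine AdicCompletion.ext_evalₐ fun n => ?_
        rw [AdicCompletion.evalₐ_liftRingHom, hFmk, AdicCompletion.evalₐ_mk]
        exact congrArg _ (a n).2

end Completion

theorem isNoetherianRing_adicCompletion {R : Type*} [CommRing R] [IsNoetherianRing R]
    (I : Ideal R) : IsNoetherianRing (AdicCompletion I R) := by
  obtain ⟨s, hs⟩ := (IsNoetherian.noetherian I : I.FG)
  let φ : MvPolynomial s R →+* R := MvPolynomial.eval fun i : s => (i : R)
  have hφ : Function.Surjective φ := fun r => ⟨MvPolynomial.C r, by simp [φ]⟩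
  obtain ⟨Φ, hΦ⟩ := exists_surjective_adicCompletion φ hφ (MvPolynomial.idealOfVars s R) I (by
    rw [MvPolynomial.idealOfVars, Ideal.map_span, ← hs, ← Set.range_comp]
    congr 1
    ext r
    simp [φ])
  have : IsNoetherianRing (AdicCompletion (MvPolynomial.idealOfVars s R) (MvPolynomial s R)) :=
    isNoetherianRing_of_ringEquiv (MvPowerSeries s R)
      (MvPowerSeries.toAdicCompletionAlgEquiv s R).toRingEquiv
  exact isNoetherianRing_of_surjective _ _ Φ hΦ

section Unmixed

variable {R : Type u} [CommRing R] [IsLocalRing R] [IsNoetherianRing R]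

theorem ringKrullDim_le_adicCompletion :
    ringKrullDim R ≤ ringKrullDim (AdicCompletion (maximalIdeal R) R) := by
  have := isNoetherianRing_adicCompletion (maximalIdeal R)
  rw [← IsLocalRing.maximalIdeal_height_eq_ringKrullDim,
    ← IsLocalRing.maximalIdeal_height_eq_ringKrullDim]
  have hloc : IsLocalHom (algebraMap R (AdicCompletion (maximalIdeal R) R)) := inferInstance
  have : (maximalIdeal (AdicCompletion (maximalIdeal R) R)).LiesOver (maximalIdeal R) :=
    ⟨(IsLocalRing.maximalIdeal_comap (algebraMap R (AdicCompletion (maximalIdeal R) R))).symm⟩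
  rw [Ideal.height_eq_height_add_of_liesOver_of_hasGoingDown (maximalIdeal R)
    (maximalIdeal (AdicCompletion (maximalIdeal R) R))]
  exact_mod_cast le_self_add

theorem eq_zero_of_isUnmixedRing (hum : IsUnmixedRing R) {d : ℕ} {x : Fin (d + 1) → R}
    (hx : IsSOP R R x) (i : Fin (d + 1)) {u : R} (hu : x i * u = 0) : u = 0 := by
  have hN := isNoetherianRing_adicCompletion (maximalIdeal R)
  obtain ⟨hdim, hxm, hrad⟩ := isSOP_self_iff.1 hx
  by_contra hu0
  let S := AdicCompletion (maximalIdeal R) R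
  have hu1 : algebraMap R S u ≠ 0 := fun h =>
    hu0 (AdicCompletion.of_injective (maximalIdeal R) R (by rw [map_zero]; exact h))
  have hN : IsNoetherianRing S := hN
  obtain ⟨P, hP, hle⟩ := exists_le_isAssociatedPrime_of_isNoetherianRing S (algebraMap R S u) hu1
  have hxP : algebraMap R S (x i) ∈ P := hle (by
    rw [Submodule.mem_colon_singleton, smul_eq_mul, ← map_mul, hu, map_zero]
    exact Submodule.zero_mem _)
  have hPle : P ≤ maximalIdeal S := IsLocalRing.le_maximalIdeal hP.isPrime.ne_top
  have h1 : ringKrullDim (S ⧸ P) ≤ d := by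
    refine ringKrullDim_quotient_le_of_le_radical hPle
      (y := fun j => algebraMap R S (x (i.succAbove j))) ?_ ?_
    · intro j
      rw [AdicCompletion.maximalIdeal_eq_map]
      exact Ideal.mem_map_of_mem _ (hxm _)
    · have : (maximalIdeal R) ≤ (Ideal.comap (algebraMap R S) (Ideal.span (Set.range fun j =>
          algebraMap R S (x (i.succAbove j))) ⊔ P)).radical := by
        refine hrad.trans (Ideal.radical_mono ?_)
        rw [Ideal.span_le]
        rintro _ ⟨k, rfl⟩
        rcases Fin.eq_self_or_eq_succAbove i k with rfl | ⟨j, rfl⟩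
        · exact Ideal.mem_sup_right hxP
        · exact Ideal.mem_sup_left (Ideal.subset_span ⟨j, rfl⟩)
      rw [AdicCompletion.maximalIdeal_eq_map, Ideal.map_le_iff_le_comap, Ideal.comap_radical]
      exact this
  have h2 := hum P hP
  have h3 := ringKrullDim_le_adicCompletion (R := R)
  rw [← h2, hdim] at h3
  have := h3.trans h1
  exact absurd this (by
    rw [not_le]
    exact_mod_cast Nat.lt_succ_self d)

end Unmixed

section HomologyClasses

variable {V : Type*} [Category* V] [Abelian V] (K : ChainComplex V ℕ) (n : ℕ) {A : V}

/-- The morphism out of homology induced by a cocycle with values in `A`. -/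
noncomputable def homologyDesc (k : K.X n ⟶ A) (hk : K.d (n + 1) n ≫ k = 0) : K.homology n ⟶ A :=
  K.homologyι n ≫ K.descOpcycles k (n + 1) (by simp) hk

theorem exists_homologyDesc [Injective A] (e : K.homology n ⟶ A) :
    ∃ k hk, homologyDesc K n k hk = e := by
  refine ⟨K.pOpcycles n ≫ Injective.factorThru e (K.homologyι n), by simp, ?_⟩
  have : K.descOpcycles (K.pOpcycles n ≫ Injective.factorThru e (K.homologyι n)) (n + 1)
      (by simp) (by simp) = Injective.factorThru e (K.homologyι n) := by
    rw [← cancel_epi (K.pOpcycles n), HomologicalComplex.p_descOpcycles]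
  rw [homologyDesc, this, Injective.comp_factorThru]

theorem homologyDesc_eq_zero_iff [Injective A] (k : K.X n ⟶ A) (hk : K.d (n + 1) n ≫ k = 0) :
    homologyDesc K n k hk = 0 ↔ ∃ (j : ℕ) (x : K.X j ⟶ A), k = K.d n j ≫ x := by
  constructor
  · intro h
    let j := (ComplexShape.down ℕ).next n
    let S : ShortComplex V := ShortComplex.mk (K.homologyι n) (K.fromOpcycles n j)
      (K.homologyι_comp_fromOpcycles n j)
    have hS : S.Exact := S.exact_of_f_is_kernel (K.homologyIsKernel n j rfl)
    refine ⟨j, hS.descToInjective (K.descOpcycles k (n + 1) (by simp) hk) h, ?_⟩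
    have h2 := hS.comp_descToInjective (K.descOpcycles k (n + 1) (by simp) hk) h
    have h3 : K.d n j = K.pOpcycles n ≫ K.fromOpcycles n j := by simp
    rw [h3, Category.assoc]
    erw [h2]
    simp
  · rintro ⟨j, x, hx⟩
    exact K.homologyι_descOpcycles_eq_zero_of_boundary k (n + 1) (by simp) x hx

theorem homologyMap_comp_homologyDesc {L : ChainComplex V ℕ} (φ : K ⟶ L) (k : L.X n ⟶ A)
    (hk : L.d (n + 1) n ≫ k = 0) :
    HomologicalComplex.homologyMap φ n ≫ homologyDesc L n k hk =
      homologyDesc K n (φ.f n ≫ k) (by rw [← φ.comm_assoc, hk, comp_zero]) := by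
  simp [homologyDesc, HomologicalComplex.homologyι_naturality_assoc,
    HomologicalComplex.opcyclesMap_comp_descOpcycles]

theorem homologyDesc_add (k k' : K.X n ⟶ A) (hk : K.d (n + 1) n ≫ k = 0)
    (hk' : K.d (n + 1) n ≫ k' = 0) :
    homologyDesc K n (k + k') (by simp [hk, hk']) =
      homologyDesc K n k hk + homologyDesc K n k' hk' := by
  have : K.descOpcycles (k + k') (n + 1) (by simp) (by simp [hk, hk']) =
      K.descOpcycles k (n + 1) (by simp) hk + K.descOpcycles k' (n + 1) (by simp) hk' := by
    rw [← cancel_epi (K.pOpcycles n)]; simp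
  simp [homologyDesc, this]

theorem homologyDesc_comp {A' : V} (k : K.X n ⟶ A) (hk : K.d (n + 1) n ≫ k = 0) (α : A ⟶ A') :
    homologyDesc K n k hk ≫ α = homologyDesc K n (k ≫ α) (by rw [reassoc_of% hk, zero_comp]) := by
  simp [homologyDesc, HomologicalComplex.descOpcycles_comp]

end HomologyClasses

section ExtClasses

variable {R : Type u} [CommRing R]

/-- An element of a module, as a morphism to `R` in the opposite category. -/
noncomputable def eltOp (V : ModuleCat.{u} R) (v : V) : op V ⟶ op (ModuleCat.of R R) :=
  (ModuleCat.ofHom (LinearMap.toSpanSingleton R V v)).op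

/-- The element represented by a morphism to `R` in the opposite category. -/
noncomputable def opElt {V : ModuleCat.{u} R} (e : op V ⟶ op (ModuleCat.of R R)) : V :=
  e.unop.hom (1 : R)

theorem opElt_eltOp {V : ModuleCat.{u} R} (v : V) : opElt (eltOp V v) = v := by
  simp [opElt, eltOp]

theorem eltOp_opElt {V : ModuleCat.{u} R} (e : op V ⟶ op (ModuleCat.of R R)) :
    eltOp V (opElt e) = e := by
  apply Quiver.Hom.unop_inj
  apply ModuleCat.hom_ext
  apply LinearMap.ext_ring
  simp [opElt, eltOp]

theorem op_comp_eltOp {V W : ModuleCat.{u} R} (α : V ⟶ W) (v : V) :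
    α.op ≫ eltOp V v = eltOp W (α.hom v) := by
  apply Quiver.Hom.unop_inj
  apply ModuleCat.hom_ext
  apply LinearMap.ext_ring
  simp [eltOp]

theorem opElt_comp {V W : ModuleCat.{u} R} (α : V ⟶ W) (e : op V ⟶ op (ModuleCat.of R R)) :
    opElt (α.op ≫ e) = α.hom (opElt e) := rfl

theorem opElt_add {V : ModuleCat.{u} R} (e e' : op V ⟶ op (ModuleCat.of R R)) :
    opElt (e + e') = opElt e + opElt e' := rfl

theorem eltOp_add {V : ModuleCat.{u} R} (v w : V) :
    eltOp V (v + w) = eltOp V v + eltOp V w := by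
  apply Quiver.Hom.unop_inj
  apply ModuleCat.hom_ext
  apply LinearMap.ext_ring
  simp [eltOp]

theorem eltOp_zero {V : ModuleCat.{u} R} : eltOp V 0 = 0 := by
  apply Quiver.Hom.unop_inj
  apply ModuleCat.hom_ext
  apply LinearMap.ext_ring
  simp [eltOp]

theorem opElt_inj {V : ModuleCat.{u} R} {e e' : op V ⟶ op (ModuleCat.of R R)}
    (h : opElt e = opElt e') : e = e' := by
  rw [← eltOp_opElt e, ← eltOp_opElt e', h]

variable {N : ModuleCat.{u} R} (P : ProjectiveResolution N) (n : ℕ) (M : ModuleCat.{u} R)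

/-- The complex `Hom(P, M)` in the opposite category. -/
noncomputable abbrev homOp : ChainComplex (ModuleCat.{u} R)ᵒᵖ ℕ :=
  (((linearYoneda R (ModuleCat.{u} R)).obj M).rightOp.mapHomologicalComplex _).obj P.complex

variable {M}

/-- The morphism from `Hom(P, M)` defined by a cochain. -/
noncomputable def cochainOp (f : P.complex.X n ⟶ M) : (homOp P M).X n ⟶ op (ModuleCat.of R R) :=
  eltOp (ModuleCat.of R (P.complex.X n ⟶ M)) f

/-- The cochain underlying a morphism from `Hom(P, M)` to `R` in the opposite category. -/
noncomputable def opCochain (k : (homOp P M).X n ⟶ op (ModuleCat.of R R)) : P.complex.X n ⟶ M :=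
  opElt (V := ModuleCat.of R (P.complex.X n ⟶ M)) k

theorem opCochain_cochainOp (f : P.complex.X n ⟶ M) : opCochain P n (cochainOp P n f) = f :=
  opElt_eltOp (V := ModuleCat.of R (P.complex.X n ⟶ M)) f

theorem cochainOp_opCochain (k : (homOp P M).X n ⟶ op (ModuleCat.of R R)) :
    cochainOp P n (opCochain P n k) = k :=
  eltOp_opElt (V := ModuleCat.of R (P.complex.X n ⟶ M)) k

theorem cochainOp_injective : Function.Injective (cochainOp P n (M := M)) := fun f g h => by
  rw [← opCochain_cochainOp P n f, h, opCochain_cochainOp]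

theorem cochainOp_zero : cochainOp P n (0 : P.complex.X n ⟶ M) = 0 :=
  eltOp_zero (V := ModuleCat.of R (P.complex.X n ⟶ M))

variable (M)

/-- The Ext module computed by a projective resolution. -/
noncomputable abbrev extObj (N : ModuleCat.{u} R) (n : ℕ) (M : ModuleCat.{u} R) : ModuleCat.{u} R :=
  ((Ext R (ModuleCat.{u} R) n).obj (op N)).obj M

/-- The Ext module is the homology of the complex `Hom(P, M)` in the opposite category. -/
noncomputable def extIso : op (extObj N n M) ≅ (homOp P M).homology n :=
  P.isoLeftDerivedObj ((linearYoneda R (ModuleCat.{u} R)).obj M).rightOp n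

variable {M}
variable {n}

theorem d_comp_cochainOp (i : ℕ) (f : P.complex.X n ⟶ M) :
    (homOp P M).d i n ≫ cochainOp P n f = cochainOp P i (P.complex.d i n ≫ f) :=
  op_comp_eltOp (V := ModuleCat.of R (P.complex.X n ⟶ M))
    (W := ModuleCat.of R (P.complex.X i ⟶ M)) _ _

theorem d_comp_cochainOp_eq_zero {f : P.complex.X n ⟶ M} (hf : P.complex.d (n + 1) n ≫ f = 0) :
    (homOp P M).d (n + 1) n ≫ cochainOp P n f = 0 := by
  rw [d_comp_cochainOp, hf, cochainOp_zero]

/-- The class in `Ext` of a cocycle. -/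
noncomputable def extCls (f : P.complex.X n ⟶ M) (hf : P.complex.d (n + 1) n ≫ f = 0) :
    extObj N n M :=
  opElt ((extIso P n M).hom ≫
    homologyDesc (homOp P M) n (cochainOp P n f) (d_comp_cochainOp_eq_zero P hf))

theorem extCls_congr {f g : P.complex.X n ⟶ M} (hf : P.complex.d (n + 1) n ≫ f = 0)
    (h : f = g) : extCls P f hf = extCls P g (h ▸ hf) := by
  subst h; rfl

theorem exists_extCls (a : extObj N n M) :
    ∃ f hf, extCls P (n := n) (M := M) f hf = a := by
  obtain ⟨k, hk, h⟩ := exists_homologyDesc (homOp P M) n (A := op (ModuleCat.of R R))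
    ((extIso P n M).inv ≫ eltOp (extObj N n M) a)
  obtain ⟨f, rfl⟩ : ∃ f, cochainOp P n f = k := ⟨_, cochainOp_opCochain P n k⟩
  refine ⟨f, ?_, ?_⟩
  · rw [d_comp_cochainOp] at hk
    apply cochainOp_injective
    rw [hk, cochainOp_zero]
  · unfold extCls
    rw [h, Iso.hom_inv_id_assoc, opElt_eltOp]

theorem extCls_eq_zero_iff (f : P.complex.X n ⟶ M) (hf : P.complex.d (n + 1) n ≫ f = 0) :
    extCls P f hf = 0 ↔ ∃ (j : ℕ) (g : P.complex.X j ⟶ M), P.complex.d n j ≫ g = f := by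
  have h1 : extCls P f hf = 0 ↔
      homologyDesc (homOp P M) n (cochainOp P n f) (d_comp_cochainOp_eq_zero P hf) = 0 := by
    constructor
    · intro h
      have h2 : (extIso P n M).hom ≫
        homologyDesc (homOp P M) n (cochainOp P n f) (d_comp_cochainOp_eq_zero P hf) = 0 :=
        opElt_inj h
      rw [← cancel_epi (extIso P n M).hom, h2, comp_zero]
    · intro h
      rw [extCls, h, comp_zero]
      rfl
  rw [h1, homologyDesc_eq_zero_iff]
  constructor
  · rintro ⟨j, x, hx⟩
    obtain ⟨g, rfl⟩ : ∃ f, cochainOp P j f = x := ⟨_, cochainOp_opCochain P j x⟩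
    refine ⟨j, g, ?_⟩
    rw [d_comp_cochainOp] at hx
    exact (cochainOp_injective P n hx).symm
  · rintro ⟨j, g, hg⟩
    refine ⟨j, cochainOp P j g, ?_⟩
    rw [d_comp_cochainOp, hg]

theorem extCls_add (f g : P.complex.X n ⟶ M) (hf : P.complex.d (n + 1) n ≫ f = 0)
    (hg : P.complex.d (n + 1) n ≫ g = 0) :
    extCls P (f + g) (by rw [Preadditive.comp_add, hf, hg, add_zero]) =
      extCls P f hf + extCls P g hg := by
  have h : homologyDesc (homOp P M) n (cochainOp P n (f + g))
      (d_comp_cochainOp_eq_zero P (by rw [Preadditive.comp_add, hf, hg, add_zero])) =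
    homologyDesc (homOp P M) n (cochainOp P n f) (d_comp_cochainOp_eq_zero P hf) +
    homologyDesc (homOp P M) n (cochainOp P n g) (d_comp_cochainOp_eq_zero P hg) := by
    rw [← homologyDesc_add]
    congr 1
    exact eltOp_add (V := ModuleCat.of R (P.complex.X n ⟶ M)) _ _
  unfold extCls
  rw [h, Preadditive.comp_add, opElt_add]

/-- The morphism of complexes `Hom(P, M') ⟶ Hom(P, M)` induced by `M ⟶ M'`. -/
noncomputable def homOpMap {M' : ModuleCat.{u} R} (α : M ⟶ M') : homOp P M' ⟶ homOp P M :=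
  (NatTrans.mapHomologicalComplex (NatTrans.rightOp ((linearYoneda R (ModuleCat.{u} R)).map α)) _).app
    P.complex

theorem homOpMap_f {M' : ModuleCat.{u} R} (α : M ⟶ M') (f : P.complex.X n ⟶ M) :
    (homOpMap P α).f n ≫ cochainOp P n f = cochainOp P n (f ≫ α) :=
  op_comp_eltOp (V := ModuleCat.of R (P.complex.X n ⟶ M))
    (W := ModuleCat.of R (P.complex.X n ⟶ M')) _ _

theorem map_op_comp_extIso {M' : ModuleCat.{u} R} (α : M ⟶ M') :
    (((Ext R (ModuleCat.{u} R) n).obj (op N)).map α).op ≫ (extIso P n M).hom =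
      (extIso P n M').hom ≫ HomologicalComplex.homologyMap (homOpMap P α) n := by
  rw [← Iso.eq_comp_inv, Category.assoc]
  exact ProjectiveResolution.leftDerived_app_eq
    (NatTrans.rightOp ((linearYoneda R (ModuleCat.{u} R)).map α)) P n

theorem map_extCls {M' : ModuleCat.{u} R} (α : M ⟶ M') (f : P.complex.X n ⟶ M)
    (hf : P.complex.d (n + 1) n ≫ f = 0) :
    (((Ext R (ModuleCat.{u} R) n).obj (op N)).map α).hom (extCls P f hf) =
      extCls P (f ≫ α) (by rw [reassoc_of% hf, zero_comp]) := by
  unfold extCls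
  rw [← opElt_comp, reassoc_of% map_op_comp_extIso P α, homologyMap_comp_homologyDesc]
  congr 2
  congr 1
  exact homOpMap_f P α f

/-- The augmentation of a projective resolution. -/
noncomputable def augm {N : ModuleCat.{u} R} (P : ProjectiveResolution N) : P.complex.X 0 ⟶ N :=
  P.π.f 0

section

variable {N' : ModuleCat.{u} R} (P' : ProjectiveResolution N') {P}

variable (M) in
/-- The morphism of complexes `Hom(P', M) ⟶ Hom(P, M)`, in the opposite category, induced by
a chain map. -/
noncomputable def homOpMapLeft (φ : P'.complex ⟶ P.complex) : homOp P' M ⟶ homOp P M :=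
  (((linearYoneda R (ModuleCat.{u} R)).obj M).rightOp.mapHomologicalComplex _).map φ

theorem mapLeft_op_comp_extIso (β : N' ⟶ N)
    (φ : P'.complex ⟶ P.complex) (comm : φ.f 0 ≫ augm P = augm P' ≫ β) :
    (((Ext R (ModuleCat.{u} R) n).map β.op).app M).op ≫ (extIso P n M).hom =
      (extIso P' n M).hom ≫ HomologicalComplex.homologyMap (homOpMapLeft M P' φ) n :=
  ProjectiveResolution.isoLeftDerivedObj_hom_naturality β P' P φ comm
    ((linearYoneda R (ModuleCat.{u} R)).obj M).rightOp n

theorem map_extCls_left (β : N' ⟶ N)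
    (φ : P'.complex ⟶ P.complex) (comm : φ.f 0 ≫ augm P = augm P' ≫ β)
    (f : P.complex.X n ⟶ M) (hf : P.complex.d (n + 1) n ≫ f = 0) :
    (((Ext R (ModuleCat.{u} R) n).map β.op).app M).hom (extCls P f hf) =
      extCls P' (φ.f n ≫ f) (by rw [← φ.comm_assoc, hf, comp_zero]) := by
  unfold extCls
  rw [← opElt_comp, reassoc_of% mapLeft_op_comp_extIso P' β φ comm, homologyMap_comp_homologyDesc]
  congr 2

end

end ExtClasses

section LocalCohomologyClasses

variable {R : Type u} [CommRing R]

theorem extCls_smul {N M : ModuleCat.{u} R} (P : ProjectiveResolution N) {n : ℕ} (r : R)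
    (f : P.complex.X n ⟶ M) (hf : P.complex.d (n + 1) n ≫ f = 0) :
    extCls P (r • f) (by rw [Linear.comp_smul, hf, smul_zero]) = r • extCls P f hf := by
  let ρ : op (ModuleCat.of R R) ⟶ op (ModuleCat.of R R) :=
    (ModuleCat.ofHom (LinearMap.lsmul R R r)).op
  have key : ∀ {V : ModuleCat.{u} R} (e : op V ⟶ op (ModuleCat.of R R)),
      opElt (e ≫ ρ) = r • opElt e := by
    intro V e
    change e.unop.hom (r • (1 : R)) = r • e.unop.hom (1 : R)
    rw [map_smul]
  have h1 : cochainOp P n (r • f) = cochainOp P n f ≫ ρ := by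
    apply opElt_inj (V := ModuleCat.of R (P.complex.X n ⟶ M))
    exact (opElt_eltOp (V := ModuleCat.of R (P.complex.X n ⟶ M)) _).trans
      ((congrArg (r • ·) (opElt_eltOp (V := ModuleCat.of R (P.complex.X n ⟶ M)) f).symm).trans
      (key (V := ModuleCat.of R (P.complex.X n ⟶ M)) _).symm)
  unfold extCls
  rw [← key, Category.assoc, homologyDesc_comp]
  congr 2
  congr 1

theorem extCls_smul_eq_zero {N M : ModuleCat.{u} R} (P : ProjectiveResolution N) {n : ℕ} (r : R)
    (hr : ∀ x : N, r • x = 0)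
    (f : P.complex.X n ⟶ M) (hf : P.complex.d (n + 1) n ≫ f = 0) :
    r • extCls P f hf = 0 := by
  have hz : r • (𝟙 N) = 0 := by
    apply ModuleCat.hom_ext
    ext x
    exact hr x
  have h1 := map_extCls_left P (P := P) (0 : N ⟶ N) (r • 𝟙 P.complex) (by
    have : (r • 𝟙 P.complex : P.complex ⟶ P.complex).f 0 = r • 𝟙 _ := rfl
    rw [this, Linear.smul_comp, Category.id_comp, comp_zero]
    rw [← Category.comp_id (augm P), ← Linear.comp_smul, hz, comp_zero]) f hf
  have h2 := map_extCls_left P (P := P) (0 : N ⟶ N) (0 : P.complex ⟶ P.complex) (by simp) f hf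
  rw [h1] at h2
  rw [← extCls_smul]
  have e1 : (r • 𝟙 P.complex : P.complex ⟶ P.complex).f n ≫ f = r • f := by
    have : (r • 𝟙 P.complex : P.complex ⟶ P.complex).f n = r • 𝟙 _ := rfl
    rw [this, Linear.smul_comp, Category.id_comp]
  have e2 : (0 : P.complex ⟶ P.complex).f n ≫ f = 0 := by simp
  rw [extCls_congr P _ e1.symm, h2, extCls_eq_zero_iff]
  exact ⟨n, 0, by rw [e2, comp_zero]⟩

variable (J : Ideal R)

/-- The module `R/J^t`. -/
noncomputable abbrev powQuot (t : ℕ) : ModuleCat.{u} R := ModuleCat.of R (R ⧸ J ^ t)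

/-- The chosen projective resolution of `R/J^t`. -/
noncomputable def powRes (t : ℕ) : ProjectiveResolution (powQuot J t) :=
  projectiveResolution (powQuot J t)

variable {J} in
/-- The projection `R/J^t' ⟶ R/J^t`. -/
noncomputable def powProj {t t' : ℕ} (h : t ≤ t') : powQuot J t' ⟶ powQuot J t :=
  ModuleCat.ofHom <| Submodule.mapQ _ _ LinearMap.id (Ideal.pow_le_pow_right h)

variable {J} in
/-- A chain map lifting `powProj`. -/
noncomputable def powLift {t t' : ℕ} (h : t ≤ t') : (powRes J t').complex ⟶ (powRes J t).complex :=
  ProjectiveResolution.lift (powProj h) (powRes J t') (powRes J t)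

theorem powLift_comm {t t' : ℕ} (h : t ≤ t') :
    (powLift h).f 0 ≫ augm (powRes J t) = augm (powRes J t') ≫ powProj (J := J) h :=
  ProjectiveResolution.lift_commutes_zero _ _ _

/-- Local cohomology. -/
noncomputable abbrev lc (n : ℕ) (M : ModuleCat.{u} R) : ModuleCat.{u} R :=
  (localCohomology J n).obj M

/-- The canonical map to local cohomology. -/
noncomputable def toLC (n t : ℕ) (M : ModuleCat.{u} R) : extObj (powQuot J t) n M ⟶ lc J n M :=
  have := localCohomology.hasColimitDiagram.{u, 0} (localCohomology.idealPowersDiagram J) n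
  (colimit.ι (localCohomology.diagram (localCohomology.idealPowersDiagram J) n) (op (op t))).app M

theorem toLC_naturality (n t : ℕ) {M M' : ModuleCat.{u} R} (α : M ⟶ M') :
    toLC J n t M ≫ (localCohomology J n).map α =
      ((Ext R (ModuleCat.{u} R) n).obj (op (powQuot J t))).map α ≫ toLC J n t M' := by
  have := localCohomology.hasColimitDiagram.{u, 0} (localCohomology.idealPowersDiagram J) n
  exact ((colimit.ι (localCohomology.diagram (localCohomology.idealPowersDiagram J) n)
    (op (op t))).naturality α).symm

theorem powProj_comp_toLC (n : ℕ) {t t' : ℕ} (h : t ≤ t') (M : ModuleCat.{u} R) :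
    ((Ext R (ModuleCat.{u} R) n).map (powProj (J := J) h).op).app M ≫ toLC J n t' M =
      toLC J n t M := by
  have := localCohomology.hasColimitDiagram.{u, 0} (localCohomology.idealPowersDiagram J) n
  exact congrArg (fun α => NatTrans.app α M)
    (colimit.w (localCohomology.diagram (localCohomology.idealPowersDiagram J) n)
      (homOfLE h).op.op)

theorem exists_toLC (n : ℕ) (M : ModuleCat.{u} R) (a : lc J n M) :
    ∃ (t : ℕ) (b : extObj (powQuot J t) n M), (toLC J n t M).hom b = a := by
  have := localCohomology.hasColimitDiagram.{u, 0} (localCohomology.idealPowersDiagram J) n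
  let D := localCohomology.diagram (localCohomology.idealPowersDiagram J) n
  have : PreservesFilteredColimitsOfSize.{0, 0} (forget (ModuleCat.{u} R)) :=
    preservesFilteredColimitsOfSize_shrink.{0, u, 0, u} _
  have hc := isColimitOfPreserves ((evaluation _ _).obj M) (colimit.isColimit D)
  obtain ⟨j, y, hy⟩ := Concrete.isColimit_exists_rep _ hc a
  exact ⟨j.unop.unop, y, hy⟩

theorem toLC_eq_zero (n t : ℕ) (M : ModuleCat.{u} R) (b : extObj (powQuot J t) n M)
    (h : (toLC J n t M).hom b = 0) : ∃ (t' : ℕ) (ht : t ≤ t'),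
      (((Ext R (ModuleCat.{u} R) n).map (powProj (J := J) ht).op).app M).hom b = 0 := by
  have := localCohomology.hasColimitDiagram.{u, 0} (localCohomology.idealPowersDiagram J) n
  let D := localCohomology.diagram (localCohomology.idealPowersDiagram J) n
  have : PreservesFilteredColimitsOfSize.{0, 0} (forget (ModuleCat.{u} R)) :=
    preservesFilteredColimitsOfSize_shrink.{0, u, 0, u} _
  have hc := isColimitOfPreserves ((evaluation _ _).obj M) (colimit.isColimit D)
  obtain ⟨k, f, g, hfg⟩ := Concrete.isColimit_exists_of_rep_eq _ hc (i := op (op t))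
    (j := op (op t)) b (0 : extObj (powQuot J t) n M) (by
      refine Eq.trans ?_ (map_zero (toLC J n t M).hom).symm
      exact h)
  refine ⟨k.unop.unop, leOfHom f.unop.unop, ?_⟩
  refine Eq.trans ?_ (hfg.trans (map_zero (ModuleCat.Hom.hom _)))
  rfl

end LocalCohomologyClasses

section LocalCohomologyCocycles

variable {R : Type u} [CommRing R] (J : Ideal R) {n : ℕ} {M : ModuleCat.{u} R}

/-- Cochains of degree `n` on the chosen resolution of `R/J^t`. -/
abbrev Cochain (t n : ℕ) (M : ModuleCat.{u} R) : Type u := (powRes J t).complex.X n ⟶ M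

/-- The differential of a cochain. -/
noncomputable abbrev cdiff {t : ℕ} {M : ModuleCat.{u} R} {n : ℕ} (m : ℕ) (f : Cochain J t n M) :
    Cochain J t m M :=
  (powRes J t).complex.d m n ≫ f

variable {J}

/-- The restriction of a cochain to a higher power. -/
noncomputable abbrev cres {t t' : ℕ} (h : t ≤ t') (f : Cochain J t n M) : Cochain J t' n M :=
  (powLift h).f n ≫ f

theorem cdiff_cres {t t' : ℕ} (h : t ≤ t') (f : Cochain J t n M) (m : ℕ) :
    cdiff J m (cres h f) = cres h (cdiff J m f) := by
  simp [cdiff, cres]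

theorem cdiff_cres_eq_zero {t t' : ℕ} (h : t ≤ t') {f : Cochain J t n M} {m : ℕ}
    (hf : cdiff J m f = 0) : cdiff J m (cres h f) = 0 := by
  rw [cdiff_cres, hf]; exact comp_zero

theorem cdiff_add {t m : ℕ} (f g : Cochain J t n M) :
    cdiff J m (f + g) = cdiff J m f + cdiff J m g :=
  Preadditive.comp_add _ _ _ _ _ _

theorem cdiff_sub {t m : ℕ} (f g : Cochain J t n M) :
    cdiff J m (f - g) = cdiff J m f - cdiff J m g :=
  Preadditive.comp_sub _ _ _

theorem cdiff_smul {t m : ℕ} (r : R) (f : Cochain J t n M) :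
    cdiff J m (r • f) = r • cdiff J m f :=
  Linear.comp_smul _ _ _ _ _ _

theorem cdiff_comp {t i j : ℕ} {M M' : ModuleCat.{u} R} (g : Cochain J t i M) (α : M ⟶ M') :
    cdiff J j (g ≫ α) = cdiff J j g ≫ α := by
  simp [cdiff]

/-- The class in local cohomology of a cocycle. -/
noncomputable def hcls {t : ℕ} (f : Cochain J t n M) (hf : cdiff J (n + 1) f = 0) : lc J n M :=
  (toLC J n t M).hom (extCls (powRes J t) f hf)

theorem hcls_congr {t : ℕ} {f g : Cochain J t n M} (hf : cdiff J (n + 1) f = 0)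
    (h : f = g) : hcls f hf = hcls g (h ▸ hf) := by
  subst h; rfl

theorem exists_hcls (a : lc J n M) :
    ∃ (t : ℕ) (f : Cochain J t n M) (hf : cdiff J (n + 1) f = 0), hcls f hf = a := by
  obtain ⟨t, b, rfl⟩ := exists_toLC J n M a
  obtain ⟨f, hf, rfl⟩ := exists_extCls (powRes J t) b
  exact ⟨t, f, hf, rfl⟩

theorem hcls_cres {t t' : ℕ} (h : t ≤ t') (f : Cochain J t n M) (hf : cdiff J (n + 1) f = 0) :
    hcls (cres h f) (cdiff_cres_eq_zero h hf) = hcls f hf := by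
  unfold hcls
  have h1 := map_extCls_left (powRes J t') (P := powRes J t) (powProj h) (powLift h)
    (powLift_comm J h) f hf
  rw [← h1, ← powProj_comp_toLC J n h M]
  rfl

theorem hcls_eq_zero_iff {t : ℕ} (f : Cochain J t n M) (hf : cdiff J (n + 1) f = 0) :
    hcls f hf = 0 ↔ ∃ (t' : ℕ) (h : t ≤ t') (j : ℕ) (g : Cochain J t' j M),
      cdiff J n g = cres h f := by
  constructor
  · intro h0
    obtain ⟨t', ht, h1⟩ := toLC_eq_zero J n t M _ h0
    rw [map_extCls_left (powRes J t') (P := powRes J t) (powProj ht) (powLift ht)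
      (powLift_comm J ht) f hf, extCls_eq_zero_iff] at h1
    obtain ⟨j, g, hg⟩ := h1
    exact ⟨t', ht, j, g, hg⟩
  · rintro ⟨t', ht, j, g, hg⟩
    rw [← hcls_cres ht f hf, hcls, (extCls_eq_zero_iff _ _ _).2 ⟨j, g, hg⟩, map_zero]

theorem hcls_eq_zero {t j : ℕ} (f : Cochain J t n M) (hf : cdiff J (n + 1) f = 0)
    (g : Cochain J t j M) (hg : cdiff J n g = f) : hcls f hf = 0 := by
  rw [hcls, (extCls_eq_zero_iff _ _ _).2 ⟨j, g, hg⟩, map_zero]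

theorem hcls_add {t : ℕ} (f g : Cochain J t n M) (hf : cdiff J (n + 1) f = 0)
    (hg : cdiff J (n + 1) g = 0) :
    hcls (f + g) (by rw [cdiff_add, hf, hg, add_zero]) =
      hcls f hf + hcls g hg := by
  unfold hcls
  rw [extCls_add, map_add]

theorem hcls_smul {t : ℕ} (r : R) (f : Cochain J t n M) (hf : cdiff J (n + 1) f = 0) :
    hcls (r • f) (by rw [cdiff_smul, hf, smul_zero]) =
      r • hcls f hf := by
  unfold hcls
  rw [extCls_smul, map_smul]

theorem map_hcls {M' : ModuleCat.{u} R} (α : M ⟶ M') {t : ℕ} (f : Cochain J t n M)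
    (hf : cdiff J (n + 1) f = 0) :
    ((localCohomology J n).map α).hom (hcls f hf) =
      hcls (f ≫ α) (by rw [cdiff_comp, hf, zero_comp]) := by
  unfold hcls
  have h1 := congrArg (fun β => β.hom (extCls (powRes J t) f hf)) (toLC_naturality J n t α)
  refine h1.trans ?_
  exact congrArg (toLC J n t M').hom (map_extCls (powRes J t) α f hf)

theorem smul_hcls_eq_zero {t : ℕ} {r : R} (hr : r ∈ J ^ t) (f : Cochain J t n M)
    (hf : cdiff J (n + 1) f = 0) : r • hcls f hf = 0 := by
  unfold hcls
  rw [← map_smul, extCls_smul_eq_zero, map_zero]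
  rintro ⟨x⟩
  change Submodule.Quotient.mk (r • x) = (0 : R ⧸ J ^ t)
  rw [Submodule.Quotient.mk_eq_zero]
  exact (J ^ t).mul_mem_right x hr

theorem exists_pow_smul_eq_zero (a : lc J n M) : ∃ t, ∀ r ∈ J ^ t, r • a = 0 := by
  obtain ⟨t, f, hf, rfl⟩ := exists_hcls a
  exact ⟨t, fun r hr => smul_hcls_eq_zero hr f hf⟩

end LocalCohomologyCocycles

section Connecting

variable {R : Type u} [CommRing R] {J : Ideal R} {n : ℕ}

theorem cdiff_of_ne {t m j : ℕ} {M : ModuleCat.{u} R} (h : j + 1 ≠ m) (g : Cochain J t j M) :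
    cdiff J m g = 0 := by
  rw [cdiff, (powRes J t).complex.shape m j (by simpa using h), zero_comp]

theorem cdiff_cdiff {t i j k : ℕ} {M : ModuleCat.{u} R} (g : Cochain J t k M) :
    cdiff J i (cdiff J j g) = 0 := by
  simp [cdiff]

theorem cres_comp {t t' i : ℕ} {M M' : ModuleCat.{u} R} (h : t ≤ t') (g : Cochain J t i M)
    (α : M ⟶ M') : cres h (g ≫ α) = cres h g ≫ α := by
  simp [cres]

theorem exists_lift_cochain {t i : ℕ} {S : ShortComplex (ModuleCat.{u} R)} (hS : S.ShortExact)
    (f : Cochain J t i S.X₃) : ∃ f' : Cochain J t i S.X₂, f' ≫ S.g = f := by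
  have := hS.epi_g
  exact ⟨Projective.factorThru f S.g, Projective.factorThru_comp _ _⟩

theorem exists_desc_cochain {t i : ℕ} {S : ShortComplex (ModuleCat.{u} R)} (hS : S.ShortExact)
    (f : Cochain J t i S.X₂) (hf : f ≫ S.g = 0) : ∃ f' : Cochain J t i S.X₁, f' ≫ S.f = f := by
  have := hS.mono_f
  exact ⟨hS.exact.lift f hf, hS.exact.lift_f f hf⟩

/-- The connecting relation of a short exact sequence. -/
def Connects (J : Ideal R) (S : ShortComplex (ModuleCat.{u} R)) (a : lc J n S.X₃)
    (b : lc J (n + 1) S.X₁) : Prop :=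
  ∃ (t : ℕ) (f : Cochain J t n S.X₂) (g : Cochain J t (n + 1) S.X₁)
    (hf : cdiff J (n + 1) (f ≫ S.g) = 0) (hg : cdiff J (n + 1 + 1) g = 0),
    g ≫ S.f = cdiff J (n + 1) f ∧ hcls (f ≫ S.g) hf = a ∧ hcls g hg = b

variable {S : ShortComplex (ModuleCat.{u} R)} (hS : S.ShortExact)

include hS

theorem connects_of_lift {t : ℕ} {f : Cochain J t n S.X₂} {g : Cochain J t (n + 1) S.X₁}
    (h : g ≫ S.f = cdiff J (n + 1) f) :
    ∃ (hf : cdiff J (n + 1) (f ≫ S.g) = 0) (hg : cdiff J (n + 1 + 1) g = 0),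
      Connects J S (hcls (f ≫ S.g) hf) (hcls g hg) := by
  have := hS.mono_f
  have hf : cdiff J (n + 1) (f ≫ S.g) = 0 := by
    rw [cdiff_comp, ← h, Category.assoc, S.zero, comp_zero]
  have hg : cdiff J (n + 1 + 1) g = 0 := by
    rw [← cancel_mono S.f, ← cdiff_comp, h, cdiff_cdiff, zero_comp]
  exact ⟨hf, hg, t, f, g, hf, hg, h, rfl, rfl⟩

theorem exists_connects (a : lc J n S.X₃) : ∃ b, Connects J S a b := by
  obtain ⟨t, f', hf', rfl⟩ := exists_hcls a
  obtain ⟨f, rfl⟩ := exists_lift_cochain hS f'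
  obtain ⟨g, hg⟩ := exists_desc_cochain hS (cdiff J (n + 1) f) (by rw [← cdiff_comp, hf'])
  obtain ⟨_, _, h⟩ := connects_of_lift hS hg
  exact ⟨_, h⟩

theorem exists_connects_of_map_eq_zero {b : lc J (n + 1) S.X₁}
    (h : ((localCohomology J (n + 1)).map S.f).hom b = 0) : ∃ a : lc J n S.X₃, Connects J S a b := by
  obtain ⟨t, g, hg, rfl⟩ := exists_hcls b
  rw [map_hcls, hcls_eq_zero_iff] at h
  obtain ⟨t', ht, j, f, hf⟩ := h
  rw [← hcls_cres ht g hg]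
  obtain ⟨f, hf⟩ : ∃ f : Cochain J t' n S.X₂, cres ht g ≫ S.f = cdiff J (n + 1) f := by
    by_cases hj : j = n
    · subst hj
      exact ⟨f, by rw [hf, cres_comp]⟩
    · refine ⟨0, ?_⟩
      rw [← cres_comp, ← hf, cdiff_of_ne (by omega)]
      simp
  obtain ⟨_, _, h⟩ := connects_of_lift hS hf
  exact ⟨_, h⟩

theorem Connects.eq_zero {b : lc J (n + 1) S.X₁} (h : Connects J S (0 : lc J n S.X₃) b) : b = 0 := by
  have := hS.mono_f
  obtain ⟨t, f, g, hf, hg, h, h0, rfl⟩ := h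
  rw [hcls_eq_zero_iff] at h0
  obtain ⟨t', ht, j, k, hk⟩ := h0
  obtain ⟨k, rfl⟩ := exists_lift_cochain hS k
  obtain ⟨l, hl⟩ := exists_desc_cochain hS (cres ht f - cdiff J n k) (by
    rw [Preadditive.sub_comp, ← cdiff_comp, hk, cres_comp, sub_self])
  rw [← hcls_cres ht]
  refine hcls_eq_zero _ _ l ?_
  rw [← cancel_mono S.f, ← cdiff_comp, hl, ← cres_comp, h, ← cdiff_cres]
  rw [cdiff_sub, cdiff_cdiff, sub_zero]

theorem Connects.exists_map_eq {a : lc J n S.X₃} (h : Connects J S a (0 : lc J (n + 1) S.X₁)) :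
    ∃ c, ((localCohomology J n).map S.g).hom c = a := by
  have := hS.mono_f
  obtain ⟨t, f, g, hf, hg, h, rfl, h0⟩ := h
  rw [hcls_eq_zero_iff] at h0
  obtain ⟨t', ht, j, k, hk⟩ := h0
  obtain ⟨k, hk⟩ : ∃ k : Cochain J t' n S.X₁, cdiff J (n + 1) k = cres ht g := by
    by_cases hj : j = n
    · subst hj
      exact ⟨k, hk⟩
    · refine ⟨0, ?_⟩
      rw [← hk, cdiff_of_ne (by omega) k]
      simp
  have hc : cdiff J (n + 1) (cres ht f - k ≫ S.f) = 0 := by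
    rw [cdiff_sub, sub_eq_zero, cdiff_comp k S.f, hk, ← cres_comp, h, cdiff_cres]
  refine ⟨hcls _ hc, ?_⟩
  rw [map_hcls, ← hcls_cres ht]
  refine hcls_congr _ ?_
  rw [Preadditive.sub_comp, ← cres_comp, Category.assoc k, S.zero, comp_zero, sub_zero]

theorem Connects.add {a a' : lc J n S.X₃} {b b' : lc J (n + 1) S.X₁} (h : Connects J S a b)
    (h' : Connects J S a' b') : Connects J S (a + a') (b + b') := by
  obtain ⟨t, f, g, hf, hg, h, rfl, rfl⟩ := h
  obtain ⟨t', f', g', hf', hg', h', rfl, rfl⟩ := h'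
  have hl := le_max_left t t'
  have hr := le_max_right t t'
  obtain ⟨h1, h2, h3⟩ := connects_of_lift hS (f := cres hl f + cres hr f')
    (g := cres hl g + cres hr g') (by
      rw [Preadditive.add_comp, ← cres_comp, ← cres_comp, h, h', ← cdiff_cres, ← cdiff_cres]
      simp [cdiff])
  convert h3 using 1
  · rw [← hcls_cres hl, ← hcls_cres hr, ← hcls_add]
    refine hcls_congr _ ?_
    simp
  · rw [← hcls_cres hl, ← hcls_cres hr, ← hcls_add]

theorem Connects.smul (r : R) {a : lc J n S.X₃} {b : lc J (n + 1) S.X₁} (h : Connects J S a b) :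
    Connects J S (r • a) (r • b) := by
  obtain ⟨t, f, g, hf, hg, h, rfl, rfl⟩ := h
  obtain ⟨h1, h2, h3⟩ := connects_of_lift hS (f := r • f) (g := r • g) (by
      rw [Linear.smul_comp, h]; simp [cdiff])
  convert h3 using 1
  · rw [← hcls_smul]
    refine hcls_congr _ ?_
    simp
  · rw [← hcls_smul]

end Connecting

section Multiplication

variable {R : Type u} [CommRing R] {J : Ideal R} {n : ℕ}

theorem exists_smul_eq_zero_of_subsingleton_aux {V : Type*} [AddCommGroup V] [Module R V] {x : R}
    (hx : ∀ v : V, x • v = 0 → v = 0) (t : ℕ) (v : V) (h : x ^ t • v = 0) : v = 0 := by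
  induction t with
  | zero => simpa using h
  | succ t ih =>
    rw [pow_succ', mul_smul] at h
    exact ih (hx _ h)

theorem subsingleton_lc_of_smul_injective {M : ModuleCat.{u} R} {x : R} (hxJ : x ∈ J)
    (hx : ∀ v : lc J n M, x • v = 0 → v = 0) : Subsingleton (lc J n M) := by
  refine subsingleton_of_forall_eq 0 fun v => ?_
  obtain ⟨t, ht⟩ := exists_pow_smul_eq_zero v
  exact exists_smul_eq_zero_of_subsingleton_aux hx t v (ht _ (Ideal.pow_mem_pow hxJ t))

variable {M M'' : Type u} [AddCommGroup M] [Module R M] [AddCommGroup M''] [Module R M'']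

/-- `p` presents `M''` as `M/xM` for a nonzerodivisor `x` of `M`. -/
structure IsRegQuot (x : R) (p : M →ₗ[R] M'') : Prop where
  reg : ∀ m : M, x • m = 0 → m = 0
  surj : Function.Surjective p
  ker : ∀ m : M, p m = 0 ↔ ∃ m', x • m' = m

variable {x : R} {p : M →ₗ[R] M''} 

/-- The sequence `M ⟶ M ⟶ M/xM`. -/
noncomputable def regSeq (hp : IsRegQuot x p) : ShortComplex (ModuleCat.{u} R) :=
  ShortComplex.mk (ModuleCat.ofHom (LinearMap.lsmul R M x)) (ModuleCat.ofHom p) (by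
    apply ModuleCat.hom_ext
    ext m
    exact (hp.ker _).2 ⟨m, rfl⟩)

theorem regSeq_shortExact (hp : IsRegQuot x p) : (regSeq hp).ShortExact := by
  have h1 : Mono (regSeq hp).f := by
    rw [ModuleCat.mono_iff_injective]
    exact (injective_iff_map_eq_zero (LinearMap.lsmul R M x)).2 hp.reg
  have h2 : Epi (regSeq hp).g := by
    rw [ModuleCat.epi_iff_surjective]
    exact hp.surj
  refine ShortComplex.ShortExact.mk ?_
  rw [ShortComplex.moduleCat_exact_iff]
  intro m hm
  exact (hp.ker m).1 hm

theorem map_lsmul (x : R) (v : lc J n (ModuleCat.of R M)) :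
    ((localCohomology J n).map (ModuleCat.ofHom (LinearMap.lsmul R M x))).hom v = x • v := by
  obtain ⟨t, f, hf, rfl⟩ := exists_hcls v
  rw [map_hcls, ← hcls_smul]
  refine hcls_congr _ ?_
  apply ModuleCat.hom_ext
  ext a
  rfl

theorem IsRegQuot.subsingleton_zero (hp : IsRegQuot x p) (hxJ : x ∈ J) :
    Subsingleton (lc J 0 (ModuleCat.of R M)) := by
  have := (regSeq_shortExact hp).mono_f
  refine subsingleton_lc_of_smul_injective hxJ fun v hv => ?_
  rw [← map_lsmul] at hv
  obtain ⟨t, f, hf, rfl⟩ := exists_hcls v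
  rw [map_hcls, hcls_eq_zero_iff] at hv
  obtain ⟨t', ht, j, g, hg⟩ := hv
  rw [cdiff_of_ne (by omega), cres_comp] at hg
  rw [← hcls_cres ht]
  have h0 : cres ht f = 0 := by
    have := (regSeq_shortExact hp).mono_f
    refine (cancel_mono (regSeq hp).f).1 ?_
    exact hg.symm.trans zero_comp.symm
  rw [hcls_congr _ h0]
  exact hcls_eq_zero _ _ (0 : Cochain J t' 0 _) (by simp [cdiff])

theorem IsRegQuot.subsingleton_succ (hp : IsRegQuot x p) (hxJ : x ∈ J)
    (h : Subsingleton (lc J n (ModuleCat.of R M''))) :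
    Subsingleton (lc J (n + 1) (ModuleCat.of R M)) := by
  refine subsingleton_lc_of_smul_injective hxJ fun v hv => ?_
  rw [← map_lsmul] at hv
  obtain ⟨a, ha⟩ := exists_connects_of_map_eq_zero (regSeq_shortExact hp) hv
  obtain rfl : a = 0 := Subsingleton.elim (α := lc J n (ModuleCat.of R M'')) _ _
  exact ha.eq_zero (regSeq_shortExact hp)

theorem IsRegQuot.eq_zero_of_connects (hp : IsRegQuot x p)
    (h1 : Subsingleton (lc J n (ModuleCat.of R M))) {a : lc J n (ModuleCat.of R M'')}
    (h : Connects J (regSeq hp) a (0 : lc J (n + 1) (ModuleCat.of R M))) : a = 0 := by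
  obtain ⟨c, rfl⟩ := h.exists_map_eq (regSeq_shortExact hp)
  obtain rfl : c = 0 := Subsingleton.elim (α := lc J n (ModuleCat.of R M)) _ _
  exact map_zero _

theorem IsRegQuot.subsingleton_quot (hp : IsRegQuot x p)
    (h1 : Subsingleton (lc J n (ModuleCat.of R M)))
    (h2 : Subsingleton (lc J (n + 1) (ModuleCat.of R M))) :
    Subsingleton (lc J n (ModuleCat.of R M'')) := by
  refine subsingleton_of_forall_eq 0 fun a => ?_
  obtain ⟨b, hb⟩ := exists_connects (regSeq_shortExact hp) a
  obtain rfl : b = 0 := Subsingleton.elim (α := lc J (n + 1) (ModuleCat.of R M)) _ _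
  exact hp.eq_zero_of_connects h1 hb

/-- The connecting map, when it is injective. -/
theorem IsRegQuot.exists_connecting (hp : IsRegQuot x p)
    (h1 : Subsingleton (lc J n (ModuleCat.of R M))) :
    ∃ δ : lc J n (ModuleCat.of R M'') →ₗ[R] lc J (n + 1) (ModuleCat.of R M),
      Function.Injective δ ∧ ∀ b, x • b = 0 → ∃ a, δ a = b := by
  have hS := regSeq_shortExact hp
  choose δ hδ using fun a : lc J n (ModuleCat.of R M'') =>
    (exists_connects hS a : ∃ b : lc J (n + 1) (ModuleCat.of R M), Connects J (regSeq hp) a b)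
  have uniq : ∀ (a : lc J n (ModuleCat.of R M'')) (b b' : lc J (n + 1) (ModuleCat.of R M)),
      Connects J (regSeq hp) a b → Connects J (regSeq hp) a b' → b = b' := by
    intro a b b' h h'
    have h3 := h.add hS (h'.smul hS (-1))
    have ha : a + (-1 : R) • a = 0 := by rw [neg_one_smul, add_neg_cancel]
    have h4 : Connects J (regSeq hp) (0 : lc J n (ModuleCat.of R M'')) (b + (-1 : R) • b') :=
      ha ▸ h3
    have h5 : b + (-1 : R) • b' = 0 := h4.eq_zero hS
    rwa [neg_one_smul, ← sub_eq_add_neg, sub_eq_zero] at h5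
  let D : lc J n (ModuleCat.of R M'') →ₗ[R] lc J (n + 1) (ModuleCat.of R M) :=
    { toFun := δ
      map_add' := fun a a' => uniq _ _ _ (hδ _) ((hδ a).add hS (hδ a'))
      map_smul' := fun r a => uniq _ _ _ (hδ _) ((hδ a).smul hS r) }
  refine ⟨D, ?_, ?_⟩
  · refine (injective_iff_map_eq_zero D).2 fun a ha => ?_
    have h := hδ a
    rw [show δ a = 0 from ha] at h
    exact hp.eq_zero_of_connects h1 h
  · intro b hb
    rw [← map_lsmul] at hb
    obtain ⟨a, ha⟩ := exists_connects_of_map_eq_zero hS hb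
    exact ⟨a, uniq _ _ _ (hδ a) ha⟩

theorem moduleLength_congr {V W : Type u} [AddCommGroup V] [Module R V] [AddCommGroup W]
    [Module R W] (e : V ≃ₗ[R] W) : moduleLength R V = moduleLength R W :=
  Order.krullDim_eq_of_orderIso (Submodule.orderIsoMapComap e)

/-- The length of the socle. -/
noncomputable def socLength (J : Ideal R) (V : Type u) [AddCommGroup V] [Module R V] :
    WithBot ℕ∞ :=
  moduleLength R ↥(Submodule.torsionBySet R V (J : Set R))

theorem socLength_eq {V W : Type u} [AddCommGroup V] [Module R V] [AddCommGroup W]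
    [Module R W] (δ : V →ₗ[R] W) (hδ : Function.Injective δ)
    (h : ∀ w : W, (∀ r ∈ J, r • w = 0) → ∃ v, δ v = w) : socLength J V = socLength J W := by
  refine moduleLength_congr (LinearEquiv.ofBijective
    (δ.restrict (p := Submodule.torsionBySet R V (J : Set R))
      (q := Submodule.torsionBySet R W (J : Set R)) ?_) ⟨?_, ?_⟩)
  · intro v hv
    rw [Submodule.mem_torsionBySet_iff] at hv ⊢
    intro a
    rw [← map_smul, hv a, map_zero]
  · intro v v' hv
    exact Subtype.ext (hδ (congrArg Subtype.val hv))
  · rintro ⟨w, hw⟩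
    rw [Submodule.mem_torsionBySet_iff] at hw
    obtain ⟨v, rfl⟩ := h w fun r hr => hw ⟨r, hr⟩
    refine ⟨⟨v, ?_⟩, rfl⟩
    rw [Submodule.mem_torsionBySet_iff]
    intro a
    apply hδ
    rw [map_smul, hw a, map_zero]

theorem IsRegQuot.socLength_eq (hp : IsRegQuot x p) (hxJ : x ∈ J)
    (h1 : Subsingleton (lc J n (ModuleCat.of R M))) :
    socLength J (lc J n (ModuleCat.of R M'')) = socLength J (lc J (n + 1) (ModuleCat.of R M)) := by
  obtain ⟨δ, h2, h3⟩ := hp.exists_connecting h1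
  exact CParam.socLength_eq δ h2 fun w hw => h3 w (hw x hxJ)

end Multiplication

section Zeroth

variable {R : Type u} [CommRing R] {J : Ideal R} {M : Type u} [AddCommGroup M] [Module R M]

theorem exists_desc_augm {N : ModuleCat.{u} R} (P : ProjectiveResolution N) {M : ModuleCat.{u} R}
    (f : P.complex.X 0 ⟶ M) (hf : P.complex.d 1 0 ≫ f = 0) : ∃ f' : N ⟶ M, augm P ≫ f' = f :=
  ⟨P.isColimitCokernelCofork.desc (CokernelCofork.ofπ f hf),
    P.isColimitCokernelCofork.fac (CokernelCofork.ofπ f hf) WalkingParallelPair.one⟩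

theorem d_comp_augm {N : ModuleCat.{u} R} (P : ProjectiveResolution N) :
    P.complex.d 1 0 ≫ augm P = 0 :=
  P.complex_d_comp_π_f_zero

theorem epi_augm {N : ModuleCat.{u} R} (P : ProjectiveResolution N) : Epi (augm P) :=
  inferInstanceAs (Epi (P.π.f 0))

/-- The map `R/J^t ⟶ M` defined by an element annihilated by `J^t`. -/
noncomputable def powDesc {t : ℕ} {m : M} (h : ∀ r ∈ J ^ t, r • m = 0) :
    powQuot J t ⟶ ModuleCat.of R M :=
  ModuleCat.ofHom (Submodule.liftQ (J ^ t) (LinearMap.toSpanSingleton R M m) fun r hr => h r hr)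

theorem cdiff_augm_powDesc {t : ℕ} {m : M} (h : ∀ r ∈ J ^ t, r • m = 0) :
    cdiff J 1 (augm (powRes J t) ≫ powDesc h) = 0 := by
  rw [cdiff, reassoc_of% d_comp_augm, zero_comp]

theorem eq_zero_of_hcls_powDesc_eq_zero {k : ℕ} {m : M} (h : ∀ r ∈ J ^ k, r • m = 0)
    (hm : hcls (augm (powRes J k) ≫ powDesc h) (cdiff_augm_powDesc h) = 0) : m = 0 := by
  obtain ⟨t, ht, j, g, hg⟩ := (hcls_eq_zero_iff _ _).1 hm
  rw [cdiff_of_ne (by omega), cres, ← Category.assoc, powLift_comm, Category.assoc] at hg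
  have := epi_augm (powRes J t)
  have h1 : powProj ht ≫ powDesc h = 0 := by
    rw [← cancel_epi (augm (powRes J t)), comp_zero]
    exact hg.symm
  have h2 := congrArg (fun α => α.hom (Submodule.Quotient.mk (1 : R))) h1
  have h3 : (1 : R) • m = 0 := h2
  rwa [one_smul] at h3

theorem eq_zero_of_subsingleton_lc_zero (h0 : Subsingleton (lc J 0 (ModuleCat.of R M))) {k : ℕ}
    {m : M} (h : ∀ r ∈ J ^ k, r • m = 0) : m = 0 :=
  eq_zero_of_hcls_powDesc_eq_zero h (Subsingleton.elim _ _)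

theorem hcls_zero_linearEquiv (k : ℕ) (h : ∀ r ∈ J ^ k, ∀ m : M, r • m = 0) :
    Nonempty (M ≃ₗ[R] lc J 0 (ModuleCat.of R M)) := by
  have hk : ∀ m : M, ∀ r ∈ J ^ k, r • m = 0 := fun m r hr => h r hr m
  have hadd : ∀ m m', powDesc (hk (m + m')) = powDesc (hk m) + powDesc (hk m') := by
    intro m m'
    apply ModuleCat.hom_ext
    apply Submodule.linearMap_qext
    apply LinearMap.ext_ring
    change (1 : R) • (m + m') = (1 : R) • m + (1 : R) • m'
    rw [smul_add]
  have hsmul : ∀ (r : R) m, powDesc (hk (r • m)) = r • powDesc (hk m) := by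
    intro r m
    apply ModuleCat.hom_ext
    apply Submodule.linearMap_qext
    apply LinearMap.ext_ring
    change (1 : R) • (r • m) = r • ((1 : R) • m)
    rw [smul_comm]
  let φ : M →ₗ[R] lc J 0 (ModuleCat.of R M) :=
    { toFun := fun m => hcls (augm (powRes J k) ≫ powDesc (hk m)) (cdiff_augm_powDesc (hk m))
      map_add' := fun m m' => by
        rw [← hcls_add]
        exact hcls_congr _ (by rw [hadd, Preadditive.comp_add])
      map_smul' := fun r m => by
        rw [RingHom.id_apply, ← hcls_smul]
        exact hcls_congr _ (by rw [hsmul, Linear.comp_smul]) }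
  refine ⟨LinearEquiv.ofBijective φ ⟨?_, ?_⟩⟩
  · exact (injective_iff_map_eq_zero φ).2 fun m hm => eq_zero_of_hcls_powDesc_eq_zero (hk m) hm
  · intro a
    obtain ⟨t, f, hf, rfl⟩ := exists_hcls a
    obtain ⟨t', f, hf, hcl, ht⟩ : ∃ (t' : ℕ) (f' : Cochain J t' 0 (ModuleCat.of R M))
        (hf' : cdiff J 1 f' = 0), hcls f' hf' = hcls f hf ∧ k ≤ t' :=
      ⟨max k t, cres (le_max_right k t) f, _, hcls_cres _ f hf, le_max_left k t⟩
    rw [← hcl]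
    obtain ⟨f, rfl⟩ := exists_desc_augm (powRes J t') f hf
    refine ⟨f.hom (Submodule.Quotient.mk (1 : R)), ?_⟩
    change hcls _ (cdiff_augm_powDesc (hk _)) = _
    rw [← hcls_cres ht]
    refine hcls_congr _ ?_
    rw [cres, ← Category.assoc, powLift_comm, Category.assoc]
    congr 1
    apply ModuleCat.hom_ext
    apply Submodule.linearMap_qext
    apply LinearMap.ext_ring
    change (1 : R) • f.hom (Submodule.Quotient.mk (1 : R)) = f.hom (Submodule.Quotient.mk (1 : R))
    rw [one_smul]

theorem socLength_lc_zero (k : ℕ) (h : ∀ r ∈ J ^ k, ∀ m : M, r • m = 0) :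
    socLength J (lc J 0 (ModuleCat.of R M)) = socLength J M := by
  obtain ⟨e⟩ := hcls_zero_linearEquiv k h
  exact (socLength_eq e.toLinearMap e.injective fun w _ => e.surjective w).symm

end Zeroth

section Transfer

variable {R : Type u} [CommRing R] {J : Ideal R}

/-- Local cohomology respects linear equivalences. -/
noncomputable def lcCongr (J : Ideal R) (n : ℕ) {M N : Type u} [AddCommGroup M] [Module R M]
    [AddCommGroup N] [Module R N] (e : M ≃ₗ[R] N) :
    lc J n (ModuleCat.of R M) ≃ₗ[R] lc J n (ModuleCat.of R N) :=
  ((localCohomology J n).mapIso e.toModuleIso).toLinearEquiv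

theorem exists_isRegQuot {I I' : Ideal R} {x : R} (h : I' = I ⊔ Ideal.span {x})
    (hreg : ∀ u, x * u ∈ I → u ∈ I) : ∃ p : (R ⧸ I) →ₗ[R] (R ⧸ I'), IsRegQuot x p := by
  have hle : I ≤ I' := h ▸ le_sup_left
  refine ⟨Submodule.factor hle, ?_, ?_, ?_⟩
  · intro m hm
    obtain ⟨u, rfl⟩ := Submodule.Quotient.mk_surjective _ m
    rw [← Submodule.Quotient.mk_smul, Submodule.Quotient.mk_eq_zero] at hm
    exact (Submodule.Quotient.mk_eq_zero _).2 (hreg u hm)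
  · intro m
    obtain ⟨u, rfl⟩ := Submodule.Quotient.mk_surjective _ m
    exact ⟨Submodule.Quotient.mk u, rfl⟩
  · intro m
    obtain ⟨u, rfl⟩ := Submodule.Quotient.mk_surjective _ m
    change (Submodule.Quotient.mk u : R ⧸ I') = 0 ↔ _
    rw [Submodule.Quotient.mk_eq_zero, h]
    constructor
    · intro hu
      obtain ⟨a, ha, b, hb, rfl⟩ := Submodule.mem_sup.1 hu
      obtain ⟨c, rfl⟩ := Ideal.mem_span_singleton'.1 hb
      refine ⟨Submodule.Quotient.mk c, ?_⟩
      rw [← Submodule.Quotient.mk_smul, Submodule.Quotient.eq]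
      have : x • c - (a + c * x) = -a := by rw [smul_eq_mul]; ring
      rw [this]
      exact I.neg_mem ha
    · rintro ⟨m', hm'⟩
      obtain ⟨c, rfl⟩ := Submodule.Quotient.mk_surjective _ m'
      rw [← Submodule.Quotient.mk_smul, Submodule.Quotient.eq] at hm'
      have h1 : u = -(x • c - u) + c * x := by rw [smul_eq_mul]; ring
      rw [h1]
      exact Submodule.add_mem_sup (I.neg_mem hm')
        (Ideal.mul_mem_left _ _ (Ideal.mem_span_singleton_self x))

end Transfer

section Depth

variable {R : Type u} [CommRing R] [IsLocalRing R] [IsNoetherianRing R]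

omit [IsLocalRing R] in
theorem mem_associatedPrimes_quotient {I p : Ideal R} : p ∈ associatedPrimes R (R ⧸ I) ↔
    p.IsPrime ∧ ∃ w, ∀ a, a ∈ p ↔ a * w ∈ I := by
  rw [AssociatedPrimes.mem_iff, isAssociatedPrime_iff]
  refine and_congr_right fun _ => ?_
  have key (w a : R) : a ∈ (⊥ : Submodule R (R ⧸ I)).colon {Submodule.Quotient.mk w} ↔
      a * w ∈ I := by
    rw [Submodule.mem_colon_singleton, Submodule.mem_bot, ← Submodule.Quotient.mk_smul,
      Submodule.Quotient.mk_eq_zero, smul_eq_mul]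
  constructor
  · rintro ⟨x, rfl⟩
    obtain ⟨w, rfl⟩ := Submodule.Quotient.mk_surjective _ x
    exact ⟨w, key w⟩
  · rintro ⟨w, hw⟩
    exact ⟨Submodule.Quotient.mk w, Ideal.ext fun a => (hw a).trans (key w a).symm⟩

omit [IsLocalRing R] in
theorem exists_mem_associatedPrimes_quotient {I : Ideal R} {w : R} (hw : w ∉ I) :
    ∃ p ∈ associatedPrimes R (R ⧸ I), ∀ a, a * w ∈ I → a ∈ p := by
  obtain ⟨p, hp, h⟩ := exists_le_isAssociatedPrime_of_isNoetherianRing R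
    (Submodule.Quotient.mk w : R ⧸ I) (by rwa [Ne, Submodule.Quotient.mk_eq_zero])
  refine ⟨p, hp, fun a ha => h ?_⟩
  rwa [Submodule.mem_colon_singleton, Submodule.mem_bot, ← Submodule.Quotient.mk_smul,
    Submodule.Quotient.mk_eq_zero]

theorem exists_regular_of_subsingleton_lc_zero {I : Ideal R}
    (h0 : Subsingleton (lc (maximalIdeal R) 0 (ModuleCat.of R (R ⧸ I)))) :
    ∃ y ∈ maximalIdeal R, ∀ u, y * u ∈ I → u ∈ I := by
  by_contra! hcon
  have hfin := associatedPrimes.finite R (R ⧸ I)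
  have hsub : (maximalIdeal R : Set R) ⊆
      ⋃ p ∈ (↑hfin.toFinset : Set (Ideal R)), ((id p : Ideal R) : Set R) := by
    intro y hy
    obtain ⟨u, hyu, hu⟩ := hcon y hy
    obtain ⟨p, hp, h⟩ := exists_mem_associatedPrimes_quotient hu
    exact Set.mem_biUnion (by simpa using hp) (h y hyu)
  obtain ⟨p, hp, hle⟩ := (Ideal.subset_union_prime ⊥ ⊥ fun p hp _ _ =>
    (mem_associatedPrimes_quotient.1 (hfin.mem_toFinset.1 hp)).1).1 hsub
  obtain ⟨hprime, w, hw⟩ := mem_associatedPrimes_quotient.1 (hfin.mem_toFinset.1 hp)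
  have hw0 : w ∈ I := by
    rw [← Submodule.Quotient.mk_eq_zero]
    refine eq_zero_of_subsingleton_lc_zero h0 (k := 1) fun r hr => ?_
    rw [← Submodule.Quotient.mk_smul, Submodule.Quotient.mk_eq_zero]
    exact (hw r).1 (hle (by simpa using hr))
  exact hprime.ne_top ((Ideal.eq_top_iff_one _).2 ((hw 1).2 (by simpa using hw0)))

omit [IsLocalRing R] [IsNoetherianRing R] in
theorem ringKrullDim_quotient_add_one_le {p p' : Ideal R} (hp : p.IsPrime) (hle : p ≤ p') {y : R}
    (hy : y ∈ p') (hy' : y ∉ p) : ringKrullDim (R ⧸ p') + 1 ≤ ringKrullDim (R ⧸ p) :=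
  ringKrullDim_succ_le_of_surjective (Ideal.Quotient.factor hle)
    (Ideal.Quotient.factor_surjective hle) (r := Ideal.Quotient.mk p y)
    (mem_nonZeroDivisors_of_ne_zero (by rwa [Ne, Ideal.Quotient.eq_zero_iff_mem]))
    (by rw [Ideal.Quotient.factor_mk, Ideal.Quotient.eq_zero_iff_mem.2 hy])

theorem exists_associatedPrime_gt {I p : Ideal R} (hp : p ∈ associatedPrimes R (R ⧸ I)) {y : R}
    (hy : y ∈ maximalIdeal R) (hreg : ∀ u, y * u ∈ I → u ∈ I) :
    ∃ p' ∈ associatedPrimes R (R ⧸ (I ⊔ Ideal.span {y})), p ≤ p' ∧ y ∈ p' ∧ y ∉ p := by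
  obtain ⟨hprime, w, hw⟩ := mem_associatedPrimes_quotient.1 hp
  have hwI : w ∉ I := fun h =>
    hprime.ne_top ((Ideal.eq_top_iff_one _).2 ((hw 1).2 (by simpa using h)))
  let N : Ideal R := modColon R I p
  have hN : ¬ N ≤ I ⊔ Ideal.span {y} := by
    intro hle
    refine hwI (Submodule.le_of_le_smul_of_le_jacobson_bot (I := Ideal.span {y}) (N := I) (N' := N)
      (IsNoetherian.noetherian _) ?_ ?_ fun r hr => ?_)
    · rw [IsLocalRing.jacobson_eq_maximalIdeal _ bot_ne_top]
      exact (Ideal.span_singleton_le_iff_mem _).2 hy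
    · intro u hu
      obtain ⟨a, ha, b, hb, rfl⟩ := Submodule.mem_sup.1 (hle hu)
      obtain ⟨c, rfl⟩ := Ideal.mem_span_singleton'.1 hb
      refine Submodule.add_mem_sup ha ?_
      rw [mul_comm c y, smul_eq_mul]
      refine Ideal.mul_mem_mul (Ideal.mem_span_singleton_self y) fun r hr => hreg _ ?_
      have h1 : y * (r • c) = r • (a + c * y) - r * a := by simp only [smul_eq_mul]; ring
      rw [h1]
      exact I.sub_mem (hu r hr) (I.mul_mem_left _ ha)
    · exact (hw r).1 hr
  obtain ⟨u, huN, hu⟩ := Set.not_subset.1 hN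
  obtain ⟨p', hp', h⟩ := exists_mem_associatedPrimes_quotient hu
  refine ⟨p', hp', fun a ha => h a (le_sup_left (a := I) (huN a ha)), h y ?_, fun hyp => hwI ?_⟩
  · exact le_sup_right (a := I) (Ideal.mul_mem_right _ _ (Ideal.mem_span_singleton_self y))
  · exact hreg _ ((hw y).1 hyp)

theorem le_ringKrullDim_of_subsingleton_lc (t : ℕ) : ∀ I : Ideal R,
    (∀ i < t, Subsingleton (lc (maximalIdeal R) i (ModuleCat.of R (R ⧸ I)))) →
      ∀ p ∈ associatedPrimes R (R ⧸ I), (t : WithBot ℕ∞) ≤ ringKrullDim (R ⧸ p) := by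
  induction t with
  | zero =>
    intro I _ p hp
    have := (mem_associatedPrimes_quotient.1 hp).1
    exact ringKrullDim_nonneg_of_nontrivial
  | succ t ih =>
    intro I h p hp
    obtain ⟨y, hy, hreg⟩ := exists_regular_of_subsingleton_lc_zero (h 0 (Nat.succ_pos t))
    obtain ⟨π, hπ⟩ := exists_isRegQuot rfl hreg
    obtain ⟨p', hp', hle, h1, h2⟩ := exists_associatedPrime_gt hp hy hreg
    have h3 := ih _ (fun i hi => hπ.subsingleton_quot (h i (by omega)) (h (i + 1) (by omega))) p' hp'
    refine le_trans ?_ (ringKrullDim_quotient_add_one_le (mem_associatedPrimes_quotient.1 hp).1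
      hle h1 h2)
    push_cast
    gcongr

end Depth

section RegularSequence

variable {R : Type u} [CommRing R] [IsLocalRing R] [IsNoetherianRing R]

omit [IsLocalRing R] [IsNoetherianRing R] in
theorem sup_headIdeal_succ (I : Ideal R) (y : ℕ → R) (s : ℕ) :
    I ⊔ headIdeal y (s + 1) = (I ⊔ headIdeal y s) ⊔ Ideal.span {y s} := by
  rw [headIdeal_succ, sup_assoc]

/-- A system of parameters of `R/I` is regular when `R/I` is Cohen-Macaulay. -/
theorem regular_of_subsingleton_lc {I : Ideal R} {e : ℕ} {y : ℕ → R}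
    (h : ∀ i < e, Subsingleton (lc (maximalIdeal R) i (ModuleCat.of R (R ⧸ I))))
    (hy : ∀ i < e, y i ∈ maximalIdeal R)
    (hrad : maximalIdeal R ≤ (I ⊔ headIdeal y e).radical) (s : ℕ) (hs : s ≤ e) :
    (∀ i, i + s < e →
      Subsingleton (lc (maximalIdeal R) i (ModuleCat.of R (R ⧸ (I ⊔ headIdeal y s))))) ∧
    (s < e → ∀ u, y s * u ∈ I ⊔ headIdeal y s → u ∈ I ⊔ headIdeal y s) := by
  have reg : ∀ s, (∀ i, i + s < e →
      Subsingleton (lc (maximalIdeal R) i (ModuleCat.of R (R ⧸ (I ⊔ headIdeal y s))))) →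
      s < e → ∀ u, y s * u ∈ I ⊔ headIdeal y s → u ∈ I ⊔ headIdeal y s := by
    intro s hv hs u hu
    by_contra hcon
    obtain ⟨p, hp, hmem⟩ := exists_mem_associatedPrimes_quotient hcon
    obtain ⟨hprime, w, hw⟩ := mem_associatedPrimes_quotient.1 hp
    have h1 := le_ringKrullDim_of_subsingleton_lc (e - s) _ (fun i hi => hv i (by omega)) p hp
    have hle : I ⊔ headIdeal y (s + 1) ≤ p := by
      rw [sup_headIdeal_succ]
      refine sup_le (fun a ha => (hw a).2 (Ideal.mul_mem_right _ _ ha)) ?_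
      exact (Ideal.span_singleton_le_iff_mem _).2 (hmem _ hu)
    have h2 := ringKrullDim_quotient_le_of_le_radical (I := p) (e := e - (s + 1))
      (y := fun j => y (s + 1 + j)) (le_maximalIdeal hprime.ne_top)
      (fun j => hy _ (by omega)) (hrad.trans (Ideal.radical_mono (sup_le ?_ ?_)))
    · have := h1.trans h2
      have : e - s ≤ e - (s + 1) := by exact_mod_cast this
      omega
    · exact le_sup_of_le_right (le_sup_left.trans hle)
    · rw [headIdeal, Ideal.span_le]
      rintro _ ⟨i, hi, rfl⟩
      by_cases his : i < s + 1
      · exact le_sup_of_le_right (le_sup_right.trans hle) (mem_headIdeal y his)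
      · have hie : i < e := hi
        refine Ideal.mem_sup_left (Ideal.subset_span ⟨⟨i - (s + 1), by omega⟩, ?_⟩)
        exact congrArg y (by simp only; omega)
  suffices hv : ∀ i, i + s < e →
      Subsingleton (lc (maximalIdeal R) i (ModuleCat.of R (R ⧸ (I ⊔ headIdeal y s)))) from
    ⟨hv, reg s hv⟩
  induction s with
  | zero =>
    rw [headIdeal_zero, sup_bot_eq]
    exact h
  | succ s ih =>
    intro i hi
    obtain ⟨p, hp⟩ := exists_isRegQuot (sup_headIdeal_succ I y s)
      (reg s (ih (by omega)) (by omega))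
    exact hp.subsingleton_quot (ih (by omega) i (by omega)) (ih (by omega) (i + 1) (by omega))

omit [IsNoetherianRing R] in
theorem lc_of_regular {d : ℕ} {x : ℕ → R} (hx : ∀ i < d, x i ∈ maximalIdeal R)
    (hreg : ∀ s < d, ∀ u, x s * u ∈ headIdeal x s → u ∈ headIdeal x s) (k : ℕ) : ∀ s, s + k = d →
    (∀ i < k, Subsingleton (lc (maximalIdeal R) i (ModuleCat.of R (R ⧸ headIdeal x s)))) ∧
    socLength (maximalIdeal R) (lc (maximalIdeal R) k (ModuleCat.of R (R ⧸ headIdeal x s))) =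
      socLength (maximalIdeal R) (lc (maximalIdeal R) 0 (ModuleCat.of R (R ⧸ headIdeal x d))) := by
  induction k with
  | zero =>
    rintro s rfl
    exact ⟨fun i hi => absurd hi (Nat.not_lt_zero i), rfl⟩
  | succ k ih =>
    intro s hs
    obtain ⟨h1, h2⟩ := ih (s + 1) (by omega)
    obtain ⟨p, hp⟩ := exists_isRegQuot (headIdeal_succ x s) (hreg s (by omega))
    have hv : ∀ i < k + 1,
        Subsingleton (lc (maximalIdeal R) i (ModuleCat.of R (R ⧸ headIdeal x s))) := by
      intro i hi
      cases i with
      | zero => exact hp.subsingleton_zero (hx s (by omega))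
      | succ i => exact hp.subsingleton_succ (hx s (by omega)) (h1 i (by omega))
    refine ⟨hv, ?_⟩
    rw [← h2]
    exact (hp.socLength_eq (hx s (by omega)) (hv k (by omega))).symm

omit [IsNoetherianRing R] in
theorem socLength_quotient (I : Ideal R) : socLength (maximalIdeal R) (R ⧸ I) = irMod R R I := by
  rw [irMod_eq, ← moduleLength_eq]
  refine moduleLength_congr (LinearEquiv.ofEq _ _ ?_)
  ext v
  obtain ⟨a, rfl⟩ := Submodule.Quotient.mk_surjective _ v
  rw [Submodule.mem_torsionBySet_iff]
  have h1 : (∀ r : (maximalIdeal R : Set R), (r : R) • (Submodule.Quotient.mk a : R ⧸ I) = 0) ↔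
      a ∈ colonIdeal R I := by
    rw [mem_colonIdeal]
    constructor
    · intro h r hr
      have := h ⟨r, hr⟩
      rwa [← Submodule.Quotient.mk_smul, Submodule.Quotient.mk_eq_zero] at this
    · intro h r
      rw [← Submodule.Quotient.mk_smul, Submodule.Quotient.mk_eq_zero]
      exact h r r.2
  rw [h1]
  constructor
  · exact fun h => ⟨a, h, rfl⟩
  · rintro ⟨b, hb, hba⟩
    have h2 : b - a ∈ I := (Submodule.Quotient.eq _).1 hba
    have := (colonIdeal R I).sub_mem hb (le_colonIdeal I h2)
    rwa [sub_sub_cancel] at this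

omit [IsNoetherianRing R] in
theorem rLength_eq_irMod {d : ℕ} {x : ℕ → R} (hx : ∀ i < d, x i ∈ maximalIdeal R)
    (hreg : ∀ s < d, ∀ u, x s * u ∈ headIdeal x s → u ∈ headIdeal x s) {k : ℕ}
    (hk : maximalIdeal R ^ k ≤ headIdeal x d) :
    (∀ i < d, Subsingleton (Hmod R R i)) ∧ rLength R d = irMod R R (headIdeal x d) := by
  obtain ⟨h1, h2⟩ := lc_of_regular hx hreg d 0 (zero_add d)
  rw [headIdeal_zero] at h1 h2
  let e : (R ⧸ (⊥ : Ideal R)) ≃ₗ[R] R := Submodule.quotEquivOfEqBot ⊥ rfl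
  refine ⟨fun i hi => ?_, ?_⟩
  · have := h1 i hi
    exact (lcCongr (maximalIdeal R) i e).symm.injective.subsingleton
  · rw [← socLength_quotient, ← socLength_lc_zero (J := maximalIdeal R) (M := R ⧸ headIdeal x d) k
      (fun r hr m => ?_), ← h2]
    · exact (socLength_eq (lcCongr (maximalIdeal R) d e).toLinearMap (LinearEquiv.injective _)
        fun w _ => (lcCongr (maximalIdeal R) d e).surjective w).symm
    · obtain ⟨u, rfl⟩ := Submodule.Quotient.mk_surjective _ m
      rw [← Submodule.Quotient.mk_smul, Submodule.Quotient.mk_eq_zero]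
      exact Ideal.mul_mem_right _ _ (hk hr)

end RegularSequence

theorem eval_mem_mul {R : Type u} [CommRing R] {d : ℕ} {x : Fin d → R} {q A : Ideal R}
    (hx : ∀ i, x i ∈ q) {F : MvPolynomial (Fin d) R} {n : ℕ} (hF : F.IsHomogeneous n)
    (hA : ∀ α, coeff α F ∈ A) : eval x F ∈ A * q ^ n := by
  rw [eval_eq']
  refine Ideal.sum_mem _ fun α hα => Ideal.mul_mem_mul (hA α) ?_
  have := prod_pow_mem_pow hx α
  rwa [Decidable.of_not_not (mt hF.coeff_eq_zero (mem_support_iff.1 hα))] at this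

theorem colonIdeal_eq_of_socleLeOne {R : Type u} [CommRing R] [IsLocalRing R] {q : Ideal R}
    (h : SocleLeOne (maximalIdeal R) q) {w : R} (hw : ∀ t ∈ maximalIdeal R, t * w ∈ q)
    (hwq : w ∉ q) : colonIdeal R q = q ⊔ Ideal.span {w} := by
  refine le_antisymm (fun v hv => ?_) (sup_le (le_colonIdeal q)
    ((Ideal.span_singleton_le_iff_mem _).2 hw))
  obtain ⟨c, c', h1, h2⟩ := h w v hw hv
  have hc' : IsUnit c' := by
    by_contra hc'
    have hc : IsUnit c := by
      by_contra hc
      exact h2 ⟨hc, hc'⟩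
    refine hwq ((Ideal.unit_mul_mem_iff_mem _ hc).1 ?_)
    exact (Ideal.add_mem_iff_left _ (hv c' hc')).1 h1
  refine (Ideal.unit_mul_mem_iff_mem _ hc').1 ?_
  rw [show c' * v = (c * w + c' * v) + (-c) * w by ring]
  exact add_mem (Ideal.mem_sup_left h1)
    (Ideal.mul_mem_left _ _ (Ideal.mem_sup_right (Ideal.mem_span_singleton_self w)))

theorem exists_colonIdeal_eq_of_irMod_eq_one {R : Type u} [CommRing R] [IsLocalRing R]
    {q : Ideal R} (h : irMod R R q = 1) : ∃ w, (∀ t ∈ maximalIdeal R, t * w ∈ q) ∧ w ∉ q ∧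
      colonIdeal R q = q ⊔ Ideal.span {w} := by
  rw [irMod_eq] at h
  have h1 : Module.length R (Submodule.map q.mkQ (colonIdeal R q)) = 1 := by exact_mod_cast h
  rw [Module.length_eq_one_iff] at h1
  have hne : ¬ colonIdeal R q ≤ q := fun hle => by
    have := IsSimpleModule.nontrivial R (Submodule.map q.mkQ (colonIdeal R q))
    obtain ⟨a, ha⟩ := exists_ne (0 : Submodule.map q.mkQ (colonIdeal R q))
    obtain ⟨_, b, hb, rfl⟩ := a
    refine ha (Subtype.ext ?_)
    exact (Submodule.Quotient.mk_eq_zero _).2 (hle hb)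
  obtain ⟨w, hw, hwq⟩ := SetLike.not_le_iff_exists.1 hne
  refine ⟨w, hw, hwq, le_antisymm (fun v hv => ?_) (sup_le (le_colonIdeal q)
    ((Ideal.span_singleton_le_iff_mem _).2 hw))⟩
  let a : Submodule.map q.mkQ (colonIdeal R q) := ⟨q.mkQ w, w, hw, rfl⟩
  let b : Submodule.map q.mkQ (colonIdeal R q) := ⟨q.mkQ v, v, hv, rfl⟩
  have ha : a ≠ 0 := fun h0 => hwq ((Submodule.Quotient.mk_eq_zero _).1 (congrArg Subtype.val h0))
  obtain ⟨r, hr⟩ := IsSimpleModule.toSpanSingleton_surjective R ha b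
  have hr' : (Submodule.Quotient.mk (r * w) : R ⧸ q) = Submodule.Quotient.mk v :=
    congrArg Subtype.val hr
  rw [Submodule.Quotient.eq] at hr'
  rw [show v = -(r * w - v) + r * w by ring]
  exact add_mem (Ideal.mem_sup_left (neg_mem hr'))
    (Ideal.mul_mem_left _ _ (Ideal.mem_sup_right (Ideal.mem_span_singleton_self w)))

namespace IsCSeq

variable {R : Type u} [CommRing R] {x : ℕ → R} {d : ℕ} {b : ℕ → Ideal R}
  (hx : IsCSeq x d b) (hd : 0 < d)
  (hreg : ∀ u, x (d - 1) * u ∈ headIdeal x (d - 1) → u ∈ headIdeal x (d - 1))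

section Regular

include hx hreg

omit hx in
theorem headIdeal_sup_divIdeal :
    headIdeal x d ⊔ divIdeal (headIdeal x (d - 1)) (x (d - 1)) = headIdeal x d :=
  sup_eq_left.2 fun u hu => headIdeal_mono x (Nat.sub_le d 1) (hreg u hu)

theorem coeff_mem_headIdeal {n : ℕ} {F : MvPolynomial (Fin d) R} (hF : F.IsHomogeneous n)
    (h : eval (fun i : Fin d => x i) F ∈ headIdeal x d ^ (n + 1)) (α : Fin d →₀ ℕ) :
    coeff α F ∈ headIdeal x d := by
  refine hx.coeff_mem_of_sum_mem (A := headIdeal x d) (u := fun _ : Fin 1 => (1 : R)) (n := n)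
    (F := fun _ => F) (fun _ t ht => by simpa using ht) (fun c hc j => ?_) (fun _ => hF)
    (by simpa using h) 0 α
  rw [headIdeal_sup_divIdeal hreg] at hc
  rw [Subsingleton.elim j 0]
  simpa using hc

include hd

theorem length_pow_quotient (n : ℕ) :
    Module.length R (Submodule.map (headIdeal x d ^ (n + 1)).mkQ (headIdeal x d ^ n)) =
      (((n + d - 1).choose (d - 1) : ℕ) : ℕ∞) * Module.length R (R ⧸ headIdeal x d) := by
  have := length_map_pow_mul_span (u := fun _ : Fin 1 => (1 : R)) (A := headIdeal x d) hd
    (headIdeal_eq_span_range x d) (fun _ t ht => by simpa using ht) (n := n)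
    (fun F hF h j α => by
      rw [Subsingleton.elim j 0]
      exact hx.coeff_mem_headIdeal hreg (hF 0) (by simpa using h) α)
  rw [Set.range_const, Ideal.span_singleton_one, Ideal.mul_top] at this
  simpa using this

theorem length_quotient_pow (n : ℕ) :
    Module.length R (R ⧸ headIdeal x d ^ (n + 1)) =
      (((n + d).choose d : ℕ) : ℕ∞) * Module.length R (R ⧸ headIdeal x d) := by
  induction n with
  | zero => rw [zero_add, pow_one, zero_add, Nat.choose_self, Nat.cast_one, one_mul]
  | succ n ih =>
    rw [length_quotient_eq_add (Ideal.pow_le_pow_right (Nat.le_succ (n + 1))), ih,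
      hx.length_pow_quotient hd hreg, ← add_mul]
    congr 1
    obtain ⟨e, rfl⟩ : ∃ e, d = e + 1 := ⟨d - 1, by omega⟩
    have h1 := Nat.choose_succ_succ (n + 1 + e) e
    rw [show (n + 1 + (e + 1) - 1) = n + 1 + e by omega, show e + 1 - 1 = e from rfl,
      show n + 1 + (e + 1) = n + 1 + e + 1 by omega, show n + (e + 1) = n + 1 + e by omega]
    exact_mod_cast h1.symm

variable [IsLocalRing R] (hqm : headIdeal x d ≤ maximalIdeal R)

include hqm

theorem colonIdeal_pow_le_pow {n : ℕ} {a : R} (ha : a ∈ colonIdeal R (headIdeal x d ^ (n + 1)))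
    (k : ℕ) (hk : k ≤ n) : a ∈ headIdeal x d ^ k := by
  have hxq : ∀ i : Fin d, x i ∈ headIdeal x d := fun i => mem_headIdeal x i.2
  induction k with
  | zero => simp
  | succ k ih =>
    have h0 := ih (by omega)
    rw [headIdeal_eq_span_range] at h0
    obtain ⟨F, hF, rfl⟩ := exists_eval_eq h0
    have h1 := hx.coeff_mem_headIdeal hreg (n := k + 1) (F := X ⟨0, hd⟩ * F)
      (by rw [add_comm k 1]; exact (isHomogeneous_X R _).mul hF) (by
        rw [eval_mul, eval_X]
        exact Ideal.pow_le_pow_right (by omega) (ha _ (hqm (hxq ⟨0, hd⟩))))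
    rw [pow_succ']
    refine eval_mem_mul hxq hF fun α => ?_
    have := h1 (Finsupp.single ⟨0, hd⟩ 1 + α)
    rwa [coeff_X_mul] at this

theorem colonIdeal_pow (n : ℕ) : colonIdeal R (headIdeal x d ^ (n + 1)) =
    colonIdeal R (headIdeal x d) * headIdeal x d ^ n := by
  have hxq : ∀ i : Fin d, x i ∈ headIdeal x d := fun i => mem_headIdeal x i.2
  refine le_antisymm (fun a ha => ?_) (Ideal.mul_le.2 fun a ha c hc r hr => ?_)
  · have h0 := hx.colonIdeal_pow_le_pow hd hreg hqm ha n le_rfl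
    rw [headIdeal_eq_span_range] at h0
    obtain ⟨F, hF, rfl⟩ := exists_eval_eq h0
    refine eval_mem_mul hxq hF fun α r hr => ?_
    have h1 := hx.coeff_mem_headIdeal hreg (n := n) (F := C r * F)
      (by rw [← zero_add n]; exact (isHomogeneous_C _ r).mul hF) (by
        rw [eval_mul, eval_C]
        exact ha r hr) α
    rwa [coeff_C_mul] at h1
  · rw [pow_succ', smul_eq_mul, ← mul_assoc]
    exact Ideal.mul_mem_mul (ha r hr) hc

variable {w : R} (hw : ∀ t ∈ maximalIdeal R, t * w ∈ headIdeal x d) (hwq : w ∉ headIdeal x d)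

include hw hwq

omit hqm in
theorem length_map_pow_mul_socle (n : ℕ) :
    Module.length R (Submodule.map (headIdeal x d ^ (n + 1)).mkQ
      (headIdeal x d ^ n * Ideal.span {w})) = (((n + d - 1).choose (d - 1) : ℕ) : ℕ∞) := by
  have := length_map_pow_mul_span (u := fun _ : Fin 1 => w) (A := maximalIdeal R) hd
    (headIdeal_eq_span_range x d) (fun _ => hw) (n := n)
    (fun F hF h => hx.coeff_mem_of_sum_mem (fun _ => hw) (fun c hc j => by
      rw [headIdeal_sup_divIdeal hreg] at hc
      rw [Subsingleton.elim j 0]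
      by_contra hc0
      refine hwq ((Ideal.unit_mul_mem_iff_mem _ (not_not.1 hc0)).1 ?_)
      simpa using hc) hF h)
  rw [Set.range_const] at this
  simpa [length_residue] using this

variable (hcol : colonIdeal R (headIdeal x d) = headIdeal x d ⊔ Ideal.span {w})

include hcol

theorem length_colonIdeal_pow (n : ℕ) :
    Module.length R (Submodule.map (headIdeal x d ^ (n + 1)).mkQ
      (colonIdeal R (headIdeal x d ^ (n + 1)))) = (((n + d - 1).choose (d - 1) : ℕ) : ℕ∞) := by
  rw [hx.colonIdeal_pow hd hreg hqm, hcol, Ideal.sup_mul, Submodule.map_sup, ← pow_succ']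
  have : Submodule.map (headIdeal x d ^ (n + 1)).mkQ (headIdeal x d ^ (n + 1)) = ⊥ := by
    exact Submodule.mkQ_map_self _
  rw [this, bot_sup_eq, mul_comm (Ideal.span {w})]
  exact hx.length_map_pow_mul_socle hd hreg hw hwq n

theorem irMod_eq_one : irMod R R (headIdeal x d) = 1 := by
  have h := hx.length_colonIdeal_pow hd hreg hqm hw hwq hcol 0
  rw [zero_add, pow_one] at h
  rw [irMod_eq, h]
  simp

theorem isIrrCoeff_single : IsIrrCoeff R (headIdeal x d) d (fun i => if i = 0 then 1 else 0) := by
  refine isIrrCoeff_iff.2 ⟨0, fun n _ => ⟨_, hx.length_colonIdeal_pow hd hreg hqm hw hwq hcol n, ?_⟩⟩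
  rw [Finset.sum_eq_single_of_mem 0 (Finset.mem_range.2 hd) fun i _ hi => by simp [hi]]
  simp

end Regular

end IsCSeq

namespace IsCSeq

variable {R : Type u} [CommRing R] {x : ℕ → R} {d : ℕ} {b : ℕ → Ideal R}
  (hx : IsCSeq x d b) (hd : 0 < d)
  (hreg : ∀ u, x (d - 1) * u ∈ headIdeal x (d - 1) → u ∈ headIdeal x (d - 1))
  [IsLocalRing R] [IsNoetherianRing R]
  (hsq : headIdeal x d ≤ maximalIdeal R ^ 2) (hprin : ∀ t, maximalIdeal R ≠ Ideal.span {t})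
  {w : R} (hw : ∀ t ∈ maximalIdeal R, t * w ∈ headIdeal x d)

include hx hreg hsq hprin hw

theorem mul_socle_mem {t : R} (ht : t ∈ maximalIdeal R) :
    t * w ∈ maximalIdeal R * headIdeal x d := by
  have hlin : ∀ r ∈ headIdeal x d, ∃ c : Fin d → R, ∑ i, c i * x i = r := fun r hr => by
    rw [headIdeal_eq_span_range] at hr
    exact Ideal.mem_span_range_iff_exists_fun.1 hr
  obtain ⟨c, hc⟩ := hlin (t * w) (hw t ht)
  rw [← hc]
  refine Ideal.sum_mem _ fun j _ => Ideal.mul_mem_mul ?_ (mem_headIdeal x j.2)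
  by_contra hcj
  have hunit : IsUnit (c j) := not_not.1 hcj
  refine hprin t (le_antisymm ?_ ((Ideal.span_singleton_le_iff_mem _).2 ht))
  refine Submodule.le_of_le_smul_of_le_jacobson_bot (IsNoetherian.noetherian _)
    (IsLocalRing.maximalIdeal_le_jacobson ⊥) (fun r hr => ?_)
  obtain ⟨c', hc'⟩ := hlin (r * w) (hw r hr)
  have h1 := hx.coeff_mem_headIdeal hreg (n := 1)
    (linForm_isHomogeneous fun i => t * c' i - r * c i) (by
      rw [eval_linForm]
      have : ∑ i, (t * c' i - r * c i) * x i = t * ∑ i, c' i * x i - r * ∑ i, c i * x i := by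
        rw [Finset.mul_sum, Finset.mul_sum, ← Finset.sum_sub_distrib]
        exact Finset.sum_congr rfl fun i _ => by ring
      rw [this, hc, hc']
      convert Submodule.zero_mem _ using 1
      ring) (Finsupp.single j 1)
  rw [coeff_linForm] at h1
  refine (Ideal.unit_mul_mem_iff_mem _ hunit).1 ?_
  rw [show c j * r = c' j * t - (t * c' j - r * c j) by ring, smul_eq_mul, ← pow_two]
  exact sub_mem (Ideal.mem_sup_left (Ideal.mul_mem_left _ _ (Ideal.mem_span_singleton_self t)))
    (Ideal.mem_sup_right (hsq h1))

variable (hcol : colonIdeal R (headIdeal x d) = headIdeal x d ⊔ Ideal.span {w})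

include hd hcol

theorem colonIdeal_sq_le : colonIdeal R (headIdeal x d) * colonIdeal R (headIdeal x d) ≤
    colonIdeal R (headIdeal x d) * headIdeal x d := by
  have hqm : headIdeal x d ≤ maximalIdeal R := hsq.trans (Ideal.pow_le_self two_ne_zero)
  have h1 : w * w ∈ colonIdeal R (headIdeal x d) * headIdeal x d := by
    have h := hx.colonIdeal_pow hd hreg hqm 1
    rw [pow_one] at h
    rw [← h]
    intro r hr
    rw [pow_succ, pow_one, smul_eq_mul, ← mul_assoc]
    refine Submodule.mul_induction_on (hx.mul_socle_mem hreg hsq hprin hw hr)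
      (fun a ha c hc => ?_) fun a c ha hc => ?_
    · rw [mul_right_comm]
      exact Ideal.mul_mem_mul (hw a ha) hc
    · rw [add_mul]
      exact add_mem ha hc
  have h2 : w ∈ colonIdeal R (headIdeal x d) := hw
  nth_rw 2 [hcol]
  rw [Ideal.mul_sup]
  refine sup_le le_rfl ?_
  nth_rw 1 [hcol]
  rw [Ideal.sup_mul, Ideal.span_singleton_mul_span_singleton]
  refine sup_le ?_ ((Ideal.span_singleton_le_iff_mem _).2 h1)
  rw [mul_comm]
  exact Ideal.mul_mono_left ((Ideal.span_singleton_le_iff_mem _).2 h2)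

theorem colonIdeal_headIdeal_pow (n : ℕ) : colonIdeal R (headIdeal x d) ^ (n + 1) =
    colonIdeal R (headIdeal x d) * headIdeal x d ^ n := by
  induction n with
  | zero => simp
  | succ n ih =>
    rw [pow_succ, ih, mul_right_comm, pow_succ', ← mul_assoc]
    congr 1
    exact le_antisymm (hx.colonIdeal_sq_le hd hreg hsq hprin hw hcol)
      (Ideal.mul_mono_right (le_colonIdeal _))

theorem exists_hilbCoeff (hwq : w ∉ headIdeal x d) {k : ℕ}
    (hk : maximalIdeal R ^ k ≤ headIdeal x d) : ∃ e e' : ℕ → ℤ,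
    IsHilbCoeff R (colonIdeal R (headIdeal x d)) d e ∧ IsHilbCoeff R (headIdeal x d) d e' ∧
      e 1 - e' 1 = 1 := by
  have hqm : headIdeal x d ≤ maximalIdeal R := hsq.trans (Ideal.pow_le_self two_ne_zero)
  obtain ⟨L₀, hL₀⟩ := ENat.ne_top_iff_exists.1
    (Module.length_ne_top_iff.2 (isFiniteLength_quotient_iff.2 ⟨k, hk⟩))
  have hlen (n : ℕ) := hx.length_quotient_pow hd hreg n
  have hlen' (n : ℕ) : (((n + d).choose d : ℕ) : ℕ∞) * L₀ =
      (((n + d - 1).choose (d - 1) : ℕ) : ℕ∞) +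
        Module.length R (R ⧸ colonIdeal R (headIdeal x d) ^ (n + 1)) := by
    rw [hL₀, ← hlen, ← hx.length_colonIdeal_pow hd hreg hqm hw hwq hcol n,
      hx.colonIdeal_headIdeal_pow hd hreg hsq hprin hw hcol, ← hx.colonIdeal_pow hd hreg hqm]
    exact length_quotient_eq_add (le_colonIdeal _)
  refine ⟨fun i => if i = 0 then L₀ else if i = 1 then 1 else 0, fun i => if i = 0 then L₀ else 0,
    isHilbCoeff_iff.2 ⟨0, fun n _ => ?_⟩,
    isHilbCoeff_iff.2 ⟨0, fun n _ => ⟨(n + d).choose d * L₀, ?_, ?_⟩⟩, by simp⟩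
  · have h1 := hlen' n
    have hfin : Module.length R (R ⧸ colonIdeal R (headIdeal x d) ^ (n + 1)) ≠ ⊤ := fun h => by
      rw [h, add_top] at h1
      exact ENat.natCast_ne_top ((n + d).choose d * L₀) (by exact_mod_cast h1)
    obtain ⟨L, hL⟩ := ENat.ne_top_iff_exists.1 hfin
    refine ⟨L, hL.symm, ?_⟩
    rw [← hL] at h1
    have h2 : (n + d).choose d * L₀ = (n + d - 1).choose (d - 1) + L := by exact_mod_cast h1
    obtain ⟨e, rfl⟩ : ∃ e, d = e + 1 := ⟨d - 1, by omega⟩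
    rw [Finset.sum_range_succ', Finset.sum_range_succ',
      Finset.sum_eq_zero fun i _ => by simp]
    have h3 : (((n + (e + 1)).choose (e + 1) * L₀ : ℕ) : ℤ) =
      (((n + (e + 1) - 1).choose (e + 1 - 1) + L : ℕ) : ℤ) := congrArg _ h2
    rw [show n + (e + 1) - 1 = n + e by omega] at h3
    push_cast at h3
    simp
    linarith
  · rw [hlen, ← hL₀]
    push_cast
    rfl
  · rw [Finset.sum_eq_single_of_mem 0 (Finset.mem_range.2 (by omega)) fun i _ hi => by simp [hi]]
    simp
    ring

end IsCSeq

section CohenMacaulay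

variable {R : Type u} [CommRing R]

theorem span_image_eq_headIdeal {e : ℕ} (y : Fin e → R) (i : Fin e) :
    Ideal.span (y '' {j | j < i}) = headIdeal (extendZero y) i := by
  rw [headIdeal]
  congr 1
  ext a
  constructor
  · rintro ⟨j, hj, rfl⟩
    exact ⟨j, hj, extendZero_of_lt y j.2⟩
  · rintro ⟨j, hj, rfl⟩
    exact ⟨⟨j, lt_trans hj i.2⟩, hj, (extendZero_of_lt y _).symm⟩

theorem headIdeal_reverse (x : ℕ → R) {d e : ℕ} (h : e ≤ d) :
    headIdeal (fun k => x (d - 1 - k)) (d - e) = tailIdeal x d e := by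
  rw [headIdeal, tailIdeal]
  congr 1
  ext a
  constructor
  · rintro ⟨j, hj, rfl⟩
    rw [Set.mem_ofPred_eq] at hj
    exact ⟨d - 1 - j, ⟨by omega, by omega⟩, rfl⟩
  · rintro ⟨j, ⟨h1, h2⟩, rfl⟩
    refine ⟨d - 1 - j, ?_, ?_⟩
    · rw [Set.mem_ofPred_eq]
      omega
    · exact congrArg x (by omega)

variable [IsLocalRing R] [IsNoetherianRing R]

theorem le_radical_of_isSOP_quotient {I : Ideal R} {e : ℕ} {y : Fin e → R}
    (hy : IsSOP R (R ⧸ (I • (⊤ : Submodule R R))) y) :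
    maximalIdeal R ≤ (I ⊔ headIdeal (extendZero y) e).radical := by
  rw [headIdeal_extendZero, sup_comm]
  refine exists_pow_le_iff_le_radical.1 (isFiniteLength_quotient_iff.1 ?_)
  set J := Ideal.span (Set.range y)
  have h1 : (I • (⊤ : Submodule R R)) ≤ LinearMap.ker (J ⊔ I).mkQ := by
    rw [Submodule.ker_mkQ, smul_eq_mul, Ideal.mul_top]
    exact le_sup_right
  refine hy.2.2.of_surjective
    (f := Submodule.liftQ _ (Submodule.liftQ (I • (⊤ : Submodule R R)) (J ⊔ I).mkQ h1) ?_) ?_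
  · intro z hz
    obtain ⟨a, rfl⟩ := Submodule.mkQ_surjective _ z
    rw [mkQ_mem_smul_top_self] at hz
    exact (Submodule.Quotient.mk_eq_zero _).2 hz
  · intro z
    obtain ⟨a, rfl⟩ := Submodule.mkQ_surjective _ z
    exact ⟨Submodule.mkQ _ (Submodule.mkQ _ a), rfl⟩

theorem bIdeal_eq_top {I : Ideal R} {e : ℕ} (hdim : ringKrullDim (R ⧸ I) = e)
    (h : ∀ i < e, Subsingleton (lc (maximalIdeal R) i (ModuleCat.of R (R ⧸ I)))) :
    bIdeal R (R ⧸ (I • (⊤ : Submodule R R))) = ⊤ := by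
  rw [bIdeal]
  simp only [iInf_eq_top]
  intro s y hy i
  obtain rfl : s = e := by
    have := hy.1
    rw [moduleDim_quotient, hdim] at this
    exact_mod_cast this.symm
  have hreg := (regular_of_subsingleton_lc (y := extendZero y) h
    (fun j hj => by rw [extendZero_of_lt y hj]; exact hy.2.1 ⟨j, hj⟩)
    (le_radical_of_isSOP_quotient hy) i i.2.le).2 i.2
  rw [eq_top_iff]
  intro c _
  rw [Submodule.mem_annihilator]
  intro v hv
  obtain ⟨v, rfl⟩ := Submodule.mkQ_surjective _ v
  obtain ⟨u, rfl⟩ := Submodule.mkQ_surjective _ v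
  have hv' : y i * u ∈ Ideal.span (y '' {j | j < i}) ⊔ I := by
    rw [← mkQ_mem_smul_top_self, ← Submodule.Quotient.mk_eq_zero]
    exact hv
  rw [span_image_eq_headIdeal, sup_comm] at hv'
  have hu := hreg u (by rwa [extendZero_of_lt y i.2])
  rw [sup_comm, ← span_image_eq_headIdeal, ← mkQ_mem_smul_top_self,
    ← Submodule.Quotient.mk_eq_zero] at hu
  exact (congrArg (c • ·) hu).trans (smul_zero c)

variable {d : ℕ} {x : Fin d → R} (hx : IsSOP R R x) (hcm : ∀ i < d, Subsingleton (Hmod R R i))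
include hx hcm

omit hx [IsNoetherianRing R] in
theorem subsingleton_lc_quotient_bot : ∀ i < d,
    Subsingleton (lc (maximalIdeal R) i (ModuleCat.of R (R ⧸ (⊥ : Ideal R)))) := by
  intro i hi
  have : Subsingleton (lc (maximalIdeal R) i (ModuleCat.of R R)) := hcm i hi
  let e : (R ⧸ (⊥ : Ideal R)) ≃ₗ[R] R := Submodule.quotEquivOfEqBot ⊥ rfl
  exact (lcCongr (maximalIdeal R) i e).injective.subsingleton

/-- A system of parameters of a Cohen-Macaulay local ring is a regular sequence. -/
theorem regular_of_isSOP (s : ℕ) (hs : s < d) (u : R)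
    (hu : extendZero x s * u ∈ headIdeal (extendZero x) s) : u ∈ headIdeal (extendZero x) s := by
  obtain ⟨-, hxm, hrad⟩ := isSOP_self_iff.1 hx
  have := (regular_of_subsingleton_lc (y := extendZero x) (subsingleton_lc_quotient_bot hcm)
    (fun j hj => by rw [extendZero_of_lt x hj]; exact hxm ⟨j, hj⟩)
    (by rwa [bot_sup_eq, headIdeal_extendZero]) s hs.le).2 hs u
  rw [bot_sup_eq] at this
  exact this hu

/-- A system of parameters of a Cohen-Macaulay local ring is a C-system of parameters. -/
theorem isCSOP_of_isSOP : IsCSOP R R x := by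
  refine ⟨hx, fun i => ?_⟩
  obtain ⟨-, hxm, hrad⟩ := isSOP_self_iff.1 hx
  have htail := span_image_eq_tailIdeal x (i + 1)
  have hdim := (isSOP_quotient_of_perm (Nat.succ_le_of_lt i.2) hx (Equiv.refl _)
    (a := fun _ => 1) fun _ => one_pos).1
  rw [moduleDim_quotient] at hdim
  have hrev := headIdeal_reverse (extendZero x) (Nat.succ_le_of_lt i.2)
  have hlc := (regular_of_subsingleton_lc (y := fun k => extendZero x (d - 1 - k))
    (subsingleton_lc_quotient_bot hcm)
    (fun j hj => by
      rw [extendZero_of_lt x (show d - 1 - j < d by omega)]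
      exact hxm _)
    (by
      have h0 := headIdeal_reverse (extendZero x) (Nat.zero_le d)
      rw [Nat.sub_zero, ← span_image_eq_tailIdeal] at h0
      rw [bot_sup_eq, h0]
      simpa using hrad) (d - (i + 1)) (Nat.sub_le _ _)).1
  rw [bot_sup_eq, show d - (i + 1) = d - (i : ℕ).succ from rfl, hrev] at hlc
  have htop := bIdeal_eq_top (e := i + 1) hdim fun j hj => by
    rw [htail]
    exact hlc j (by omega)
  have hset : {j : Fin d | i < j} = {j : Fin d | (i : ℕ) + 1 ≤ j} := rfl
  rw [hset, htop, Ideal.top_pow]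
  exact Submodule.mem_top

end CohenMacaulay

section Gorenstein

variable {R : Type u} [CommRing R] [IsLocalRing R] [IsNoetherianRing R] {d : ℕ}

theorem exists_isSOP_mem_pow (hdim : ringKrullDim R = d) (N : ℕ) :
    ∃ x : Fin d → R, IsSOP R R x ∧ ∀ i, x i ∈ maximalIdeal R ^ N := by
  obtain ⟨s, hs, hcard⟩ :=
    Ideal.exists_finset_card_eq_height_of_isNoetherianRing (maximalIdeal R)
  have hcard' : s.card = d := by
    rw [← IsLocalRing.maximalIdeal_height_eq_ringKrullDim, ← hcard] at hdim
    exact_mod_cast hdim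
  let z : Fin d → R := fun i => (s.equivFinOfCardEq hcard').symm i
  have hz : Set.range z = s := by
    ext a
    constructor
    · rintro ⟨i, rfl⟩
      exact ((s.equivFinOfCardEq hcard').symm i).2
    · intro ha
      exact ⟨s.equivFinOfCardEq hcard' ⟨a, ha⟩, by simp [z]⟩
  have hzm (i : Fin d) : z i ∈ maximalIdeal R :=
    hs.1.2 (Ideal.subset_span (hz ▸ Set.mem_range_self i))
  refine ⟨fun i => z i ^ (N + 1), isSOP_self_iff.2 ⟨hdim, fun i =>
    Ideal.pow_mem_of_mem _ (hzm i) _ N.succ_pos, ?_⟩, fun i =>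
    Ideal.pow_le_pow_right N.le_succ (Ideal.pow_mem_pow (hzm i) _)⟩
  have h1 : maximalIdeal R ≤ (Ideal.span (s : Set R)).radical := by
    rw [Ideal.radical_eq_sInf]
    refine le_sInf fun p hp => ?_
    have := hp.2
    exact hs.2 ⟨hp.2, hp.1⟩ (IsLocalRing.le_maximalIdeal hp.2.ne_top)
  refine h1.trans ?_
  rw [← Ideal.radical_idem (Ideal.span (Set.range _)), ← hz]
  refine Ideal.radical_mono (Ideal.span_le.2 ?_)
  rintro _ ⟨i, rfl⟩
  exact ⟨N + 1, Ideal.subset_span ⟨i, rfl⟩⟩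

theorem headIdeal_le_maximalIdeal {x : Fin d → R} (hx : IsSOP R R x) :
    headIdeal (extendZero x) d ≤ maximalIdeal R := by
  rw [headIdeal_extendZero, Ideal.span_le]
  rintro _ ⟨i, rfl⟩
  exact (isSOP_self_iff.1 hx).2.1 i

theorem exists_maximalIdeal_pow_le {x : Fin d → R} (hx : IsSOP R R x) :
    ∃ k, maximalIdeal R ^ k ≤ headIdeal (extendZero x) d := by
  rw [headIdeal_extendZero]
  exact exists_pow_le_iff_le_radical.2 (isSOP_self_iff.1 hx).2.2

theorem exists_isCSOP_of_isCParamIdeal (hdim : ringKrullDim R = d) {q : Ideal R}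
    (hq : IsCParamIdeal R q) :
    ∃ x : Fin d → R, IsCSOP R R x ∧ q = headIdeal (extendZero x) d := by
  obtain ⟨s, x, hx, rfl⟩ := hq
  obtain rfl : s = d := by
    have := (isSOP_self_iff.1 hx.1).1
    rw [hdim] at this
    exact_mod_cast this.symm
  exact ⟨x, hx, (headIdeal_extendZero x).symm⟩

theorem isGorensteinLocal_of_isCSOP (hd : 2 ≤ d) (hum : IsUnmixedRing R) {x : Fin d → R}
    (hx : IsCSOP R R x)
    (h : ∀ u : Fin 2 → R, (∀ j, ∀ t ∈ maximalIdeal R, t * u j ∈ headIdeal (extendZero x) d) →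
      ¬ ∀ c : Fin 2 → R, ∑ j, c j * u j ∈ headIdeal (extendZero x) d ⊔
        divIdeal (headIdeal (extendZero x) (d - 1)) (extendZero x (d - 1)) →
          ∀ j, c j ∈ maximalIdeal R) : IsGorensteinLocal R := by
  have hseq := isCSeq_of_isCSOP hx
  have hqm := headIdeal_le_maximalIdeal hx.1
  obtain ⟨hdim, hxm, -⟩ := isSOP_self_iff.1 hx.1
  obtain ⟨k, hk⟩ := exists_maximalIdeal_pow_le hx.1
  by_cases hsoc : SocleLeOne (maximalIdeal R)
    (divIdeal (headIdeal (extendZero x) (d - 1)) (extendZero x (d - 1)) ⊔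
      Ideal.span {extendZero x (d - 1)})
  · obtain ⟨hreg, hsoc'⟩ := hseq.isRegular_of_socleLeOne hd hqm
      (fun w hw n => not_headIdeal_pow_le hd hx.1 hw n) hk hsoc (fun u hu => by
        obtain ⟨e, rfl⟩ : ∃ e, d = e + 1 := ⟨d - 1, by omega⟩
        refine eq_zero_of_isUnmixedRing hum hx.1 (Fin.last e) ?_
        rwa [extendZero_of_lt x (show e + 1 - 1 < e + 1 by omega)] at hu)
    obtain ⟨hcm, hlen⟩ := rLength_eq_irMod (fun i hi => by
      rw [extendZero_of_lt x hi]
      exact hxm _) hreg hk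
    obtain ⟨g, hg, hgm⟩ := exists_socle hk (v := (1 : R))
      fun h1 => (maximalIdeal.isMaximal R).ne_top ((Ideal.eq_top_iff_one _).2 (hqm h1))
    have hir := hseq.irMod_eq_one (by omega) (hreg (d - 1) (by omega)) hqm hgm hg
      (colonIdeal_eq_of_socleLeOne hsoc' hgm hg)
    refine ⟨fun i hi => hcm i ?_, fun d' hd' => ?_⟩
    · rw [hdim] at hi
      exact_mod_cast hi
    · obtain rfl : d' = d := by
        rw [hdim] at hd'
        exact_mod_cast hd'.symm
      rw [hlen, hir]
  · obtain ⟨u, hmu, hu⟩ := hseq.exists_socle_pair (by omega) hsoc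
    exact absurd hu (h u hmu)

theorem exists_socle_generator_of_isGorensteinLocal (hG : IsGorensteinLocal R) {x : Fin d → R}
    (hx : IsSOP R R x) : IsCSOP R R x ∧
      (∀ s < d, ∀ u, extendZero x s * u ∈ headIdeal (extendZero x) s →
        u ∈ headIdeal (extendZero x) s) ∧ irMod R R (headIdeal (extendZero x) d) = 1 ∧
      ∃ w, (∀ t ∈ maximalIdeal R, t * w ∈ headIdeal (extendZero x) d) ∧
        w ∉ headIdeal (extendZero x) d ∧
          colonIdeal R (headIdeal (extendZero x) d) = headIdeal (extendZero x) d ⊔ Ideal.span {w} := by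
  obtain ⟨hdim, hxm, -⟩ := isSOP_self_iff.1 hx
  have hcm : ∀ i < d, Subsingleton (Hmod R R i) := fun i hi => hG.1 i (by
    rw [hdim]
    exact_mod_cast hi)
  have hreg := regular_of_isSOP hx hcm
  obtain ⟨k, hk⟩ := exists_maximalIdeal_pow_le hx
  have hir := (rLength_eq_irMod (fun i hi => by
    rw [extendZero_of_lt x hi]
    exact hxm _) hreg hk).2
  rw [hG.2 d hdim] at hir
  exact ⟨isCSOP_of_isSOP hx hcm, hreg, hir.symm, exists_colonIdeal_eq_of_irMod_eq_one hir.symm⟩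

end Gorenstein

end CParam

/-- For `R` unmixed of dimension `d ≥ 2`, TFAE: (1) `R` is Gorenstein;
(2) `𝒩(R) = 1` (for some C-parameter ideal);
(3) `f_0(q, R) = 1` for some C-parameter ideal `q`;
(4) `e_1(q :_R m, R) - e_1(q, R) = 1` for some C-parameter ideal `q ⊆ m^(g(R))`. -/
theorem statement_8 {R : Type u} [CommRing R] [IsLocalRing R] [IsNoetherianRing R]
    (hres : IsHomImageOfCM R)
    (d : ℕ) (hd : 2 ≤ d) (hdim : ringKrullDim R = (d : WithBot ℕ∞))
    (hum : IsUnmixedRing R)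
    (NR : ℕ) (hNR : IsStableValue R NR) :
    (IsGorensteinLocal R ↔ (∃ q : Ideal R, IsCParamIdeal R q) ∧ NR = 1) ∧
    (IsGorensteinLocal R ↔ ∃ q : Ideal R, IsCParamIdeal R q ∧
        ∃ f : ℕ → ℤ, IsIrrCoeff R q d f ∧ f 0 = 1) ∧
    (IsGorensteinLocal R ↔ ∃ q : Ideal R, IsCParamIdeal R q ∧
        q ≤ maximalIdeal R ^ gInvariant R ∧
        ∃ e e' : ℕ → ℤ, IsHilbCoeff R (colonIdeal R q) d e ∧ IsHilbCoeff R q d e' ∧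
          e 1 - e' 1 = 1) := by
  have hd0 : 0 < d := by omega
  obtain ⟨x, hx, hxm⟩ := CParam.exists_isSOP_mem_pow hdim (max 2 (gInvariant R))
  have hqm := CParam.headIdeal_le_maximalIdeal hx
  have hqpow {N : ℕ} (hN : N ≤ max 2 (gInvariant R)) :
      CParam.headIdeal (CParam.extendZero x) d ≤ maximalIdeal R ^ N := by
    rw [CParam.headIdeal_extendZero, Ideal.span_le]
    rintro _ ⟨i, rfl⟩
    exact Ideal.pow_le_pow_right hN (hxm i)
  have hparam (h : IsCSOP R R x) : IsCParamIdeal R (CParam.headIdeal (CParam.extendZero x) d) :=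
    ⟨d, x, h, CParam.headIdeal_extendZero x⟩
  refine ⟨⟨fun hG => ?_, ?_⟩, ⟨fun hG => ?_, ?_⟩, ⟨fun hG => ?_, ?_⟩⟩
  · obtain ⟨hC, -, hir, -⟩ := CParam.exists_socle_generator_of_isGorensteinLocal hG hx
    refine ⟨⟨_, hparam hC⟩, ?_⟩
    have h := hNR _ (hparam hC)
    rw [hir] at h
    exact_mod_cast h.symm
  · rintro ⟨⟨q, hq⟩, rfl⟩
    obtain ⟨y, hy, rfl⟩ := CParam.exists_isCSOP_of_isCParamIdeal hdim hq
    exact CParam.isGorensteinLocal_of_isCSOP hd hum hy fun u hmu hu =>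
      (CParam.isCSeq_of_isCSOP hy).irMod_ne_one hd0 hmu hu (hNR _ hq)
  · obtain ⟨hC, hreg, -, w, hw, hwq, hcol⟩ :=
      CParam.exists_socle_generator_of_isGorensteinLocal hG hx
    exact ⟨_, hparam hC, _, (CParam.isCSeq_of_isCSOP hC).isIrrCoeff_single hd0
      (hreg (d - 1) (by omega)) hqm hw hwq hcol, rfl⟩
  · rintro ⟨q, hq, f, hf, hf0⟩
    obtain ⟨y, hy, rfl⟩ := CParam.exists_isCSOP_of_isCParamIdeal hdim hq
    exact CParam.isGorensteinLocal_of_isCSOP hd hum hy fun u hmu hu =>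
      (CParam.isCSeq_of_isCSOP hy).irr_coeff_ne_one hd0 hmu hu hf hf0
  · obtain ⟨hC, hreg, -, w, hw, hwq, hcol⟩ :=
      CParam.exists_socle_generator_of_isGorensteinLocal hG hx
    obtain ⟨k, hk⟩ := CParam.exists_maximalIdeal_pow_le hx
    refine ⟨_, hparam hC, hqpow (le_max_right _ _),
      (CParam.isCSeq_of_isCSOP hC).exists_hilbCoeff hd0 (hreg (d - 1) (by omega))
        (hqpow (le_max_left _ _)) (fun t ht => ?_) hw hcol hwq hk⟩
    have h1 := CParam.ringKrullDim_le_ncard (R := R) (Set.finite_singleton t)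
      (by rw [ht]; exact Ideal.subset_span) (by rw [ht]; exact Ideal.le_radical)
    rw [Set.ncard_singleton, hdim] at h1
    have h2 : d ≤ 1 := by exact_mod_cast h1
    omega
  · rintro ⟨q, hq, -, e, e', he, he', h1⟩
    obtain ⟨y, hy, rfl⟩ := CParam.exists_isCSOP_of_isCParamIdeal hdim hq
    exact CParam.isGorensteinLocal_of_isCSOP hd hum hy fun u hmu hu =>
      (CParam.isCSeq_of_isCSOP hy).chern_sub_ne_one hd0 hmu hu he' he h1
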